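/- arXiv:1305.4291 — 2 statements merged into one kernel-verified Lean document; each statement's English description precedes it below -/
import Mathlib

section
/- Rotation symmetry of the tetrahedral weight: for positive reals a, c with b := 1/2 − a − c > 0 and all real x, y, one has g_{a,c}(x, y) = e^{iπ/12} · g_{b,a}(y − x − 1/2, −x) · e^{πix/2}, where g_{b,a} is the function g with parameter pair (b, a); equivalently g_{a,c}(x,y) = e^{−iπ/12} · g_{c,b}(−y, x − y + 1/2) · e^{πiy/2}. -/
open Real MeasureTheory

noncomputable section

/-- `c_𝖻 = i(𝖻 + 𝖻⁻¹)/2`. -/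
def cB (bb : ℝ) : ℂ := Complex.I * (bb + bb⁻¹) / 2

/-- The integrand in the definition of Faddeev's quantum dilogarithm. -/
def phiKer (bb : ℝ) (z w : ℂ) : ℂ :=
  Complex.exp (-2 * Complex.I * z * w) /
    (4 * Complex.sinh (w * bb) * Complex.sinh (w / bb) * w)

/-- Faddeev's quantum dilogarithm on the strip `|Im z| < Im c_𝖻`, defined by the
contour integral over `ℝ + iε` with `ε = π·min(𝖻,𝖻⁻¹)/2`. -/
def PhiS (bb : ℝ) (z : ℂ) : ℂ :=
  Complex.exp (∫ t : ℝ, phiKer bb z (t + Complex.I * (π * min bb bb⁻¹ / 2)))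

/-- The factor appearing in the functional equation:
`Φ_𝖻(z) = Efac 𝖻 z · Φ_𝖻(z + i𝖻)`. -/
def Efac (bb : ℝ) (z : ℂ) : ℂ := 1 + Complex.exp (2 * π * bb * (z + Complex.I * bb / 2))

/-- Number of upward shifts by `i𝖻` needed to bring `z` into the strip. -/
def nUp (bb : ℝ) (z : ℂ) : ℕ := ⌊(-((bb + bb⁻¹) / 2) - z.im) / bb⌋₊ + 1

/-- Number of downward shifts by `i𝖻` needed to bring `z` into the strip. -/
def nDn (bb : ℝ) (z : ℂ) : ℕ := ⌊(z.im - (bb + bb⁻¹) / 2) / bb⌋₊ + 1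

/-- Faddeev's quantum dilogarithm `Φ_𝖻`, extended from the strip `|Im z| < Im c_𝖻`
to all of `ℂ` as a meromorphic function by the functional equation
`Φ_𝖻(z - i𝖻/2) = (1 + e^{2π𝖻z}) Φ_𝖻(z + i𝖻/2)`. -/
def Phi (bb : ℝ) (z : ℂ) : ℂ :=
  if z.im ≤ -((bb + bb⁻¹) / 2) then
    (∏ k ∈ Finset.range (nUp bb z), Efac bb (z + Complex.I * k * bb)) *
      PhiS bb (z + Complex.I * (nUp bb z) * bb)
  else if (bb + bb⁻¹) / 2 ≤ z.im then
    PhiS bb (z - Complex.I * (nDn bb z) * bb) /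
      ∏ k ∈ Finset.range (nDn bb z), Efac bb (z - Complex.I * (k + 1) * bb)
  else PhiS bb z

/-- `ψ_{a,c}(t) = Φ_𝖻(t - 2c_𝖻(a+c))⁻¹ e^{-4πi c_𝖻 a (t - c_𝖻(a+c))} e^{-πi c_𝖻²(4(a-c)+1)/6}`. -/
def psiF (bb a c : ℝ) (t : ℂ) : ℂ :=
  (Phi bb (t - 2 * cB bb * (a + c)))⁻¹ *
    Complex.exp (-4 * π * Complex.I * cB bb * a * (t - cB bb * (a + c))) *
    Complex.exp (-π * Complex.I * (cB bb) ^ 2 * (4 * (a - c) + 1) / 6)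

/-- `ψ̄_{a,c}(t) = Φ_𝖻(t + 2c_𝖻(a+c)) e^{-4πi c_𝖻 a (t + c_𝖻(a+c))} e^{πi c_𝖻²(4(a-c)+1)/6}`. -/
def psiBar (bb a c : ℝ) (t : ℂ) : ℂ :=
  Phi bb (t + 2 * cB bb * (a + c)) *
    Complex.exp (-4 * π * Complex.I * cB bb * a * (t + cB bb * (a + c))) *
    Complex.exp (π * Complex.I * (cB bb) ^ 2 * (4 * (a - c) + 1) / 6)

/-- `ψ̃_{a,c}(s) = ∫_ℝ ψ_{a,c}(t) e^{-2πi s t} dt`. -/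
def psiT (bb a c : ℝ) (s : ℝ) : ℂ :=
  ∫ t : ℝ, psiF bb a c t * Complex.exp (-2 * π * Complex.I * s * t)

/-- `ψ̃′_{a,c}(s) = e^{-πi s²} ψ̃_{a,c}(s)`. -/
def psiT' (bb a c : ℝ) (s : ℝ) : ℂ :=
  Complex.exp (-π * Complex.I * s ^ 2) * psiT bb a c s

/-- `g_{a,c}(s,t) = Σ_{m∈ℤ} ψ̃′_{a,c}(s+m) e^{iπ t (s+2m)}`. -/
def gW (bb a c : ℝ) (s t : ℝ) : ℂ :=
  ∑' m : ℤ, psiT' bb a c (s + m) * Complex.exp (Complex.I * π * t * (s + 2 * m))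

section GeneralAnalysis
open Filter Topology

/-- A continuous function with exponential decay at both ends is integrable. -/
lemma integrable_of_exp_decay {E : Type*} [NormedAddCommGroup E] {m : ℝ → E}
    (hm : Continuous m) {C p q : ℝ} (hp : 0 < p) (hq : 0 < q)
    (h₁ : ∀ t, 0 ≤ t → ‖m t‖ ≤ C * Real.exp (-p * t))
    (h₂ : ∀ t, t ≤ 0 → ‖m t‖ ≤ C * Real.exp (q * t)) : Integrable m := by
  rw [← integrableOn_univ, ← Set.Iic_union_Ioi (a := (0 : ℝ))]
  refine IntegrableOn.union ?_ ?_
  · have h : IntegrableOn (fun t : ℝ => C * Real.exp (q * t)) (Set.Iic 0) :=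
      (integrableOn_exp_mul_Iic hq 0).const_mul C
    refine Integrable.mono' h hm.aestronglyMeasurable ?_
    filter_upwards [ae_restrict_mem measurableSet_Iic] with t ht using h₂ t ht
  · have h : IntegrableOn (fun t : ℝ => C * Real.exp (-p * t)) (Set.Ioi 0) :=
      (integrableOn_exp_mul_Ioi (by linarith) 0).const_mul C
    refine Integrable.mono' h hm.aestronglyMeasurable ?_
    filter_upwards [ae_restrict_mem measurableSet_Ioi] with t ht using h₁ t (le_of_lt ht)

lemma norm_cexp_mul_ofReal (ζ : ℂ) (t : ℝ) :
    ‖Complex.exp (ζ * t)‖ = Real.exp (ζ.re * t) := by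
  rw [Complex.norm_exp]; simp

/-- Differentiation of a two-sided Laplace transform inside its strip of convergence. -/
lemma hasDerivAt_laplace {m : ℝ → ℂ} (hm : Continuous m) {α β : ℝ}
    (hint : ∀ ξ ∈ Set.Ioo α β, Integrable fun t : ℝ => m t * Complex.exp ((ξ : ℂ) * t))
    {ζ : ℂ} (hζ : ζ.re ∈ Set.Ioo α β) :
    Integrable (fun t : ℝ => m t * Complex.exp (ζ * t)) ∧
    Integrable (fun t : ℝ => m t * (t * Complex.exp (ζ * t))) ∧
    HasDerivAt (fun ζ : ℂ => ∫ t : ℝ, m t * Complex.exp (ζ * t))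
      (∫ t : ℝ, m t * (t * Complex.exp (ζ * t))) ζ := by
  have hmeas : ∀ ζ : ℂ, AEStronglyMeasurable (fun t : ℝ => m t * Complex.exp (ζ * t)) volume :=
    fun ζ => (by fun_prop : Continuous fun t : ℝ => m t * Complex.exp (ζ * t)).aestronglyMeasurable
  have hI : ∀ ζ : ℂ, ζ.re ∈ Set.Ioo α β →
      Integrable (fun t : ℝ => m t * Complex.exp (ζ * t)) := by
    intro ζ hζ
    refine (hint _ hζ).mono (hmeas _) (Eventually.of_forall fun t => le_of_eq ?_)
    rw [norm_mul, norm_mul, norm_cexp_mul_ofReal, norm_cexp_mul_ofReal, Complex.ofReal_re]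
  obtain ⟨r, hr, hr1, hr2⟩ : ∃ r > 0, ζ.re - 2 * r ∈ Set.Ioo α β ∧ ζ.re + 2 * r ∈ Set.Ioo α β := by
    refine ⟨min (ζ.re - α) (β - ζ.re) / 4, ?_, ?_, ?_⟩
    · have := lt_min (sub_pos.2 hζ.1) (sub_pos.2 hζ.2); linarith
    all_goals
      have h1 := min_le_left (ζ.re - α) (β - ζ.re)
      have h2 := min_le_right (ζ.re - α) (β - ζ.re)
      have h3 := lt_min (sub_pos.2 hζ.1) (sub_pos.2 hζ.2)
      constructor <;> linarith [hζ.1, hζ.2]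
  have hbi : Integrable (fun t : ℝ => r⁻¹ * (‖m t * Complex.exp (((ζ.re - 2 * r : ℝ) : ℂ) * t)‖
      + ‖m t * Complex.exp (((ζ.re + 2 * r : ℝ) : ℂ) * t)‖)) :=
    (((hint _ hr1).norm).add ((hint _ hr2).norm)).const_mul _
  have key := hasDerivAt_integral_of_dominated_loc_of_deriv_le (μ := volume)
    (F := fun (ζ : ℂ) (t : ℝ) => m t * Complex.exp (ζ * t))
    (F' := fun (ζ : ℂ) (t : ℝ) => m t * (t * Complex.exp (ζ * t)))
    (x₀ := ζ) (s := Metric.ball ζ r) (Metric.ball_mem_nhds _ hr)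
    (Eventually.of_forall hmeas) (hI ζ hζ)
    (by fun_prop : Continuous fun t : ℝ => m t * (t * Complex.exp (ζ * t))).aestronglyMeasurable
    (bound := fun t : ℝ => r⁻¹ * (‖m t * Complex.exp (((ζ.re - 2 * r : ℝ) : ℂ) * t)‖
      + ‖m t * Complex.exp (((ζ.re + 2 * r : ℝ) : ℂ) * t)‖)) ?_ hbi ?_
  · exact ⟨hI ζ hζ, key⟩
  · refine Eventually.of_forall fun t z hz => ?_
    have hz' : |z.re - ζ.re| < r := by
      rw [← Complex.sub_re]
      exact (Complex.abs_re_le_norm _).trans_lt (by simpa [dist_eq_norm] using hz)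
    obtain ⟨hz1, hz2⟩ := abs_lt.1 hz'
    simp only [norm_mul, norm_cexp_mul_ofReal, Complex.ofReal_re, Complex.norm_real,
      Real.norm_eq_abs]
    have ht : |t| ≤ r⁻¹ * Real.exp (r * |t|) := by
      rw [inv_mul_eq_div, le_div_iff₀ hr]
      linarith [Real.add_one_le_exp (r * |t|)]
    have h2 : Real.exp (r * |t|) * Real.exp (z.re * t) ≤
        Real.exp ((ζ.re - 2 * r) * t) + Real.exp ((ζ.re + 2 * r) * t) := by
      rw [← Real.exp_add]
      rcases le_total 0 t with h | h
      · refine le_add_of_nonneg_of_le (Real.exp_nonneg _) (Real.exp_le_exp.2 ?_)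
        rw [abs_of_nonneg h]; nlinarith
      · refine le_add_of_le_of_nonneg (Real.exp_le_exp.2 ?_) (Real.exp_nonneg _)
        rw [abs_of_nonpos h]; nlinarith
    calc ‖m t‖ * (|t| * Real.exp (z.re * t))
        ≤ ‖m t‖ * ((r⁻¹ * Real.exp (r * |t|)) * Real.exp (z.re * t)) := by gcongr
      _ = ‖m t‖ * (r⁻¹ * (Real.exp (r * |t|) * Real.exp (z.re * t))) := by ring
      _ ≤ ‖m t‖ * (r⁻¹ * (Real.exp ((ζ.re - 2 * r) * t) + Real.exp ((ζ.re + 2 * r) * t))) := by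
          gcongr
      _ = _ := by ring
  · refine Eventually.of_forall fun t z _ => ?_
    have h := (((hasDerivAt_id z).mul_const (t : ℂ)).cexp).const_mul (m t)
    convert! h using 1
    simp only [id]; ring

/-- Integrals of a holomorphic function along two horizontal lines agree in the limit, provided
that the function decays at both ends of the strip between them. -/
lemma tendsto_horizontal_sub {F : ℂ → ℂ} {y₁ y₂ : ℝ}
    (hF : ∀ z : ℂ, z.im ∈ Set.uIcc y₁ y₂ → DifferentiableAt ℂ F z)
    {B : ℝ → ℝ} (hB : ∀ t : ℝ, 1 ≤ |t| → ∀ y ∈ Set.uIcc y₁ y₂, ‖F (t + y * Complex.I)‖ ≤ B t)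
    (hBt : Tendsto B atTop (𝓝 0)) (hBb : Tendsto B atBot (𝓝 0)) :
    Tendsto (fun l : ℝ => (∫ t : ℝ in -l..l, F (t + y₁ * Complex.I)) -
      ∫ t : ℝ in -l..l, F (t + y₂ * Complex.I)) atTop (𝓝 0) := by
  have hside : ∀ l : ℝ, 1 ≤ |l| →
      ‖∫ y : ℝ in y₁..y₂, F (l + y * Complex.I)‖ ≤ B l * |y₂ - y₁| := fun l hl =>
    intervalIntegral.norm_integral_le_of_norm_le_const fun y hy =>
      hB l hl y (Set.uIoc_subset_uIcc hy)
  have heq : ∀ l : ℝ, (∫ t : ℝ in -l..l, F (t + y₁ * Complex.I)) -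
      (∫ t : ℝ in -l..l, F (t + y₂ * Complex.I)) =
      Complex.I * (∫ y : ℝ in y₁..y₂, F ((-l : ℝ) + y * Complex.I)) -
      Complex.I * (∫ y : ℝ in y₁..y₂, F (l + y * Complex.I)) := by
    intro l
    have h := Complex.integral_boundary_rect_eq_zero_of_differentiableOn F
      ⟨-l, y₁⟩ ⟨l, y₂⟩ (fun z hz => (hF z (Complex.mem_reProdIm.1 hz).2).differentiableWithinAt)
    simp only [smul_eq_mul] at h
    linear_combination h
  refine squeeze_zero_norm' (a := fun l => B (-l) * |y₂ - y₁| + B l * |y₂ - y₁|) ?_ ?_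
  · filter_upwards [eventually_ge_atTop (1 : ℝ)] with l hl
    have hl' : 1 ≤ |l| := hl.trans (le_abs_self l)
    rw [heq]
    refine (norm_sub_le _ _).trans ?_
    simp only [norm_mul, Complex.norm_I, one_mul]
    exact add_le_add (hside (-l) (by rwa [abs_neg])) (hside l hl')
  · simpa using ((hBb.comp tendsto_neg_atTop_atBot).mul_const _).add (hBt.mul_const |y₂ - y₁|)

/-- Shifting the contour of integration between two horizontal lines. -/
lemma integral_horizontal_eq {F : ℂ → ℂ} {y₁ y₂ : ℝ}
    (hF : ∀ z : ℂ, z.im ∈ Set.uIcc y₁ y₂ → DifferentiableAt ℂ F z)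
    {B : ℝ → ℝ} (hB : ∀ t : ℝ, 1 ≤ |t| → ∀ y ∈ Set.uIcc y₁ y₂, ‖F (t + y * Complex.I)‖ ≤ B t)
    (hBt : Tendsto B atTop (𝓝 0)) (hBb : Tendsto B atBot (𝓝 0))
    (h₁ : Integrable fun t : ℝ => F (t + y₁ * Complex.I))
    (h₂ : Integrable fun t : ℝ => F (t + y₂ * Complex.I)) :
    ∫ t : ℝ, F (t + y₁ * Complex.I) = ∫ t : ℝ, F (t + y₂ * Complex.I) := by
  have h := (intervalIntegral_tendsto_integral h₁ tendsto_neg_atTop_atBot tendsto_id).sub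
    (intervalIntegral_tendsto_integral h₂ tendsto_neg_atTop_atBot tendsto_id)
  exact sub_eq_zero.1 (tendsto_nhds_unique h (tendsto_horizontal_sub hF hB hBt hBb))

/-- The integral of a function along `ℝ + iε` whose principal part at `0` is `α / w³ + β / w` and
whose regular part is odd. -/
lemma integral_horizontal_of_odd {r k : ℂ → ℂ} {ε : ℝ} (hε : 0 < ε) {α β : ℂ}
    (hr : ∀ z : ℂ, z.im ∈ Set.Icc 0 ε → DifferentiableAt ℂ r z)
    (hodd : ∀ t : ℝ, r (-t) = -r t)
    {B : ℝ → ℝ} (hB : ∀ t : ℝ, 1 ≤ |t| → ∀ y ∈ Set.Icc 0 ε, ‖r (t + y * Complex.I)‖ ≤ B t)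
    (hBt : Tendsto B atTop (𝓝 0)) (hBb : Tendsto B atBot (𝓝 0))
    (hk : ∀ t : ℝ, k (t + ε * Complex.I) = r (t + ε * Complex.I) +
      α / (t + ε * Complex.I) ^ 3 + β / (t + ε * Complex.I))
    (hint : Integrable fun t : ℝ => k (t + ε * Complex.I)) :
    ∫ t : ℝ, k (t + ε * Complex.I) = -(π * Complex.I * β) := by
  have huIcc : Set.uIcc 0 ε = Set.Icc 0 ε := Set.uIcc_of_le hε.le
  have h0 : ∀ l : ℝ, ∫ t : ℝ in -l..l, r (t + (0 : ℝ) * Complex.I) = 0 := by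
    intro l
    have h := intervalIntegral.integral_comp_neg (a := -l) (b := l)
      (fun t : ℝ => r (t + (0 : ℝ) * Complex.I))
    simp only [neg_neg, Complex.ofReal_zero, zero_mul, add_zero, Complex.ofReal_neg, hodd] at h ⊢
    rw [intervalIntegral.integral_neg] at h
    exact self_eq_neg.1 h.symm
  have hr0 : Tendsto (fun l : ℝ => ∫ t : ℝ in -l..l, r (t + ε * Complex.I)) atTop (𝓝 0) := by
    have h := tendsto_horizontal_sub (y₁ := 0) (y₂ := ε) (by rwa [huIcc]) (by rwa [huIcc]) hBt hBb
    simp only [h0, zero_sub] at h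
    simpa using h.neg
  have hne : ∀ t : ℝ, (t + ε * Complex.I : ℂ) ≠ 0 := fun t h => by
    have := congrArg Complex.im h; simp at this; exact hε.ne' this
  have hslit : ∀ t : ℝ, (t + ε * Complex.I : ℂ) ∈ Complex.slitPlane := fun t => by
    right; simpa using hε.ne'
  have hw : ∀ t : ℝ, HasDerivAt (fun t : ℝ => (t + ε * Complex.I : ℂ)) 1 t := fun t => by
    simpa using (Complex.ofRealCLM.hasDerivAt (x := t)).add_const (ε * Complex.I)
  have hc : Continuous fun t : ℝ => (t + ε * Complex.I : ℂ) := by fun_prop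
  have hi1 : ∀ l : ℝ, ∫ t : ℝ in -l..l, (t + ε * Complex.I : ℂ)⁻¹ =
      Complex.log (l + ε * Complex.I) - Complex.log ((-l : ℝ) + ε * Complex.I) := fun l =>
    intervalIntegral.integral_eq_sub_of_hasDerivAt
      (f := fun t : ℝ => Complex.log (t + ε * Complex.I))
      (fun t _ => by simpa using (hw t).clog_real (hslit t))
      ((hc.inv₀ hne).intervalIntegrable _ _)
  have hi3 : ∀ l : ℝ, ∫ t : ℝ in -l..l, ((t + ε * Complex.I : ℂ) ^ 3)⁻¹ =
      -((l + ε * Complex.I : ℂ) ^ 2)⁻¹ / 2 - -(((-l : ℝ) + ε * Complex.I : ℂ) ^ 2)⁻¹ / 2 := fun l =>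
    intervalIntegral.integral_eq_sub_of_hasDerivAt
      (f := fun t : ℝ => -((t + ε * Complex.I : ℂ) ^ 2)⁻¹ / 2)
      (fun t _ => by
        have h := ((((hw t).pow 2).inv (pow_ne_zero 2 (hne t))).neg).div_const 2
        convert! h using 1
        have := hne t
        simp only [Pi.pow_apply]
        field_simp
        norm_num
        ring)
      (((hc.pow 3).inv₀ fun t => pow_ne_zero 3 (hne t)).intervalIntegrable _ _)
  have hnorm : Tendsto (fun l : ℝ => ‖(l + ε * Complex.I : ℂ)‖) atTop atTop := by
    refine tendsto_atTop_mono (fun l => ?_) tendsto_id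
    have h := Complex.re_le_norm (l + ε * Complex.I : ℂ)
    simpa using h
  have hnorm_eq : ∀ l : ℝ, ‖((-l : ℝ) + ε * Complex.I : ℂ)‖ = ‖(l + ε * Complex.I : ℂ)‖ := by
    intro l
    rw [Complex.norm_add_mul_I, Complex.norm_add_mul_I, neg_sq]
  have hl1 : Tendsto (fun l : ℝ => ∫ t : ℝ in -l..l, (t + ε * Complex.I : ℂ)⁻¹) atTop
      (𝓝 (-(π * Complex.I))) := by
    have has : Tendsto (fun l : ℝ => Real.arcsin (ε / ‖(l + ε * Complex.I : ℂ)‖)) atTop (𝓝 0) := by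
      have h := (Real.continuous_arcsin.tendsto 0).comp (hnorm.const_div_atTop ε)
      simpa [Function.comp_def] using h
    have h : Tendsto (fun l : ℝ =>
        ((2 * Real.arcsin (ε / ‖(l + ε * Complex.I : ℂ)‖) - π : ℝ) : ℂ) * Complex.I) atTop
        (𝓝 (((2 * 0 - π : ℝ) : ℂ) * Complex.I)) :=
      ((Complex.continuous_ofReal.tendsto _).comp ((has.const_mul 2).sub_const π)).mul_const _
    have h' : (((2 * 0 - π : ℝ) : ℂ) * Complex.I) = -(π * Complex.I) := by push_cast; ring
    rw [h'] at h
    refine h.congr' ?_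
    filter_upwards [eventually_gt_atTop 0] with l hl
    rw [hi1, Complex.log, Complex.log, hnorm_eq, Complex.arg_of_re_nonneg (by simpa using hl.le),
      Complex.arg_of_re_neg_of_im_nonneg (by simpa using hl) (by simpa using hε.le), hnorm_eq]
    simp [neg_div, Real.arcsin_neg]
    ring
  have hl3 : Tendsto (fun l : ℝ => ∫ t : ℝ in -l..l, ((t + ε * Complex.I : ℂ) ^ 3)⁻¹) atTop
      (𝓝 0) := by
    have h : Tendsto (fun l : ℝ => (‖(l + ε * Complex.I : ℂ)‖ ^ 2)⁻¹) atTop (𝓝 0) :=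
      ((tendsto_pow_atTop two_ne_zero).comp hnorm).inv_tendsto_atTop
    refine squeeze_zero_norm (fun l => ?_) h
    rw [hi3]
    refine (norm_sub_le _ _).trans (le_of_eq ?_)
    simp only [norm_div, norm_neg, norm_inv, norm_pow, hnorm_eq]
    norm_num
  have hsum : Tendsto (fun l : ℝ => ∫ t : ℝ in -l..l, k (t + ε * Complex.I)) atTop
      (𝓝 (0 + α * 0 + β * -(π * Complex.I))) := by
    refine ((hr0.add (hl3.const_mul α)).add (hl1.const_mul β)).congr fun l => ?_
    have hri : IntervalIntegrable (fun t : ℝ => r (t + ε * Complex.I)) volume (-l) l := by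
      refine Continuous.intervalIntegrable ?_ _ _
      refine continuous_iff_continuousAt.2 fun t => ?_
      exact ContinuousAt.comp (g := r)
        (hr (t + ε * Complex.I) (by simpa using hε.le)).continuousAt hc.continuousAt
    have hi3' : IntervalIntegrable (fun t : ℝ => α * ((t + ε * Complex.I : ℂ) ^ 3)⁻¹) volume
      (-l) l := (((hc.pow 3).inv₀ fun t => pow_ne_zero 3 (hne t)).intervalIntegrable
      (μ := volume) (-l) l).const_mul α
    have hi1' : IntervalIntegrable (fun t : ℝ => β * (t + ε * Complex.I : ℂ)⁻¹) volume
      (-l) l := ((hc.inv₀ hne).intervalIntegrable (μ := volume) (-l) l).const_mul β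
    simp only [hk, div_eq_mul_inv]
    rw [intervalIntegral.integral_add (hri.add hi3') hi1', intervalIntegral.integral_add hri hi3',
      intervalIntegral.integral_const_mul, intervalIntegral.integral_const_mul]
  have hlim := intervalIntegral_tendsto_integral hint tendsto_neg_atTop_atBot tendsto_id
  rw [tendsto_nhds_unique hlim hsum]
  ring
end GeneralAnalysis

section SpecialIntegrals
open Filter Topology

/-- The two-sided Laplace transform of the hyperbolic secant. -/
lemma integral_cexp_div_cosh {ζ : ℂ} (hζ : |ζ.re| < 1) :
    ∫ t : ℝ, Complex.exp (ζ * t) / Complex.cosh t = π / Complex.cos (π * ζ / 2) := by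
  obtain ⟨h1, h2⟩ := abs_lt.1 hζ
  set u : ℂ := (1 + ζ) / 2 with hu
  set v : ℂ := (1 - ζ) / 2 with hv
  have hu0 : 0 < u.re := by simp [hu]; linarith
  have hv0 : 0 < v.re := by simp [hv]; linarith
  have huv : u + v = 1 := by rw [hu, hv]; ring
  have hbeta : Complex.betaIntegral u v = π / Complex.cos (π * ζ / 2) := by
    have h := Complex.Gamma_mul_Gamma_eq_betaIntegral hu0 hv0
    rw [huv, Complex.Gamma_one, one_mul, show v = 1 - u by rw [← huv]; ring,
      Complex.Gamma_mul_Gamma_one_sub] at h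
    rw [show v = 1 - u by rw [← huv]; ring, ← h]
    congr 1
    rw [hu, show (π * ((1 + ζ) / 2) : ℂ) = π * ζ / 2 + π / 2 by ring, Complex.sin_add_pi_div_two]
  have hderiv : ∀ t ∈ Set.univ, HasDerivWithinAt (fun t : ℝ => Real.sigmoid (2 * t))
      (2 * (Real.sigmoid (2 * t) * (1 - Real.sigmoid (2 * t)))) Set.univ t := by
    intro t _
    have h := (hasDerivAt_sigmoid (2 * t)).comp t ((hasDerivAt_id t).const_mul 2)
    convert! h.hasDerivWithinAt using 1
    simp; ring
  have hinj : Set.InjOn (fun t : ℝ => Real.sigmoid (2 * t)) Set.univ := fun s _ t _ h => by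
    have := Real.sigmoid_injective h; linarith
  have himage : (fun t : ℝ => Real.sigmoid (2 * t)) '' Set.univ = Set.Ioo 0 1 := by
    rw [Set.image_univ, ← Real.range_sigmoid]
    exact (mul_left_surjective₀ (two_ne_zero' ℝ)).range_comp Real.sigmoid
  have h := integral_image_eq_integral_abs_deriv_smul MeasurableSet.univ hderiv hinj
    (fun x : ℝ => (x : ℂ) ^ (u - 1) * (1 - (x : ℂ)) ^ (v - 1))
  rw [← hbeta, Complex.betaIntegral, intervalIntegral.integral_of_le zero_le_one,
    integral_Ioc_eq_integral_Ioo, ← himage, h, setIntegral_univ]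
  refine integral_congr_ae (Eventually.of_forall fun t => ?_)
  have hch : 0 < Real.cosh t := Real.cosh_pos t
  have hx : Real.sigmoid (2 * t) = Real.exp (t - Real.log (2 * Real.cosh t)) := by
    rw [Real.exp_sub, Real.exp_log (by positivity), Real.sigmoid_def, Real.cosh_eq,
      show -(2 * t) = -t + -t by ring, Real.exp_add, Real.exp_neg]
    have := Real.exp_pos t
    field_simp
  have hx' : 1 - Real.sigmoid (2 * t) = Real.exp (-t - Real.log (2 * Real.cosh t)) := by
    rw [← Real.sigmoid_neg, Real.exp_sub, Real.exp_log (by positivity), Real.sigmoid_def,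
      Real.cosh_eq, show -(-(2 * t)) = t + t by ring, Real.exp_add, Real.exp_neg]
    have := Real.exp_pos t
    field_simp
    ring
  have hxp : 0 < Real.sigmoid (2 * t) := Real.sigmoid_pos _
  have hxp' : 0 < 1 - Real.sigmoid (2 * t) := by linarith [Real.sigmoid_lt_one (2 * t)]
  have hcpow : ∀ (r : ℝ) (s : ℂ), ((Real.exp r : ℝ) : ℂ) ^ s = Complex.exp (r * s) := fun r s => by
    rw [Complex.cpow_def_of_ne_zero (by exact_mod_cast (Real.exp_pos r).ne'),
      ← Complex.ofReal_log (Real.exp_pos r).le, Real.log_exp]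
  have hlog : Complex.exp (-(Real.log (2 * Real.cosh t) : ℂ)) = (2 * Complex.cosh t)⁻¹ := by
    rw [Complex.exp_neg, ← Complex.ofReal_exp, Real.exp_log (by positivity)]
    push_cast; rfl
  beta_reduce
  rw [abs_of_pos (by positivity), ← Complex.ofReal_one, ← Complex.ofReal_sub, hx', hx, hcpow, hcpow,
    Complex.real_smul]
  push_cast
  have hcc : Complex.cosh t ≠ 0 := by
    rw [← Complex.ofReal_cosh]; exact_mod_cast hch.ne'
  have : ∀ A : ℂ, A / Complex.cosh t = 2 * (A * (2 * Complex.cosh t)⁻¹) := fun A => by field_simp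
  rw [this, ← hlog, mul_assoc, ← Complex.exp_add, ← Complex.exp_add, ← Complex.exp_add,
    ← Complex.exp_add]
  congr 2
  rw [hu, hv]
  ring

end SpecialIntegrals

section PeriodicLiouville
open Filter Topology Bornology

/-- A holomorphic function on a horizontal strip which is compatible with an imaginary period
smaller than the width of the strip extends to a periodic entire function. -/
lemma exists_entire_periodic_extension {g : ℂ → ℂ} {α β p : ℝ} (hp : 0 < p) (hw : p < β - α)
    (hg : ∀ z : ℂ, z.im ∈ Set.Ioo α β → DifferentiableAt ℂ g z)
    (hper : ∀ z : ℂ, α < z.im → z.im + p < β → g (z + p * Complex.I) = g z) :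
    ∃ G : ℂ → ℂ, Differentiable ℂ G ∧ (∀ z, G (z + p * Complex.I) = G z) ∧
      ∀ z : ℂ, z.im ∈ Set.Ioo α β → G z = g z := by
  have hper_nat : ∀ (n : ℕ) (z : ℂ), α < z.im → z.im + n * p < β →
      g (z + n * p * Complex.I) = g z := by
    intro n
    induction n with
    | zero => intro z _ _; simp
    | succ n ih =>
      intro z h1 h2
      push_cast at h2
      have h3 : z.im + n * p < β := by nlinarith
      rw [← ih z h1 h3, ← hper (z + n * p * Complex.I) (by simp; nlinarith [n.cast_nonneg (α := ℝ)])
        (by simp; linarith)]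
      congr 1; push_cast; ring
  have hper_int : ∀ (n : ℤ) (z : ℂ), z.im ∈ Set.Ioo α β → z.im + n * p ∈ Set.Ioo α β →
      g (z + n * p * Complex.I) = g z := by
    intro n z h1 h2
    obtain ⟨k, rfl | rfl⟩ := n.eq_nat_or_neg
    · exact_mod_cast hper_nat k z h1.1 (by simpa using h2.2)
    · have h := hper_nat k (z + (-(k : ℤ) : ℤ) * p * Complex.I) (by simpa using h2.1)
        (by simpa using h1.2)
      rw [← h]; congr 1; push_cast; ring
  let G : ℂ → ℂ := fun z => g (z - toIocDiv hp ((α + β - p) / 2) z.im * p * Complex.I)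
  have hGeq : ∀ (z : ℂ) (n : ℤ), z.im + n * p ∈ Set.Ioo α β → G z = g (z + n * p * Complex.I) := by
    intro z n hn
    have hmem := sub_toIocDiv_zsmul_mem_Ioc hp ((α + β - p) / 2) z.im
    simp only [zsmul_eq_mul] at hmem
    set d := toIocDiv hp ((α + β - p) / 2) z.im with hd
    have h := hper_int (-d - n) (z + n * p * Complex.I) (by simpa using hn) (by
      simp only [Complex.add_im, Complex.mul_im, Complex.I_im, Complex.I_re]
      simp
      constructor <;> linarith [hmem.1, hmem.2])
    rw [← h]
    simp only [G, ← hd]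
    congr 1; push_cast; ring
  refine ⟨G, fun z => ?_, fun z => ?_, fun z hz => ?_⟩
  · have hmem := sub_toIocDiv_zsmul_mem_Ioc hp ((α + β - p) / 2) z.im
    simp only [zsmul_eq_mul] at hmem
    set d := toIocDiv hp ((α + β - p) / 2) z.im with hd
    have hmem' : z.im + ((-d : ℤ) : ℝ) * p ∈ Set.Ioo α β := by
      push_cast; constructor <;> linarith [hmem.1, hmem.2]
    have hev : G =ᶠ[𝓝 z] fun x => g (x + ((-d : ℤ) : ℂ) * p * Complex.I) := by
      have : ∀ᶠ x : ℂ in 𝓝 z, x.im + ((-d : ℤ) : ℝ) * p ∈ Set.Ioo α β :=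
        (by fun_prop : Continuous fun x : ℂ => x.im + ((-d : ℤ) : ℝ) * p).continuousAt
          (isOpen_Ioo.mem_nhds hmem')
      filter_upwards [this] with x hx using hGeq x _ hx
    refine DifferentiableAt.congr_of_eventuallyEq ?_ hev
    refine DifferentiableAt.comp (g := g) z (hg _ ?_) (by fun_prop)
    simpa using hmem'
  · have hmem := sub_toIocDiv_zsmul_mem_Ioc hp ((α + β - p) / 2) z.im
    simp only [zsmul_eq_mul] at hmem
    set d := toIocDiv hp ((α + β - p) / 2) z.im with hd
    rw [hGeq z (-d) (by push_cast; constructor <;> linarith [hmem.1, hmem.2]),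
      hGeq (z + p * Complex.I) (-d - 1) (by
        simp; constructor <;> linarith [hmem.1, hmem.2])]
    congr 1; push_cast; ring
  · simpa using hGeq z 0 (by simpa using hz)

/-- A periodic entire function of growth smaller than `e^{2π Im z / p}` is bounded near `i∞`. -/
lemma bounded_of_periodic_of_growth {f : ℂ → ℂ} (hf : Differentiable ℂ f) {p : ℝ} (hp : 0 < p)
    (hper : Function.Periodic f p) {C κ : ℝ} (hκ : κ < 2 * π / p)
    (hgr : ∀ z : ℂ, 0 ≤ z.im → ‖f z‖ ≤ C * Real.exp (κ * z.im)) :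
    ∃ M A : ℝ, ∀ z : ℂ, A ≤ z.im → ‖f z‖ ≤ M := by
  let F : ℂ → ℂ := fun z => f z * Complex.exp (2 * π * Complex.I * z / p)
  have hpc : (p : ℂ) ≠ 0 := by exact_mod_cast hp.ne'
  have hFn : ∀ z : ℂ, ‖F z‖ = ‖f z‖ * Real.exp (-2 * π * z.im / p) := by
    intro z
    simp only [F, norm_mul, Complex.norm_exp]
    congr 2
    rw [Complex.div_ofReal_re]
    simp
  have hFper : Function.Periodic F p := by
    intro z
    simp only [F, hper z]
    congr 1
    rw [show 2 * π * Complex.I * (z + p) / p = 2 * π * Complex.I * z / p + 2 * π * Complex.I by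
      field_simp, Complex.exp_add, Complex.exp_two_pi_mul_I, mul_one]
  have hFd : Differentiable ℂ F := by
    have : Differentiable ℂ fun z : ℂ => Complex.exp (2 * π * Complex.I * z / p) := by fun_prop
    exact hf.mul this
  have hzero : ZeroAtFilter (comap Complex.im atTop) F := by
    have hlim : Tendsto (fun z : ℂ => C * Real.exp ((κ - 2 * π / p) * z.im))
        (comap Complex.im atTop) (𝓝 0) := by
      have h1 : Tendsto (fun y : ℝ => C * Real.exp ((κ - 2 * π / p) * y)) atTop (𝓝 (C * 0)) :=
        (Real.tendsto_exp_atBot.comp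
          (tendsto_id.const_mul_atTop_of_neg (by linarith))).const_mul C
      rw [mul_zero] at h1
      exact h1.comp tendsto_comap
    refine squeeze_zero_norm' ?_ hlim
    filter_upwards [tendsto_comap.eventually (eventually_ge_atTop (0 : ℝ))] with z hz
    rw [hFn]
    calc _ ≤ C * Real.exp (κ * z.im) * Real.exp (-2 * π * z.im / p) := by
          gcongr; exact hgr z hz
      _ = _ := by rw [mul_assoc, ← Real.exp_add]; congr 2; ring
  obtain ⟨M, hM⟩ := (hFper.exp_decay_of_zero_at_inf hp
    (Eventually.of_forall fun z => hFd z) hzero).bound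
  obtain ⟨A, hA⟩ := eventually_atTop.1 (eventually_comap.1 hM)
  refine ⟨M, A, fun z hz => ?_⟩
  have h := hA z.im hz z rfl
  rw [hFn, Real.norm_of_nonneg (Real.exp_nonneg _)] at h
  exact le_of_mul_le_mul_right h (Real.exp_pos _)

/-- An entire function with an imaginary period and moderate growth is constant. -/
lemma eq_const_of_periodic_of_growth {G : ℂ → ℂ} (hG : Differentiable ℂ G) {p : ℝ} (hp : 0 < p)
    (hper : ∀ z, G (z + p * Complex.I) = G z) {C κ σ : ℝ} (hκ : κ < 2 * π / p)
    (hgr : ∀ z : ℂ, z.im ∈ Set.Icc σ (σ + p) → ‖G z‖ ≤ C * Real.exp (κ * |z.re|)) (z w : ℂ) :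
    G z = G w := by
  have hgr' : ∀ z : ℂ, ‖G z‖ ≤ C * Real.exp (κ * |z.re|) := by
    intro z
    have hmem := sub_toIocDiv_zsmul_mem_Ioc hp σ z.im
    simp only [zsmul_eq_mul] at hmem
    set d := toIocDiv hp σ z.im
    have hP : Function.Periodic G (p * Complex.I) := hper
    have h := hP.sub_zsmul_eq (x := z) d
    simp only [zsmul_eq_mul] at h
    rw [← h]
    refine (hgr _ ?_).trans (le_of_eq ?_)
    · simpa using ⟨hmem.1.le, by simpa using hmem.2⟩
    · simp
  obtain ⟨M₁, A₁, h₁⟩ := bounded_of_periodic_of_growth (f := fun z => G (Complex.I * z))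
    (by fun_prop) hp (fun z => by simpa [mul_add, mul_comm] using hper (Complex.I * z)) (C := C) hκ
    (fun z hz => by simpa [abs_of_nonneg hz] using hgr' (Complex.I * z))
  obtain ⟨M₂, A₂, h₂⟩ := bounded_of_periodic_of_growth (f := fun z => G (-(Complex.I * z)))
    (by fun_prop) hp (fun z => by
      have := hper (-(Complex.I * (z + p)))
      beta_reduce
      rw [← this]; congr 1; ring) (C := C) hκ
    (fun z hz => by simpa [abs_of_nonneg hz] using hgr' (-(Complex.I * z)))
  refine hG.apply_eq_apply_of_bounded ?_ z w
  rw [isBounded_iff_forall_norm_le]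
  refine ⟨max (max M₁ M₂) (|C| * Real.exp (|κ| * max |A₁| |A₂|)), ?_⟩
  rintro _ ⟨z, rfl⟩
  rcases le_total A₁ (-z.re) with h | h
  · refine le_max_of_le_left (le_max_of_le_left ?_)
    have := h₁ (-(Complex.I * z)) (by simpa using h)
    rwa [show Complex.I * -(Complex.I * z) = z by
      rw [mul_neg, ← mul_assoc, Complex.I_mul_I]; ring] at this
  rcases le_total A₂ z.re with h' | h'
  · refine le_max_of_le_left (le_max_of_le_right ?_)
    have := h₂ (Complex.I * z) (by simpa using h')
    rwa [show -(Complex.I * (Complex.I * z)) = z by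
      rw [← mul_assoc, Complex.I_mul_I]; ring] at this
  refine le_max_of_le_right ((hgr' z).trans ?_)
  have hz : |z.re| ≤ max |A₁| |A₂| := by
    refine abs_le.2 ⟨?_, (h'.trans (le_abs_self _)).trans (le_max_right _ _)⟩
    have := (le_abs_self A₁).trans (le_max_left |A₁| |A₂|)
    linarith
  gcongr
  · exact le_abs_self C
  · exact le_abs_self κ

end PeriodicLiouville

section LogPhi
open Filter Topology

lemma sq_norm_sinh (z : ℂ) : ‖Complex.sinh z‖ ^ 2 = Real.sinh z.re ^ 2 + Real.sin z.im ^ 2 := by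
  have h : Complex.sinh z = (Real.sinh z.re * Real.cos z.im : ℝ) +
      (Real.cosh z.re * Real.sin z.im : ℝ) * Complex.I := by
    conv_lhs => rw [← Complex.re_add_im z]
    rw [Complex.sinh_add, Complex.sinh_mul_I, Complex.cosh_mul_I]
    push_cast; ring
  rw [h, Complex.sq_norm, Complex.normSq_add_mul_I]
  have h1 := Real.cosh_sq z.re
  have h2 := Real.sin_sq_add_cos_sq z.im
  linear_combination Real.sin z.im ^ 2 * h1 + Real.sinh z.re ^ 2 * h2

lemma abs_sinh_re_le_norm_sinh (z : ℂ) : |Real.sinh z.re| ≤ ‖Complex.sinh z‖ := by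
  refine abs_le_of_sq_le_sq ?_ (norm_nonneg _)
  rw [sq_norm_sinh]; nlinarith [sq_nonneg (Real.sin z.im)]

lemma abs_sin_im_mul_cosh_re_le_norm_sinh (z : ℂ) :
    |Real.sin z.im| * Real.cosh z.re ≤ ‖Complex.sinh z‖ := by
  refine le_of_sq_le_sq ?_ (norm_nonneg _)
  rw [sq_norm_sinh, mul_pow, sq_abs, Real.cosh_sq]
  nlinarith [Real.sin_sq_le_one z.im, sq_nonneg (Real.sinh z.re)]

lemma exp_abs_le_two_mul_cosh (x : ℝ) : Real.exp |x| ≤ 2 * Real.cosh x := by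
  rw [← Real.cosh_abs, Real.cosh_eq]
  linarith [Real.exp_pos (-|x|)]

lemma integrable_exp_neg_mul_abs {κ : ℝ} (hκ : 0 < κ) :
    Integrable fun t : ℝ => Real.exp (-κ * |t|) :=
  integrable_of_exp_decay (C := 1) (by fun_prop) hκ hκ
    (fun t ht => by rw [Real.norm_of_nonneg (Real.exp_nonneg _), abs_of_nonneg ht, one_mul])
    (fun t ht => by rw [Real.norm_of_nonneg (Real.exp_nonneg _), abs_of_nonpos ht, one_mul]; simp)

lemma integral_exp_neg_mul_abs {κ : ℝ} (hκ : 0 < κ) :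
    ∫ t : ℝ, Real.exp (-κ * |t|) = 2 / κ := by
  rw [integral_comp_abs (f := fun t => Real.exp (-κ * t)), integral_exp_mul_Ioi (by linarith)]
  simp
  ring

/-- The exponent in the integral formula for `PhiS`. -/
def logPhi (b : ℝ) (z : ℂ) : ℂ :=
  ∫ t : ℝ, phiKer b z (t + Complex.I * (π * min b b⁻¹ / 2))

lemma PhiS_eq_exp_logPhi (b : ℝ) (z : ℂ) : PhiS b z = Complex.exp (logPhi b z) := rfl

/-- The part of `phiKer` on the line of integration which does not depend on `z`. -/
def lineKer (b : ℝ) (t : ℝ) : ℂ :=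
  (4 * Complex.sinh ((t + π * b / 2 * Complex.I) * b) *
    Complex.sinh ((t + π * b / 2 * Complex.I) / b) * (t + π * b / 2 * Complex.I))⁻¹

lemma phiKer_line {b : ℝ} (hb : 0 < b) (hb1 : b ≤ 1) (z : ℂ) (t : ℝ) :
    phiKer b z (t + Complex.I * (π * min b b⁻¹ / 2)) =
      Complex.exp (π * b * z) * (lineKer b t * Complex.exp (-2 * Complex.I * z * t)) := by
  have hmin : min b b⁻¹ = b := min_eq_left (hb1.trans ((one_le_inv₀ hb).2 hb1))
  rw [hmin, phiKer, lineKer, show (t : ℂ) + Complex.I * (π * b / 2) = t + π * b / 2 * Complex.I by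
    ring, div_eq_mul_inv, mul_left_comm, ← Complex.exp_add, mul_comm]
  congr 2
  linear_combination -(π * b * z) * Complex.I_sq

lemma line_im (b t : ℝ) : ((t : ℂ) + π * b / 2 * Complex.I).im = π * b / 2 := by
  have : ((t : ℂ) + π * b / 2 * Complex.I) = t + (π * b / 2 : ℝ) * Complex.I := by push_cast; ring
  rw [this]; simp

lemma line_re (b t : ℝ) : ((t : ℂ) + π * b / 2 * Complex.I).re = t := by
  have : ((t : ℂ) + π * b / 2 * Complex.I) = t + (π * b / 2 : ℝ) * Complex.I := by push_cast; ring
  rw [this]; simp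

lemma sinh_line_div {b : ℝ} (hb : b ≠ 0) (t : ℝ) :
    Complex.sinh ((t + π * b / 2 * Complex.I) / b) = Complex.cosh (t / b) * Complex.I := by
  have hbc : (b : ℂ) ≠ 0 := by exact_mod_cast hb
  rw [show ((t + π * b / 2 * Complex.I) / b : ℂ) = t / b + (π / 2 : ℝ) * Complex.I by
    push_cast; field_simp, Complex.sinh_add, Complex.sinh_mul_I, Complex.cosh_mul_I,
    ← Complex.ofReal_cos, ← Complex.ofReal_sin]
  simp

lemma norm_sinh_line_mul_ge {b : ℝ} (hb : 0 < b) (hb1 : b ≤ 1) (t : ℝ) :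
    b ^ 2 * Real.cosh (b * t) ≤ ‖Complex.sinh ((t + π * b / 2 * Complex.I) * b)‖ := by
  have h := abs_sin_im_mul_cosh_re_le_norm_sinh ((t + π * b / 2 * Complex.I) * b)
  rw [Complex.re_mul_ofReal, Complex.im_mul_ofReal, line_re, line_im] at h
  refine le_trans ?_ h
  rw [mul_comm t b]
  refine mul_le_mul_of_nonneg_right ?_ (Real.cosh_pos _).le
  have hb2 : b ^ 2 ≤ 1 := by nlinarith
  have h2 := Real.mul_le_sin (x := π * b / 2 * b) (by positivity) (by nlinarith [Real.pi_pos])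
  refine le_trans (le_of_eq ?_) (h2.trans (le_abs_self _))
  field_simp

lemma norm_lineKer_den_ge {b : ℝ} (hb : 0 < b) (hb1 : b ≤ 1) (t : ℝ) :
    b ^ 3 * Real.exp ((b + b⁻¹) * |t|) ≤ ‖4 * Complex.sinh ((t + π * b / 2 * Complex.I) * b) *
      Complex.sinh ((t + π * b / 2 * Complex.I) / b) * (t + π * b / 2 * Complex.I)‖ := by
  have h1 := norm_sinh_line_mul_ge hb hb1 t
  have h2 : ‖Complex.sinh ((t + π * b / 2 * Complex.I) / b)‖ = Real.cosh (t / b) := by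
    rw [sinh_line_div hb.ne', norm_mul, Complex.norm_I, mul_one, ← Complex.ofReal_div,
      ← Complex.ofReal_cosh, Complex.norm_real, Real.norm_of_nonneg (Real.cosh_pos _).le]
  have h3 : b ≤ ‖((t : ℂ) + π * b / 2 * Complex.I)‖ := by
    refine le_trans ?_ (Complex.abs_im_le_norm _)
    rw [line_im, abs_of_pos (by positivity)]
    nlinarith [Real.two_le_pi]
  have h4 : Real.exp ((b + b⁻¹) * |t|) ≤ 4 * Real.cosh (b * t) * Real.cosh (t / b) := by
    have e1 := exp_abs_le_two_mul_cosh (b * t)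
    have e2 := exp_abs_le_two_mul_cosh (t / b)
    rw [abs_mul, abs_of_pos hb] at e1
    rw [abs_div, abs_of_pos hb] at e2
    calc Real.exp ((b + b⁻¹) * |t|) = Real.exp (b * |t|) * Real.exp (|t| / b) := by
          rw [← Real.exp_add]; congr 1; field_simp
      _ ≤ (2 * Real.cosh (b * t)) * (2 * Real.cosh (t / b)) := by gcongr
      _ = _ := by ring
  rw [norm_mul, norm_mul, norm_mul, h2]
  have hc := Real.cosh_pos (t / b)
  have hc' := Real.cosh_pos (b * t)
  calc b ^ 3 * Real.exp ((b + b⁻¹) * |t|)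
      ≤ b ^ 3 * (4 * Real.cosh (b * t) * Real.cosh (t / b)) := by gcongr
    _ = 4 * (b ^ 2 * Real.cosh (b * t)) * Real.cosh (t / b) * b := by ring
    _ ≤ _ := by
      have : ‖(4 : ℂ)‖ = 4 := by simp
      rw [this]; gcongr

lemma norm_lineKer_le {b : ℝ} (hb : 0 < b) (hb1 : b ≤ 1) (t : ℝ) :
    ‖lineKer b t‖ ≤ (b ^ 3)⁻¹ * Real.exp (-(b + b⁻¹) * |t|) := by
  rw [lineKer, norm_inv, neg_mul, Real.exp_neg, ← mul_inv]
  exact inv_anti₀ (by positivity) (norm_lineKer_den_ge hb hb1 t)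

lemma lineKer_den_ne_zero {b : ℝ} (hb : 0 < b) (hb1 : b ≤ 1) (t : ℝ) :
    4 * Complex.sinh ((t + π * b / 2 * Complex.I) * b) *
      Complex.sinh ((t + π * b / 2 * Complex.I) / b) * (t + π * b / 2 * Complex.I) ≠ 0 :=
  norm_pos_iff.1 (lt_of_lt_of_le (by positivity) (norm_lineKer_den_ge hb hb1 t))

lemma continuous_lineKer {b : ℝ} (hb : 0 < b) (hb1 : b ≤ 1) : Continuous (lineKer b) := by
  have hb0 : (b : ℂ) ≠ 0 := by exact_mod_cast hb.ne'
  refine Continuous.inv₀ ?_ (lineKer_den_ne_zero hb hb1)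
  fun_prop

lemma norm_lineKer_mul_exp_le {b : ℝ} (hb : 0 < b) (hb1 : b ≤ 1) (ζ : ℂ) (t : ℝ) :
    ‖lineKer b t * Complex.exp (ζ * t)‖ ≤
      (b ^ 3)⁻¹ * Real.exp (-(b + b⁻¹ - |ζ.re|) * |t|) := by
  rw [norm_mul, norm_cexp_mul_ofReal]
  have h : ζ.re * t ≤ |ζ.re| * |t| := by rw [← abs_mul]; exact le_abs_self _
  calc _ ≤ ((b ^ 3)⁻¹ * Real.exp (-(b + b⁻¹) * |t|)) * Real.exp (|ζ.re| * |t|) := by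
        gcongr; exact norm_lineKer_le hb hb1 t
    _ = _ := by rw [mul_assoc, ← Real.exp_add]; congr 2; ring

lemma integrable_lineKer_mul_exp {b : ℝ} (hb : 0 < b) (hb1 : b ≤ 1) {ζ : ℂ}
    (hζ : |ζ.re| < b + b⁻¹) : Integrable fun t : ℝ => lineKer b t * Complex.exp (ζ * t) := by
  have hc := continuous_lineKer hb hb1
  refine Integrable.mono' ((integrable_exp_neg_mul_abs (sub_pos.2 hζ)).const_mul (b ^ 3)⁻¹)
    (by fun_prop : Continuous fun t : ℝ => lineKer b t * Complex.exp (ζ * t)).aestronglyMeasurable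
    (Eventually.of_forall (norm_lineKer_mul_exp_le hb hb1 ζ))

lemma re_neg_two_I_mul (z : ℂ) : (-2 * Complex.I * z).re = 2 * z.im := by simp

lemma logPhi_eq {b : ℝ} (hb : 0 < b) (hb1 : b ≤ 1) (z : ℂ) :
    logPhi b z = Complex.exp (π * b * z) *
      ∫ t : ℝ, lineKer b t * Complex.exp (-2 * Complex.I * z * t) := by
  rw [logPhi, ← integral_const_mul]
  exact integral_congr_ae (Eventually.of_forall fun t => phiKer_line hb hb1 z t)

lemma norm_cexp_pi_mul (b : ℝ) (z : ℂ) : ‖Complex.exp (π * b * z)‖ = Real.exp (π * b * z.re) := by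
  rw [Complex.norm_exp, show (π * b * z : ℂ) = (π * b : ℝ) * z by push_cast; ring,
    Complex.re_ofReal_mul]

lemma norm_logPhi_le {b : ℝ} (hb : 0 < b) (hb1 : b ≤ 1) {z : ℂ}
    (hz : 2 * |z.im| < b + b⁻¹) :
    ‖logPhi b z‖ ≤ (b ^ 3)⁻¹ * (2 / (b + b⁻¹ - 2 * |z.im|)) * Real.exp (π * b * z.re) := by
  have hre : |(-2 * Complex.I * z).re| = 2 * |z.im| := by
    rw [re_neg_two_I_mul, abs_mul, abs_two]
  rw [logPhi_eq hb hb1, norm_mul, norm_cexp_pi_mul, mul_comm]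
  gcongr
  rw [← integral_exp_neg_mul_abs (sub_pos.2 hz), ← integral_const_mul]
  refine norm_integral_le_of_norm_le ((integrable_exp_neg_mul_abs (sub_pos.2 hz)).const_mul _)
    (Eventually.of_forall fun t => ?_)
  rw [← hre]
  exact norm_lineKer_mul_exp_le hb hb1 _ t

lemma integrable_phiKer {b : ℝ} (hb : 0 < b) (hb1 : b ≤ 1) {z : ℂ} (hz : 2 * |z.im| < b + b⁻¹) :
    Integrable fun t : ℝ => phiKer b z (t + Complex.I * (π * min b b⁻¹ / 2)) := by
  simp only [phiKer_line hb hb1]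
  refine (integrable_lineKer_mul_exp hb hb1 ?_).const_mul _
  rwa [re_neg_two_I_mul, abs_mul, abs_two]

lemma differentiableAt_logPhi {b : ℝ} (hb : 0 < b) (hb1 : b ≤ 1) {z : ℂ}
    (hz : 2 * |z.im| < b + b⁻¹) : DifferentiableAt ℂ (logPhi b) z := by
  have h := (hasDerivAt_laplace (continuous_lineKer hb hb1) (α := -(b + b⁻¹)) (β := b + b⁻¹)
    (ζ := -2 * Complex.I * z) (fun ξ hξ => integrable_lineKer_mul_exp hb hb1
      (by simpa using abs_lt.2 hξ))
    (by rw [re_neg_two_I_mul]; exact abs_lt.1 (by rwa [abs_mul, abs_two]))).2.2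
  rw [funext (logPhi_eq hb hb1)]
  have h2 : DifferentiableAt ℂ (fun z : ℂ => -2 * Complex.I * z) z := by fun_prop
  exact (by fun_prop : DifferentiableAt ℂ (fun z : ℂ => Complex.exp (π * b * z)) z).mul
    (DifferentiableAt.comp (g := fun ζ : ℂ => ∫ t : ℝ, lineKer b t * Complex.exp (ζ * t)) z
      h.differentiableAt h2)

lemma conj_lineKer (b t : ℝ) : (starRingEnd ℂ) (lineKer b t) = -lineKer b (-t) := by
  have hw : (starRingEnd ℂ) ((t : ℂ) + π * b / 2 * Complex.I) =
      -(((-t : ℝ) : ℂ) + π * b / 2 * Complex.I) := by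
    simp [Complex.conj_ofNat]; ring
  rw [lineKer, lineKer, map_inv₀, map_mul, map_mul, map_mul, ← Complex.sinh_conj,
    ← Complex.sinh_conj, map_div₀, map_mul, hw, Complex.conj_ofReal, neg_mul, neg_div,
    Complex.sinh_neg, Complex.sinh_neg, ← inv_neg, Complex.conj_ofNat]
  congr 1
  ring

lemma conj_logPhi {b : ℝ} (hb : 0 < b) (hb1 : b ≤ 1) (z : ℂ) :
    (starRingEnd ℂ) (logPhi b z) = -logPhi b ((starRingEnd ℂ) z) := by
  rw [logPhi_eq hb hb1, logPhi_eq hb hb1, map_mul, ← integral_conj, ← Complex.exp_conj,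
    ← mul_neg, ← integral_neg, ← integral_neg_eq_self]
  simp only [map_mul, Complex.conj_ofReal, conj_lineKer, ← Complex.exp_conj, neg_neg]
  congr 1
  refine integral_congr_ae (Eventually.of_forall fun t => ?_)
  simp [Complex.conj_ofNat]

end LogPhi

section FunctionalEquation
open Filter Topology

/-- The kernel of the difference `logPhi b (z - ib/2) - logPhi b (z + ib/2)`. -/
def diffKer (b t : ℝ) : ℂ :=
  (2 * (Complex.cosh (t / b) * Complex.I) * (t + π * b / 2 * Complex.I))⁻¹

lemma line_ne_zero {b : ℝ} (hb : 0 < b) (t : ℝ) : (t : ℂ) + π * b / 2 * Complex.I ≠ 0 := by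
  intro h
  have := congrArg Complex.im h
  rw [line_im, Complex.zero_im] at this
  have : 0 < π * b / 2 := by positivity
  linarith

lemma cosh_div_ne_zero (b t : ℝ) : Complex.cosh (t / b) ≠ 0 := by
  rw [← Complex.ofReal_div, ← Complex.ofReal_cosh]
  exact_mod_cast (Real.cosh_pos _).ne'

lemma abs_im_sub_half_lt {b : ℝ} (hb : 0 < b) {z : ℂ} (hz : 2 * |z.im| < b⁻¹) :
    2 * |(z - b / 2 * Complex.I).im| < b + b⁻¹ ∧ 2 * |(z + b / 2 * Complex.I).im| < b + b⁻¹ := by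
  have h1 : (z - b / 2 * Complex.I).im = z.im - b / 2 := by
    rw [show (b / 2 * Complex.I : ℂ) = (b / 2 : ℝ) * Complex.I by push_cast; ring]; simp
  have h2 : (z + b / 2 * Complex.I).im = z.im + b / 2 := by
    rw [show (b / 2 * Complex.I : ℂ) = (b / 2 : ℝ) * Complex.I by push_cast; ring]; simp
  rw [h1, h2]
  have h3 := abs_sub z.im (b / 2)
  have h4 := abs_add_le z.im (b / 2)
  rw [abs_of_pos (by positivity : 0 < b / 2)] at h3 h4
  constructor <;> linarith

lemma logPhi_sub_eq {b : ℝ} (hb : 0 < b) (hb1 : b ≤ 1) {z : ℂ} (hz : 2 * |z.im| < b⁻¹) :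
    logPhi b (z - b / 2 * Complex.I) - logPhi b (z + b / 2 * Complex.I) =
      -(Complex.exp (π * b * z) * ∫ t : ℝ, diffKer b t * Complex.exp (-2 * Complex.I * z * t)) := by
  obtain ⟨h1, h2⟩ := abs_im_sub_half_lt hb hz
  rw [logPhi, logPhi, ← integral_sub (integrable_phiKer hb hb1 h1) (integrable_phiKer hb hb1 h2),
    ← integral_const_mul, ← integral_neg]
  refine integral_congr_ae (Eventually.of_forall fun t => ?_)
  simp only [phiKer_line hb hb1]
  have hne := lineKer_den_ne_zero hb hb1 t
  rw [sinh_line_div hb.ne'] at hne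
  have hne1 : Complex.sinh ((t + π * b / 2 * Complex.I) * b) ≠ 0 := fun h => hne (by rw [h]; ring)
  have hd : diffKer b t = 2 * Complex.sinh ((t + π * b / 2 * Complex.I) * b) * lineKer b t := by
    rw [diffKer, lineKer, sinh_line_div hb.ne']
    have h : ∀ s c w : ℂ, s ≠ 0 → (2 * c * w)⁻¹ = 2 * s * (4 * s * c * w)⁻¹ := fun s c w hs => by
      rw [show 4 * s * c * w = (2 * s) * (2 * c * w) by ring, mul_inv (2 * s),
        mul_inv_cancel_left₀ (by simpa using hs)]
    exact h _ _ _ hne1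
  rw [hd, Complex.two_sinh]
  have e1 : Complex.exp (π * b * (z - b / 2 * Complex.I)) *
      (lineKer b t * Complex.exp (-2 * Complex.I * (z - b / 2 * Complex.I) * t)) =
      Complex.exp (π * b * z) * lineKer b t * Complex.exp (-2 * Complex.I * z * t) *
        Complex.exp (-((t + π * b / 2 * Complex.I) * b)) := by
    rw [mul_comm (lineKer b t), ← mul_assoc, ← Complex.exp_add,
      mul_right_comm (Complex.exp _) (lineKer b t), mul_right_comm _ (lineKer b t),
      ← Complex.exp_add, ← Complex.exp_add]
    congr 2
    linear_combination (b * t : ℂ) * Complex.I_sq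
  have e2 : Complex.exp (π * b * (z + b / 2 * Complex.I)) *
      (lineKer b t * Complex.exp (-2 * Complex.I * (z + b / 2 * Complex.I) * t)) =
      Complex.exp (π * b * z) * lineKer b t * Complex.exp (-2 * Complex.I * z * t) *
        Complex.exp ((t + π * b / 2 * Complex.I) * b) := by
    rw [mul_comm (lineKer b t), ← mul_assoc, ← Complex.exp_add,
      mul_right_comm (Complex.exp _) (lineKer b t), mul_right_comm _ (lineKer b t),
      ← Complex.exp_add, ← Complex.exp_add]
    congr 2
    linear_combination -(b * t : ℂ) * Complex.I_sq
  rw [e1, e2]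
  ring

lemma continuous_diffKer {b : ℝ} (hb : 0 < b) : Continuous (diffKer b) := by
  have hb0 : (b : ℂ) ≠ 0 := by exact_mod_cast hb.ne'
  refine Continuous.inv₀ (by fun_prop) fun t => ?_
  have := line_ne_zero hb t
  have := cosh_div_ne_zero b t
  simp [*]

lemma integrable_diffKer_mul_exp {b : ℝ} (hb : 0 < b) {ζ : ℂ}
    (hζ : |ζ.re| < b⁻¹) : Integrable fun t : ℝ => diffKer b t * Complex.exp (ζ * t) := by
  have hc := continuous_diffKer hb
  refine Integrable.mono' ((integrable_exp_neg_mul_abs (sub_pos.2 hζ)).const_mul b⁻¹)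
    (by fun_prop : Continuous fun t : ℝ => diffKer b t * Complex.exp (ζ * t)).aestronglyMeasurable
    (Eventually.of_forall fun t => ?_)
  have h3 : b ≤ ‖((t : ℂ) + π * b / 2 * Complex.I)‖ := by
    refine le_trans ?_ (Complex.abs_im_le_norm _)
    rw [line_im, abs_of_pos (by positivity)]
    nlinarith [Real.two_le_pi]
  have h2 := exp_abs_le_two_mul_cosh (t / b)
  rw [abs_div, abs_of_pos hb] at h2
  have h4 : b * Real.exp (|t| / b) ≤
      ‖2 * (Complex.cosh (t / b) * Complex.I) * (t + π * b / 2 * Complex.I)‖ := by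
    rw [norm_mul, norm_mul, norm_mul, Complex.norm_I, ← Complex.ofReal_div, ← Complex.ofReal_cosh,
      Complex.norm_real, Real.norm_of_nonneg (Real.cosh_pos _).le, mul_one, Complex.norm_two,
      mul_comm]
    have := Real.cosh_pos (t / b)
    gcongr
  have h : ζ.re * t ≤ |ζ.re| * |t| := by rw [← abs_mul]; exact le_abs_self _
  rw [norm_mul, norm_cexp_mul_ofReal, diffKer, norm_inv]
  calc _ ≤ (b * Real.exp (|t| / b))⁻¹ * Real.exp (|ζ.re| * |t|) := by
        gcongr
    _ = _ := by
      rw [mul_inv, ← Real.exp_neg, mul_assoc, ← Real.exp_add]; congr 2; field_simp; ring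

/-- The derivative of `logPhi b (z - ib/2) - logPhi b (z + ib/2)`. -/
lemma hasDerivAt_diffKer_integral {b : ℝ} (hb : 0 < b) {z : ℂ} (hz : 2 * |z.im| < b⁻¹) :
    HasDerivAt (fun z : ℂ => -(Complex.exp (π * b * z) *
      ∫ t : ℝ, diffKer b t * Complex.exp (-2 * Complex.I * z * t)))
      (Complex.exp (π * b * z) * (π * b / Complex.cosh (π * b * z))) z := by
  have hb0 : (b : ℂ) ≠ 0 := by exact_mod_cast hb.ne'
  have hre : |(-2 * Complex.I * z).re| = 2 * |z.im| := by rw [re_neg_two_I_mul, abs_mul, abs_two]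
  obtain ⟨hi1, hi2, hd⟩ := hasDerivAt_laplace (continuous_diffKer hb) (α := -b⁻¹) (β := b⁻¹)
    (ζ := -2 * Complex.I * z) (fun ξ hξ => integrable_diffKer_mul_exp hb
      (by simpa using abs_lt.2 hξ)) (abs_lt.1 (by rwa [hre]))
  have h1 : HasDerivAt (fun z : ℂ => -2 * Complex.I * z) (-2 * Complex.I) z := by
    simpa using (hasDerivAt_id z).const_mul (-2 * Complex.I)
  have h2 : HasDerivAt (fun z : ℂ => Complex.exp (π * b * z))
      (Complex.exp (π * b * z) * (π * b)) z := by
    simpa using ((hasDerivAt_id z).const_mul (π * b : ℂ)).cexp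
  have h3 := (h2.mul (hd.comp z h1)).neg
  convert! h3 using 1
  have hsech : ∫ t : ℝ, Complex.exp (-2 * Complex.I * z * t) / Complex.cosh (t / b) =
      π * b / Complex.cosh (π * b * z) := by
    have hs := integral_cexp_div_cosh (ζ := -2 * Complex.I * z * b) (by
      rw [Complex.re_mul_ofReal, abs_mul, hre, abs_of_pos hb]
      rwa [← lt_inv_mul_iff₀' hb, mul_one])
    have hcv := Measure.integral_comp_div
      (fun s : ℝ => Complex.exp (-2 * Complex.I * z * b * s) / Complex.cosh s) b
    rw [hs, abs_of_pos hb] at hcv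
    have hcos : Complex.cos (π * (-2 * Complex.I * z * b) / 2) = Complex.cosh (π * b * z) := by
      rw [show (π * (-2 * Complex.I * z * b) / 2 : ℂ) = -((π * b * z) * Complex.I) by ring,
        Complex.cos_neg, Complex.cos_mul_I]
    rw [hcos] at hcv
    rw [mul_div_right_comm, mul_comm _ (b : ℂ), ← Complex.real_smul (x := b), ← hcv]
    refine integral_congr_ae (Eventually.of_forall fun t => ?_)
    push_cast
    congr 2
    field_simp
  rw [← hsech]
  simp only [Function.comp_apply]
  rw [mul_assoc (Complex.exp (π * b * z)), ← mul_add, ← mul_neg, mul_comm _ (-2 * Complex.I),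
    ← integral_const_mul (π * b : ℂ), ← integral_const_mul (-2 * Complex.I),
    ← integral_add (hi1.const_mul _) (hi2.const_mul _), ← integral_neg]
  congr 1
  refine integral_congr_ae (Eventually.of_forall fun t => ?_)
  have hd : diffKer b t * (t + π * b / 2 * Complex.I) = (2 * (Complex.cosh (t / b) * Complex.I))⁻¹ := by
    rw [diffKer, mul_inv, inv_mul_cancel_right₀ (line_ne_zero hb t)]
  have hd2 : (2 * (Complex.cosh (t / b) * Complex.I))⁻¹ * (2 * Complex.I) = (Complex.cosh (t / b))⁻¹ := by
    have := cosh_div_ne_zero b t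
    have := Complex.I_ne_zero
    field_simp
  beta_reduce
  rw [div_eq_mul_inv, ← hd2, ← hd]
  linear_combination (Complex.exp (-2 * Complex.I * z * t) * diffKer b t * π * b) * Complex.I_sq

lemma one_add_exp_eq (u : ℂ) : 1 + Complex.exp (2 * u) = 2 * Complex.exp u * Complex.cosh u := by
  rw [mul_right_comm, Complex.two_cosh, add_mul, ← Complex.exp_add, ← Complex.exp_add]
  simp [two_mul, add_comm]

lemma cosh_ne_zero_of_abs_im_lt {u : ℂ} (h : |u.im| < π / 2) : Complex.cosh u ≠ 0 := by
  intro h0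
  have h1 : Complex.sinh (u + (π / 2 : ℝ) * Complex.I) = 0 := by
    rw [Complex.sinh_add, Complex.sinh_mul_I, Complex.cosh_mul_I, h0]
    push_cast
    rw [Complex.cos_pi_div_two]; simp
  have h2 := abs_sin_im_mul_cosh_re_le_norm_sinh (u + (π / 2 : ℝ) * Complex.I)
  rw [h1, norm_zero] at h2
  have h3 : 0 < |Real.sin (u + (π / 2 : ℝ) * Complex.I).im| := by
    refine abs_pos.2 (Real.sin_pos_of_pos_of_lt_pi ?_ ?_).ne' <;> simp <;>
      linarith [abs_lt.1 h]
  have := mul_pos h3 (Real.cosh_pos (u + (π / 2 : ℝ) * Complex.I).re)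
  linarith

lemma cosh_pi_mul_ne_zero {b : ℝ} (hb : 0 < b) {z : ℂ} (hz : 2 * |z.im| < b⁻¹) :
    Complex.cosh (π * b * z) ≠ 0 := by
  refine cosh_ne_zero_of_abs_im_lt ?_
  rw [show (π * b * z : ℂ) = (π * b : ℝ) * z by push_cast; ring, Complex.im_ofReal_mul, abs_mul,
    abs_of_pos (by positivity)]
  have : b * (2 * |z.im|) < 1 := by rwa [← lt_inv_mul_iff₀ hb, mul_one]
  nlinarith [Real.pi_pos]

/-- The functional equation of the quantum dilogarithm in the strip. -/
lemma exp_logPhi_sub {b : ℝ} (hb : 0 < b) (hb1 : b ≤ 1) {z : ℂ} (hz : 2 * |z.im| < b⁻¹) :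
    Complex.exp (logPhi b (z - b / 2 * Complex.I)) =
      (1 + Complex.exp (2 * π * b * z)) * Complex.exp (logPhi b (z + b / 2 * Complex.I)) := by
  set J : ℂ → ℂ := fun z => -(Complex.exp (π * b * z) *
      ∫ t : ℝ, diffKer b t * Complex.exp (-2 * Complex.I * z * t)) with hJ
  set U : Set ℂ := {z : ℂ | 2 * |z.im| < b⁻¹} with hU
  have hUo : IsOpen U := isOpen_lt (by fun_prop) continuous_const
  have hUc : IsPreconnected U := by
    refine Convex.isPreconnected fun x hx y hy s t hs ht hst => ?_
    simp only [hU, Set.mem_ofPred_eq, Complex.add_im, Complex.real_smul, Complex.im_ofReal_mul] at *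
    have := abs_add_le (s * x.im) (t * y.im)
    rw [abs_mul, abs_mul, abs_of_nonneg hs, abs_of_nonneg ht] at this
    have h0 : 0 < b⁻¹ := by positivity
    rcases hs.eq_or_lt with rfl | hs'
    · obtain rfl : t = 1 := by linarith
      linarith
    · nlinarith [mul_lt_mul_of_pos_left hx hs', mul_le_mul_of_nonneg_left hy.le ht]
  have hw : ∀ z ∈ U, 1 + Complex.exp (2 * π * b * z) ≠ 0 := fun z hz => by
    rw [show 2 * π * b * z = 2 * (π * b * z) by ring, one_add_exp_eq]
    exact mul_ne_zero (mul_ne_zero two_ne_zero (Complex.exp_ne_zero _)) (cosh_pi_mul_ne_zero hb hz)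
  set E : ℂ → ℂ := fun z => Complex.exp (-J z) * (1 + Complex.exp (2 * π * b * z)) with hE
  have hEd : ∀ z ∈ U, HasDerivAt E 0 z := by
    intro z hz
    have h1 := (hasDerivAt_diffKer_integral hb hz).neg.cexp
    have h2 : HasDerivAt (fun z : ℂ => 1 + Complex.exp (2 * π * b * z))
        (Complex.exp (2 * π * b * z) * (2 * π * b)) z := by
      simpa using (((hasDerivAt_id z).const_mul (2 * π * b : ℂ)).cexp).const_add 1
    have h3 := h1.mul h2
    convert! h3 using 1
    have hcz := cosh_pi_mul_ne_zero hb hz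
    rw [show 2 * π * b * z = 2 * (π * b * z) by ring, one_add_exp_eq, two_mul (π * b * z),
      Complex.exp_add]
    generalize Complex.exp ((-_ : ℂ → ℂ) z) = X
    field_simp
    ring
  have hconst : ∀ z ∈ U, E z = E 0 := fun z hz =>
    hUo.is_const_of_deriv_eq_zero hUc
      (fun z hz => (hEd z hz).differentiableAt.differentiableWithinAt)
      (fun z hz => (hEd z hz).deriv) hz (by simp [hU, hb])
  have hreal : ∀ x : ℝ, (x : ℂ) ∈ U := fun x => by simp [hU, hb]
  have hlim0 : Tendsto (fun x : ℝ => Real.exp (π * b * x)) atBot (𝓝 0) :=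
    Real.tendsto_exp_atBot.comp (tendsto_id.const_mul_atBot (by positivity))
  have hJlim : Tendsto (fun x : ℝ => J x) atBot (𝓝 0) := by
    refine squeeze_zero_norm (a := fun x : ℝ => Real.exp (π * b * x) *
      ∫ t : ℝ, ‖diffKer b t‖) (fun x => ?_) (by simpa using hlim0.mul_const _)
    rw [hJ, norm_neg, norm_mul, norm_cexp_pi_mul, Complex.ofReal_re]
    gcongr
    refine (norm_integral_le_integral_norm _).trans (le_of_eq ?_)
    congr 1; ext t
    rw [norm_mul, norm_cexp_mul_ofReal, re_neg_two_I_mul]; simp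
  have hE1 : E 0 = 1 := by
    have h2 : Tendsto (fun x : ℝ => Complex.exp (2 * π * b * x)) atBot (𝓝 0) := by
      rw [tendsto_zero_iff_norm_tendsto_zero]
      have : Tendsto (fun x : ℝ => Real.exp (π * b * x) ^ 2) atBot (𝓝 0) := by
        simpa using hlim0.pow 2
      refine this.congr fun x => ?_
      rw [show (2 * π * b * x : ℂ) = ((2 * (π * b * x) : ℝ) : ℂ) by push_cast; ring,
        ← Complex.ofReal_exp, Complex.norm_real, Real.norm_of_nonneg (Real.exp_nonneg _),
        ← Real.exp_nat_mul]; simp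
    have h3 : Tendsto (fun x : ℝ => E x) atBot (𝓝 (Complex.exp (-0) * (1 + 0))) :=
      ((Complex.continuous_exp.tendsto _).comp hJlim.neg).mul (h2.const_add 1)
    simp only [neg_zero, Complex.exp_zero, add_zero, mul_one] at h3
    exact tendsto_nhds_unique (tendsto_const_nhds.congr fun x : ℝ => (hconst x (hreal x)).symm) h3
  have h := hconst z hz
  rw [hE1, hE] at h
  have hJz : J z = _ := (logPhi_sub_eq hb hb1 hz).symm
  simp only [hJz] at h
  rw [neg_sub, Complex.exp_sub] at h
  rw [div_mul_eq_mul_div, div_eq_one_iff_eq (Complex.exp_ne_zero _)] at h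
  rw [← h, mul_comm]

end FunctionalEquation

section Inversion
open Filter Topology

/-- Removing the principal part of `h w / w ^ 3` at the origin. -/
lemma exists_regular_part {h : ℂ → ℂ} {U : Set ℂ} (hU : U ∈ 𝓝 0) (hh : DifferentiableOn ℂ h U)
    {β : ℂ} (hβ : Tendsto (fun w => (h w - h 0) / w ^ 2) (𝓝[≠] 0) (𝓝 β)) :
    ∃ r : ℂ → ℂ, DifferentiableOn ℂ r U ∧
      ∀ w ≠ 0, r w = (h w - h 0 - β * w ^ 2) / w ^ 3 := by
  have h1 := (Complex.differentiableOn_dslope hU).2 hh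
  have h2 := (Complex.differentiableOn_dslope hU).2 h1
  have h3 := (Complex.differentiableOn_dslope hU).2 h2
  have hs1 : ∀ w : ℂ, w ≠ 0 → dslope h 0 w = (h w - h 0) / w := fun w hw => by
    rw [dslope_of_ne _ hw, slope_def_field, sub_zero]
  have hw0 : Tendsto (fun w : ℂ => w) (𝓝[≠] 0) (𝓝 0) := tendsto_id.mono_left nhdsWithin_le_nhds
  have h10 : dslope h 0 0 = 0 := by
    have hc := ((h1.differentiableAt hU).continuousAt.tendsto).mono_left
      (nhdsWithin_le_nhds (s := {0}ᶜ))
    refine tendsto_nhds_unique hc ?_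
    have := hw0.mul hβ
    rw [zero_mul] at this
    refine this.congr' ?_
    filter_upwards [self_mem_nhdsWithin] with w hw
    have hw : w ≠ 0 := hw
    rw [hs1 w hw]; field_simp
  have hs2 : ∀ w : ℂ, w ≠ 0 → dslope (dslope h 0) 0 w = (h w - h 0) / w ^ 2 := fun w hw => by
    rw [dslope_of_ne _ hw, slope_def_field, sub_zero, hs1 w hw, h10]; field_simp; ring
  have h20 : dslope (dslope h 0) 0 0 = β := by
    have hc := ((h2.differentiableAt hU).continuousAt.tendsto).mono_left
      (nhdsWithin_le_nhds (s := {0}ᶜ))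
    refine tendsto_nhds_unique hc (hβ.congr' ?_)
    filter_upwards [self_mem_nhdsWithin] with w hw using (hs2 w hw).symm
  refine ⟨_, h3, fun w hw => ?_⟩
  rw [dslope_of_ne _ hw, slope_def_field, sub_zero, hs2 w hw, h20]; field_simp

/-- The entire function `sinh u / u`. -/
def sinhc (u : ℂ) : ℂ := dslope Complex.sinh 0 u

lemma sinhc_zero : sinhc 0 = 1 := by
  rw [sinhc, dslope_same, (Complex.hasDerivAt_sinh 0).deriv, Complex.cosh_zero]

lemma sinhc_mul_self (u : ℂ) : sinhc u * u = Complex.sinh u := by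
  rcases eq_or_ne u 0 with rfl | hu
  · simp
  · rw [sinhc, dslope_of_ne _ hu, slope_def_field]; simp; field_simp

lemma sinhc_neg (u : ℂ) : sinhc (-u) = sinhc u := by
  rcases eq_or_ne u 0 with rfl | hu
  · simp
  · have h1 := sinhc_mul_self (-u)
    rw [Complex.sinh_neg, mul_neg, neg_inj, ← sinhc_mul_self u] at h1
    exact mul_right_cancel₀ hu h1

lemma differentiable_sinhc : Differentiable ℂ sinhc :=
  differentiableOn_univ.1 ((Complex.differentiableOn_dslope univ_mem).2
    Complex.differentiable_sinh.differentiableOn)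

lemma sinhc_ne_zero {u : ℂ} (hu : |u.im| < π) : sinhc u ≠ 0 := by
  rcases eq_or_ne u 0 with rfl | hu0
  · rw [sinhc_zero]; exact one_ne_zero
  intro h
  have h1 := sq_norm_sinh u
  rw [← sinhc_mul_self, h, zero_mul, norm_zero, zero_pow two_ne_zero] at h1
  have h2 : Real.sinh u.re = 0 := by nlinarith [sq_nonneg (Real.sinh u.re), sq_nonneg (Real.sin u.im)]
  have h3 : Real.sin u.im = 0 := by nlinarith [sq_nonneg (Real.sinh u.re), sq_nonneg (Real.sin u.im)]
  obtain ⟨h4, h5⟩ := abs_lt.1 hu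
  exact hu0 (Complex.ext (Real.sinh_eq_zero.1 h2)
    ((Real.sin_eq_zero_iff_of_lt_of_lt h4 h5).1 h3))

lemma tendsto_div_sq_of_norm_le {g : ℂ → ℂ} {c β : ℂ} {M : ℝ}
    (hg : ∀ w : ℂ, w ≠ 0 → ‖c * w‖ ≤ 1 → ‖g w / w ^ 2 - β‖ ≤ M * ‖w‖ ^ 2) :
    Tendsto (fun w => g w / w ^ 2) (𝓝[≠] 0) (𝓝 β) := by
  rw [tendsto_iff_norm_sub_tendsto_zero]
  have h1 : Tendsto (fun w : ℂ => M * ‖w‖ ^ 2) (𝓝[≠] 0) (𝓝 0) := by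
    have : Continuous fun w : ℂ => M * ‖w‖ ^ 2 := by fun_prop
    simpa using (this.tendsto 0).mono_left nhdsWithin_le_nhds
  refine squeeze_zero' (Eventually.of_forall fun _ => norm_nonneg _) ?_ h1
  have h2 : ∀ᶠ w : ℂ in 𝓝[≠] 0, ‖c * w‖ ≤ 1 := by
    have : Continuous fun w : ℂ => ‖c * w‖ := by fun_prop
    refine nhdsWithin_le_nhds ?_
    filter_upwards [this.tendsto 0 (Iio_mem_nhds (by simp : ‖c * 0‖ < 1))] with w hw using le_of_lt hw
  filter_upwards [h2, self_mem_nhdsWithin] with w hw hw0 using hg w hw0 hw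

lemma tendsto_cos_sub_one_div_sq (c : ℂ) :
    Tendsto (fun w => (Complex.cos (c * w) - 1) / w ^ 2) (𝓝[≠] 0) (𝓝 (-(c ^ 2) / 2)) := by
  refine tendsto_div_sq_of_norm_le (c := c) (M := ‖c‖ ^ 4 * (5 / 96)) fun w hw h => ?_
  have h1 := Complex.cos_bound h
  rw [show (Complex.cos (c * w) - 1) / w ^ 2 - -(c ^ 2) / 2 =
    (Complex.cos (c * w) - (1 - (c * w) ^ 2 / 2)) / w ^ 2 by field_simp; ring, norm_div, norm_pow,
    div_le_iff₀ (by positivity)]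
  refine h1.trans (le_of_eq ?_)
  rw [norm_mul]; ring

lemma tendsto_sinhc_sub_one_div_sq (c : ℂ) :
    Tendsto (fun w => (sinhc (c * w) - 1) / w ^ 2) (𝓝[≠] 0) (𝓝 (c ^ 2 / 6)) := by
  rcases eq_or_ne c 0 with rfl | hc
  · simp [sinhc_zero]
  refine tendsto_div_sq_of_norm_le (c := c) (M := ‖c‖ ^ 4 / 100) fun w hw h => ?_
  have h1 := Complex.sin_bound (x := c * w * Complex.I) (by simpa using h)
  rw [Complex.sin_mul_I, ← sinhc_mul_self] at h1
  have h2 : sinhc (c * w) * (c * w) * Complex.I - (c * w * Complex.I - (c * w * Complex.I) ^ 3 / 6) =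
      (c * w ^ 3 * Complex.I) * ((sinhc (c * w) - 1) / w ^ 2 - c ^ 2 / 6) := by
    field_simp
    linear_combination c ^ 2 * w ^ 2 * Complex.I_sq
  rw [h2, norm_mul, norm_mul, norm_mul, norm_mul, norm_mul, norm_pow, Complex.norm_I, mul_one,
    mul_one] at h1
  have hc' : 0 < ‖c‖ * ‖w‖ ^ 3 := by positivity
  refine le_of_mul_le_mul_left (h1.trans (le_of_eq ?_)) hc'
  ring

lemma norm_cos_le_exp_abs_im (u : ℂ) : ‖Complex.cos u‖ ≤ Real.exp |u.im| := by
  have h := norm_add_le (Complex.exp (u * Complex.I)) (Complex.exp (-u * Complex.I))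
  rw [Complex.norm_exp, Complex.norm_exp] at h
  simp only [Complex.mul_I_re, Complex.neg_im, neg_neg] at h
  have h1 : Real.exp (-u.im) ≤ Real.exp |u.im| := Real.exp_le_exp.2 (neg_le_abs _)
  have h2 : Real.exp u.im ≤ Real.exp |u.im| := Real.exp_le_exp.2 (le_abs_self _)
  rw [Complex.cos, norm_div, Complex.norm_two]
  linarith

lemma sinh_ge_of_le {x₀ x : ℝ} (h : x₀ ≤ x) :
    (1 - Real.exp (-2 * x₀)) / 2 * Real.exp x ≤ Real.sinh x := by
  rw [Real.sinh_eq]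
  have h1 : Real.exp (-x) ≤ Real.exp (-2 * x₀) * Real.exp x := by
    rw [← Real.exp_add]; exact Real.exp_le_exp.2 (by linarith)
  linarith

/-- The kernel of `logPhi b z + logPhi b (-z)`. -/
def invKer (b : ℝ) (z w : ℂ) : ℂ :=
  Complex.cos (2 * z * w) / (2 * sinhc (b * w) * sinhc ((b : ℂ)⁻¹ * w))

lemma phiKer_add_phiKer_neg {b : ℝ} (hb : 0 < b) (z : ℂ) {w : ℂ} (hw : w ≠ 0) :
    phiKer b z w + phiKer b (-z) w = invKer b z w / w ^ 3 := by
  have hb0 : (b : ℂ) ≠ 0 := by exact_mod_cast hb.ne'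
  rw [phiKer, phiKer, invKer, Complex.cos, mul_comm w (b : ℂ),
    show w / b = (b : ℂ)⁻¹ * w by rw [div_eq_inv_mul], ← sinhc_mul_self, ← sinhc_mul_self,
    ← add_div, div_div, div_div]
  congr 1
  · rw [add_comm]
    congr 1 <;> congr 1 <;> ring
  · generalize sinhc ((b : ℂ)⁻¹ * w) = S
    generalize sinhc (b * w) = S'
    field_simp
    ring

lemma abs_mul_im_lt {b y : ℝ} (hb : 0 < b) (hb1 : b ≤ 1) (hy : |y| < π * b) :
    |b * y| < π ∧ |b⁻¹ * y| < π := by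
  rw [abs_mul, abs_mul, abs_of_pos hb, abs_of_pos (inv_pos.2 hb)]
  constructor
  · nlinarith [abs_nonneg y, Real.pi_pos]
  · rwa [inv_mul_lt_iff₀ hb, mul_comm]

lemma invKer_den_ne_zero {b : ℝ} (hb : 0 < b) (hb1 : b ≤ 1) {w : ℂ} (hw : |w.im| < π * b) :
    2 * sinhc (b * w) * sinhc ((b : ℂ)⁻¹ * w) ≠ 0 := by
  obtain ⟨h1, h2⟩ := abs_mul_im_lt hb hb1 hw
  refine mul_ne_zero (mul_ne_zero two_ne_zero (sinhc_ne_zero ?_)) (sinhc_ne_zero ?_)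
  · rwa [Complex.im_ofReal_mul]
  · rwa [← Complex.ofReal_inv, Complex.im_ofReal_mul]

lemma tendsto_invKer {b : ℝ} (hb : 0 < b) (hb1 : b ≤ 1) (z : ℂ) :
    Tendsto (fun w => (invKer b z w - invKer b z 0) / w ^ 2) (𝓝[≠] 0)
      (𝓝 (-(z ^ 2 + ((b : ℂ) ^ 2 + (b : ℂ)⁻¹ ^ 2) / 12))) := by
  have hc := tendsto_cos_sub_one_div_sq (2 * z)
  have h1 := tendsto_sinhc_sub_one_div_sq (b : ℂ)
  have h2 := tendsto_sinhc_sub_one_div_sq (b : ℂ)⁻¹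
  have hS1 : Tendsto (fun w : ℂ => sinhc (b * w)) (𝓝[≠] 0) (𝓝 1) := by
    have : Continuous fun w : ℂ => sinhc (b * w) :=
      differentiable_sinhc.continuous.comp (by fun_prop)
    simpa [sinhc_zero] using (this.tendsto 0).mono_left (nhdsWithin_le_nhds (s := {0}ᶜ))
  have hS2 : Tendsto (fun w : ℂ => sinhc ((b : ℂ)⁻¹ * w)) (𝓝[≠] 0) (𝓝 1) := by
    have : Continuous fun w : ℂ => sinhc ((b : ℂ)⁻¹ * w) :=
      differentiable_sinhc.continuous.comp (by fun_prop)
    simpa [sinhc_zero] using (this.tendsto 0).mono_left (nhdsWithin_le_nhds (s := {0}ᶜ))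
  have h := ((hc.sub (h1.mul hS2)).sub h2).div ((hS1.const_mul 2).mul hS2) (by norm_num)
  convert h.congr' ?_ using 1
  · congr 1; ring
  have hU : ∀ᶠ w : ℂ in 𝓝[≠] 0, |w.im| < π * b := by
    refine nhdsWithin_le_nhds ?_
    have : Continuous fun w : ℂ => |w.im| := by fun_prop
    exact this.tendsto 0 (Iio_mem_nhds (by simp; positivity))
  filter_upwards [hU, self_mem_nhdsWithin] with w hw hw0
  have hw0 : w ≠ 0 := hw0
  have hne := invKer_den_ne_zero hb hb1 hw
  have hne1 : sinhc (b * w) ≠ 0 := fun h => hne (by rw [h]; ring)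
  have hne2 : sinhc ((b : ℂ)⁻¹ * w) ≠ 0 := fun h => hne (by rw [h]; ring)
  simp only [Pi.div_apply, invKer, mul_zero, Complex.cos_zero, sinhc_zero]
  generalize sinhc ((b : ℂ)⁻¹ * w) = S at *
  generalize sinhc (b * w) = S' at *
  field_simp
  ring

lemma invKer_neg (b : ℝ) (z w : ℂ) : invKer b z (-w) = invKer b z w := by
  simp only [invKer, mul_neg, sinhc_neg, Complex.cos_neg]

/-- Exponential decay of the kernel of `logPhi b z + logPhi b (-z)`. -/
lemma exists_norm_invKer_div_le {b : ℝ} (hb : 0 < b) (z : ℂ) (ε : ℝ) :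
    ∃ K : ℝ, ∀ w : ℂ, 1 ≤ |w.re| → |w.im| ≤ ε →
      ‖invKer b z w / w ^ 3‖ ≤ K * Real.exp (-(b + b⁻¹ - 2 * |z.im|) * |w.re|) := by
  have hb' : 0 < b⁻¹ := by positivity
  set c₀ := (1 - Real.exp (-2 * b)) / 2 with hc₀
  set c₁ := (1 - Real.exp (-2 * b⁻¹)) / 2 with hc₁
  have hc₀p : 0 < c₀ := by
    have : Real.exp (-2 * b) < 1 := Real.exp_lt_one_iff.2 (by linarith)
    rw [hc₀]; linarith
  have hc₁p : 0 < c₁ := by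
    have : Real.exp (-2 * b⁻¹) < 1 := Real.exp_lt_one_iff.2 (by linarith)
    rw [hc₁]; linarith
  refine ⟨Real.exp (2 * |z.re| * ε) / (2 * c₀ * c₁), fun w hw hwi => ?_⟩
  have hb0 : (b : ℂ) ≠ 0 := by exact_mod_cast hb.ne'
  have hw0 : w ≠ 0 := by rintro rfl; simp at hw; linarith
  have heq : invKer b z w / w ^ 3 =
      Complex.cos (2 * z * w) / (2 * Complex.sinh (b * w) * Complex.sinh ((b : ℂ)⁻¹ * w) * w) := by
    rw [invKer, div_div, ← sinhc_mul_self, ← sinhc_mul_self]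
    congr 1
    generalize sinhc ((b : ℂ)⁻¹ * w) = S
    generalize sinhc (b * w) = S'
    field_simp
  rw [heq, norm_div]
  have hsinh : ∀ s : ℝ, 0 < s → (1 - Real.exp (-2 * s)) / 2 * Real.exp (s * |w.re|) ≤
      ‖Complex.sinh (s * w)‖ := fun s hs => by
    refine le_trans ?_ (abs_sinh_re_le_norm_sinh _)
    rw [Complex.re_ofReal_mul, Real.abs_sinh, abs_mul, abs_of_pos hs]
    exact sinh_ge_of_le (by nlinarith)
  have hden : 2 * c₀ * c₁ * Real.exp ((b + b⁻¹) * |w.re|) ≤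
      ‖2 * Complex.sinh (b * w) * Complex.sinh ((b : ℂ)⁻¹ * w) * w‖ := by
    have e1 := hsinh b hb
    have e2 := hsinh b⁻¹ hb'
    rw [Complex.ofReal_inv] at e2
    have e3 : 1 ≤ ‖w‖ := hw.trans (Complex.abs_re_le_norm w)
    rw [norm_mul, norm_mul, norm_mul, Complex.norm_two]
    calc _ = 2 * (c₀ * Real.exp (b * |w.re|)) * (c₁ * Real.exp (b⁻¹ * |w.re|)) * 1 := by
          rw [add_mul, Real.exp_add]; ring
      _ ≤ _ := by gcongr
  have hnum : ‖Complex.cos (2 * z * w)‖ ≤ Real.exp (2 * |z.re| * ε) *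
      Real.exp (2 * |z.im| * |w.re|) := by
    refine (norm_cos_le_exp_abs_im _).trans ?_
    rw [← Real.exp_add]
    refine Real.exp_le_exp.2 ?_
    have : (2 * z * w).im = 2 * (z.re * w.im) + 2 * (z.im * w.re) := by simp; ring
    rw [this]
    refine (abs_add_le _ _).trans ?_
    simp only [abs_mul, abs_two]
    have := mul_le_mul_of_nonneg_left hwi (abs_nonneg z.re)
    linarith
  calc _ ≤ Real.exp (2 * |z.re| * ε) * Real.exp (2 * |z.im| * |w.re|) /
        (2 * c₀ * c₁ * Real.exp ((b + b⁻¹) * |w.re|)) := by gcongr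
    _ = _ := by
      rw [mul_div_mul_comm, ← Real.exp_sub]; congr 2; ring

/-- The inversion relation of the quantum dilogarithm. -/
lemma logPhi_add_logPhi_neg {b : ℝ} (hb : 0 < b) (hb1 : b ≤ 1) {z : ℂ}
    (hz : 2 * |z.im| < b + b⁻¹) :
    logPhi b z + logPhi b (-z) =
      π * Complex.I * (z ^ 2 + ((b : ℂ) ^ 2 + (b : ℂ)⁻¹ ^ 2) / 12) := by
  have hmin : min b b⁻¹ = b := min_eq_left (hb1.trans ((one_le_inv₀ hb).2 hb1))
  have hε : 0 < π * b / 2 := by positivity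
  set U : Set ℂ := {w | |w.im| < π * b} with hU
  have hUo : IsOpen U := isOpen_lt (by fun_prop) continuous_const
  have hU0 : U ∈ 𝓝 (0 : ℂ) := hUo.mem_nhds (by simp [hU]; positivity)
  have hd : DifferentiableOn ℂ (invKer b z) U := by
    intro w hw
    have h1 : DifferentiableAt ℂ (fun w : ℂ => 2 * sinhc (b * w) * sinhc ((b : ℂ)⁻¹ * w)) w := by
      have := differentiable_sinhc
      fun_prop
    exact (DifferentiableAt.div (by fun_prop) h1
      (invKer_den_ne_zero hb hb1 hw)).differentiableWithinAt
  obtain ⟨r, hrd, hr⟩ := exists_regular_part hU0 hd (tendsto_invKer hb hb1 z)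
  set β : ℂ := -(z ^ 2 + ((b : ℂ) ^ 2 + (b : ℂ)⁻¹ ^ 2) / 12) with hβ
  have hr' : ∀ w ≠ 0, invKer b z w / w ^ 3 = r w + invKer b z 0 / w ^ 3 + β / w := fun w hw => by
    rw [hr w hw]; field_simp; ring
  have hodd' : ∀ w ≠ 0, r (-w) = -r w := fun w hw => by
    rw [hr w hw, hr (-w) (neg_ne_zero.2 hw), invKer_neg]; field_simp
  have hr0 : r 0 = 0 := by
    have hc := (hrd.differentiableAt hU0).continuousAt.tendsto
    have hneg : Tendsto (fun w : ℂ => -w) (𝓝 0) (𝓝 0) := by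
      simpa using (continuous_neg (G := ℂ)).tendsto 0
    have h1 := (hc.comp hneg).mono_left (nhdsWithin_le_nhds (s := {0}ᶜ))
    have h2 := hc.neg.mono_left (nhdsWithin_le_nhds (s := {0}ᶜ))
    have h3 := tendsto_nhds_unique h1 (h2.congr' (by
      filter_upwards [self_mem_nhdsWithin] with w hw using (hodd' w hw).symm))
    exact self_eq_neg.1 h3
  obtain ⟨K, hK⟩ := exists_norm_invKer_div_le hb z (π * b / 2)
  have hw0 : ∀ t : ℝ, (t : ℂ) + (π * b / 2 : ℝ) * Complex.I ≠ 0 := fun t => by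
    simpa using line_ne_zero hb t
  have hker : ∀ t : ℝ, phiKer b z (t + Complex.I * (π * min b b⁻¹ / 2)) +
      phiKer b (-z) (t + Complex.I * (π * min b b⁻¹ / 2)) =
      invKer b z (t + (π * b / 2 : ℝ) * Complex.I) / (t + (π * b / 2 : ℝ) * Complex.I) ^ 3 := by
    intro t
    rw [hmin, show (t : ℂ) + Complex.I * (π * b / 2) = t + (π * b / 2 : ℝ) * Complex.I by
      push_cast; ring, phiKer_add_phiKer_neg hb z (hw0 t)]
  have hi1 := integrable_phiKer hb hb1 hz
  have hi2 := integrable_phiKer hb hb1 (z := -z) (by simpa using hz)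
  have hκ : 0 < b + b⁻¹ - 2 * |z.im| := sub_pos.2 hz
  have hBt : ∀ l : Filter ℝ, Tendsto (fun t : ℝ => |t|) l atTop →
      Tendsto (fun t : ℝ => K * Real.exp (-(b + b⁻¹ - 2 * |z.im|) * |t|) +
        ‖invKer b z 0‖ * (|t|⁻¹) ^ 3 + ‖β‖ * |t|⁻¹) l (𝓝 0) := by
    intro l hl
    have e1 : Tendsto (fun t : ℝ => Real.exp (-(b + b⁻¹ - 2 * |z.im|) * |t|)) l (𝓝 0) :=
      Real.tendsto_exp_atBot.comp (hl.const_mul_atTop_of_neg (by linarith))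
    have e2 : Tendsto (fun t : ℝ => |t|⁻¹) l (𝓝 0) := hl.inv_tendsto_atTop
    simpa using ((e1.const_mul K).add ((e2.pow 3).const_mul ‖invKer b z 0‖)).add (e2.const_mul ‖β‖)
  have key := integral_horizontal_of_odd (k := fun w => invKer b z w / w ^ 3) hε
    (α := invKer b z 0) (β := β) (r := r)
    (fun w hw => hrd.differentiableAt (hUo.mem_nhds (by
      simp only [hU, Set.mem_ofPred_eq]
      rw [abs_of_nonneg hw.1]; linarith [hw.2])))
    (fun t => by
      rcases eq_or_ne t 0 with rfl | ht
      · simp [hr0]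
      · exact hodd' t (by exact_mod_cast ht))
    (fun t ht y hy => by
      have hre : ((t : ℂ) + y * Complex.I).re = t := by simp
      have him : ((t : ℂ) + y * Complex.I).im = y := by simp
      have hn : |t| ≤ ‖(t : ℂ) + y * Complex.I‖ := by
        simpa [hre] using Complex.abs_re_le_norm ((t : ℂ) + y * Complex.I)
      have hwne : (t : ℂ) + y * Complex.I ≠ 0 := norm_pos_iff.1 (by linarith)
      have h1 := hK (t + y * Complex.I) (by rwa [hre]) (by rw [him, abs_of_nonneg hy.1]; exact hy.2)
      rw [hre] at h1
      have h2 : r (t + y * Complex.I) = invKer b z (t + y * Complex.I) / (t + y * Complex.I) ^ 3 -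
          invKer b z 0 / (t + y * Complex.I) ^ 3 - β / (t + y * Complex.I) := by
        rw [hr' _ hwne]; ring
      rw [h2]
      refine (norm_sub_le _ _).trans (add_le_add ((norm_sub_le _ _).trans
        (add_le_add h1 ?_)) ?_)
      · rw [norm_div, norm_pow, div_eq_mul_inv, ← inv_pow]
        gcongr
      · rw [norm_div, div_eq_mul_inv]
        gcongr)
    (hBt _ tendsto_abs_atTop_atTop) (hBt _ tendsto_abs_atBot_atTop)
    (fun t => hr' _ (hw0 t))
    ((hi1.add hi2).congr (Eventually.of_forall hker))
  rw [logPhi, logPhi, ← integral_add hi1 hi2]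
  simp only [hker]
  rw [key, hβ]
  ring

end Inversion

section Growth
open Filter Topology

/-- Bound for the logarithm of the quantum dilogarithm on `Re z ≤ 0`, `|Im z| ≤ Y`. -/
def logPhiBound (b Y : ℝ) : ℝ := (b ^ 3)⁻¹ * (2 / (b + b⁻¹ - 2 * Y))

lemma norm_logPhi_le_bound {b : ℝ} (hb : 0 < b) (hb1 : b ≤ 1) {z : ℂ} {Y : ℝ}
    (hz : |z.im| ≤ Y) (hY : 2 * Y < b + b⁻¹) :
    ‖logPhi b z‖ ≤ logPhiBound b Y * Real.exp (π * b * z.re) := by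
  refine (norm_logPhi_le hb hb1 (by linarith)).trans ?_
  rw [logPhiBound]
  have : 0 < b + b⁻¹ - 2 * Y := by linarith
  gcongr

lemma logPhiBound_nonneg {b Y : ℝ} (hb : 0 < b) (hY : 2 * Y < b + b⁻¹) : 0 ≤ logPhiBound b Y := by
  have : 0 < b + b⁻¹ - 2 * Y := by linarith
  rw [logPhiBound]; positivity

lemma re_inversion (b : ℝ) (z : ℂ) :
    (π * Complex.I * (z ^ 2 + ((b : ℂ) ^ 2 + (b : ℂ)⁻¹ ^ 2) / 12)).re = -(2 * π * z.re * z.im) := by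
  have : π * Complex.I * (z ^ 2 + ((b : ℂ) ^ 2 + (b : ℂ)⁻¹ ^ 2) / 12) =
      π * Complex.I * z ^ 2 + ((π * ((b ^ 2 + b⁻¹ ^ 2) / 12) : ℝ) : ℂ) * Complex.I := by
    push_cast; ring
  rw [this, Complex.add_re, Complex.re_ofReal_mul, Complex.I_re, mul_zero, add_zero, mul_assoc,
    Complex.re_ofReal_mul, Complex.I_mul_re, pow_two, Complex.mul_im]
  ring

/-- Two-sided control of the modulus of the quantum dilogarithm in closed substrips. -/
lemma abs_re_logPhi_add_le {b : ℝ} (hb : 0 < b) (hb1 : b ≤ 1) {z : ℂ} {Y : ℝ}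
    (hz : |z.im| ≤ Y) (hY : 2 * Y < b + b⁻¹) :
    |(logPhi b z).re + 2 * π * max z.re 0 * z.im| ≤ logPhiBound b Y := by
  have key : ∀ z : ℂ, |z.im| ≤ Y → z.re ≤ 0 → |(logPhi b z).re| ≤ logPhiBound b Y := by
    intro z hz hre
    refine (Complex.abs_re_le_norm _).trans ((norm_logPhi_le_bound hb hb1 hz hY).trans ?_)
    refine mul_le_of_le_one_right (logPhiBound_nonneg hb hY) (Real.exp_le_one_iff.2 ?_)
    exact mul_nonpos_of_nonneg_of_nonpos (by positivity) hre
  rcases le_total z.re 0 with h | h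
  · rw [max_eq_right h]
    simpa using key z hz h
  · rw [max_eq_left h]
    have h1 := key (-z) (by simpa using hz) (by simpa using h)
    have h2 := congrArg Complex.re (logPhi_add_logPhi_neg hb hb1 (z := z) (by linarith))
    rw [re_inversion, Complex.add_re] at h2
    rw [show (logPhi b z).re + 2 * π * z.re * z.im = -(logPhi b (-z)).re by linarith, abs_neg]
    exact h1

/-- The integrand of the Fourier transform of the inverse quantum dilogarithm. -/
def fourierKer (b : ℝ) (w z : ℂ) : ℂ :=
  Complex.exp (-logPhi b z) * Complex.exp (-2 * π * Complex.I * w * z)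

/-- The Fourier transform of the inverse quantum dilogarithm along the line `Im z = -δ`. -/
def fourierPhi (b δ : ℝ) (w : ℂ) : ℂ := ∫ t : ℝ, fourierKer b w (t + (-δ : ℝ) * Complex.I)

lemma norm_fourierKer_le {b : ℝ} (hb : 0 < b) (hb1 : b ≤ 1) {w z : ℂ} {Y : ℝ}
    (hz : |z.im| ≤ Y) (hY : 2 * Y < b + b⁻¹) {δ ε : ℝ} (hδ : z.im ≤ -δ) (hε : ε ≤ w.im)
    (hεδ : ε ≤ δ - w.im) :
    ‖fourierKer b w z‖ ≤
      Real.exp (logPhiBound b Y + 2 * π * (w.re * z.im)) * Real.exp (-(2 * π * ε) * |z.re|) := by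
  rw [fourierKer, ← Complex.exp_add, Complex.norm_exp, ← Real.exp_add]
  refine Real.exp_le_exp.2 ?_
  have h1 := (abs_le.1 (abs_re_logPhi_add_le hb hb1 hz hY)).1
  have h2 : (-2 * π * Complex.I * w * z).re = 2 * π * (w.re * z.im + w.im * z.re) := by
    rw [show -2 * π * Complex.I * w * z = ((-2 * π : ℝ) : ℂ) * (Complex.I * (w * z)) by
      push_cast; ring, Complex.re_ofReal_mul, Complex.I_mul_re, Complex.mul_im]
    ring
  rw [Complex.add_re, Complex.neg_re, h2]
  have h3 : max z.re 0 * z.im + w.im * z.re ≤ -ε * |z.re| := by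
    rcases le_total z.re 0 with h | h
    · rw [max_eq_right h, abs_of_nonpos h]; nlinarith
    · rw [max_eq_left h, abs_of_nonneg h]; nlinarith
  nlinarith [mul_le_mul_of_nonneg_left h3 Real.two_pi_pos.le]

lemma differentiableAt_fourierKer {b : ℝ} (hb : 0 < b) (hb1 : b ≤ 1) (w : ℂ) {z : ℂ}
    (hz : 2 * |z.im| < b + b⁻¹) : DifferentiableAt ℂ (fourierKer b w) z := by
  have := differentiableAt_logPhi hb hb1 hz
  unfold fourierKer
  fun_prop

lemma continuous_logPhi_line {b : ℝ} (hb : 0 < b) (hb1 : b ≤ 1) {y : ℝ}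
    (hy : 2 * |y| < b + b⁻¹) : Continuous fun t : ℝ => logPhi b (t + (y : ℝ) * Complex.I) := by
  refine continuous_iff_continuousAt.2 fun t => ?_
  refine ContinuousAt.comp (g := logPhi b) (differentiableAt_logPhi hb hb1 ?_).continuousAt
    (by fun_prop)
  simpa using hy

lemma continuous_fourierKer_line {b : ℝ} (hb : 0 < b) (hb1 : b ≤ 1) (w : ℂ) {y : ℝ}
    (hy : 2 * |y| < b + b⁻¹) :
    Continuous fun t : ℝ => fourierKer b w (t + (y : ℝ) * Complex.I) := by
  have := continuous_logPhi_line hb hb1 hy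
  unfold fourierKer
  fun_prop

lemma integrable_fourierKer {b : ℝ} (hb : 0 < b) (hb1 : b ≤ 1) {w : ℂ} {δ : ℝ}
    (hw : 0 < w.im) (hwδ : w.im < δ) (hδ : 2 * δ < b + b⁻¹) :
    Integrable fun t : ℝ => fourierKer b w (t + (-δ : ℝ) * Complex.I) := by
  have hδ0 : 0 < δ := hw.trans hwδ
  have hab : |-δ| = δ := by rw [abs_neg, abs_of_pos hδ0]
  have hε : 0 < min w.im (δ - w.im) := lt_min hw (by linarith)
  refine ((integrable_exp_neg_mul_abs (κ := 2 * π * min w.im (δ - w.im))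
    (by positivity)).const_mul (Real.exp (logPhiBound b δ + 2 * π * (w.re * (-δ))))).mono'
    (continuous_fourierKer_line hb hb1 w (by rwa [hab])).aestronglyMeasurable
    (Eventually.of_forall fun t => ?_)
  have him : ((t : ℂ) + (-δ : ℝ) * Complex.I).im = -δ := by simp
  have hre : ((t : ℂ) + (-δ : ℝ) * Complex.I).re = t := by simp
  have := norm_fourierKer_le hb hb1 (w := w) (z := t + (-δ : ℝ) * Complex.I) (Y := δ) (δ := δ)
    (by rw [him, hab]) hδ (by rw [him]) (min_le_left _ _) (min_le_right _ _)
  rwa [him, hre] at this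

lemma norm_fourierPhi_le {b : ℝ} (hb : 0 < b) (hb1 : b ≤ 1) {w : ℂ} {δ ε : ℝ}
    (hε : 0 < ε) (hw : ε ≤ w.im) (hwδ : ε ≤ δ - w.im) (hδ : 2 * δ < b + b⁻¹) :
    ‖fourierPhi b δ w‖ ≤
      Real.exp (logPhiBound b δ) * (2 / (2 * π * ε)) * Real.exp (-(2 * π * δ * w.re)) := by
  have hab : |-δ| = δ := by rw [abs_neg, abs_of_pos (by linarith)]
  have hκ : 0 < 2 * π * ε := by positivity
  refine (norm_integral_le_of_norm_le ((integrable_exp_neg_mul_abs hκ).const_mul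
    (Real.exp (logPhiBound b δ + 2 * π * (w.re * (-δ))))) (Eventually.of_forall fun t => ?_)).trans ?_
  · have him : ((t : ℂ) + (-δ : ℝ) * Complex.I).im = -δ := by simp
    have hre : ((t : ℂ) + (-δ : ℝ) * Complex.I).re = t := by simp
    have := norm_fourierKer_le hb hb1 (w := w) (z := t + (-δ : ℝ) * Complex.I) (Y := δ) (δ := δ)
      (by rw [him, hab]) hδ (by rw [him]) hw hwδ
    rwa [him, hre] at this
  · rw [integral_const_mul, integral_exp_neg_mul_abs hκ, Real.exp_add]
    refine le_of_eq ?_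
    rw [show 2 * π * (w.re * -δ) = -(2 * π * δ * w.re) by ring]
    ring

/-- The line of integration may be moved inside the strip of holomorphy. -/
lemma fourierPhi_eq_of_le {b : ℝ} (hb : 0 < b) (hb1 : b ≤ 1) {w : ℂ} {δ₁ δ₂ : ℝ}
    (hw : 0 < w.im) (h1 : w.im < δ₁) (h12 : δ₁ ≤ δ₂) (h2 : 2 * δ₂ < b + b⁻¹) :
    fourierPhi b δ₁ w = fourierPhi b δ₂ w := by
  have huI : Set.uIcc (-δ₁) (-δ₂) = Set.Icc (-δ₂) (-δ₁) := Set.uIcc_of_ge (by linarith)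
  have hε : 0 < min w.im (δ₁ - w.im) := lt_min hw (by linarith)
  have habs : ∀ y ∈ Set.Icc (-δ₂) (-δ₁), |y| ≤ δ₂ := fun y hy =>
    abs_le.2 ⟨hy.1, by linarith [hy.2]⟩
  have hBt : ∀ l : Filter ℝ, Tendsto (fun t : ℝ => |t|) l atTop →
      Tendsto (fun t : ℝ => Real.exp (logPhiBound b δ₂ + 2 * π * (|w.re| * δ₂)) *
        Real.exp (-(2 * π * min w.im (δ₁ - w.im)) * |t|)) l (𝓝 0) := by
    intro l hl
    have e1 : Tendsto (fun t : ℝ => Real.exp (-(2 * π * min w.im (δ₁ - w.im)) * |t|)) l (𝓝 0) :=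
      Real.tendsto_exp_atBot.comp (hl.const_mul_atTop_of_neg (by
        have : 0 < 2 * π * min w.im (δ₁ - w.im) := by positivity
        linarith))
    simpa using e1.const_mul (Real.exp (logPhiBound b δ₂ + 2 * π * (|w.re| * δ₂)))
  refine integral_horizontal_eq (F := fourierKer b w) (fun z hz => ?_) (fun t _ y hy => ?_)
    (hBt _ tendsto_abs_atTop_atTop) (hBt _ tendsto_abs_atBot_atTop)
    (integrable_fourierKer hb hb1 hw h1 (by linarith))
    (integrable_fourierKer hb hb1 hw (by linarith) h2)
  · rw [huI] at hz
    exact differentiableAt_fourierKer hb hb1 w (by linarith [habs _ hz])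
  · rw [huI] at hy
    have him : ((t : ℂ) + y * Complex.I).im = y := by simp
    have hre : ((t : ℂ) + y * Complex.I).re = t := by simp
    have := norm_fourierKer_le hb hb1 (w := w) (z := t + y * Complex.I) (Y := δ₂) (δ := δ₁)
      (by rw [him]; exact habs y hy) h2 (by rw [him]; exact hy.2) (min_le_left _ _)
      (min_le_right _ _)
    rw [him, hre] at this
    refine this.trans ?_
    have hwy : w.re * y ≤ |w.re| * δ₂ :=
      (le_abs_self _).trans (by rw [abs_mul]; gcongr; exact habs y hy)
    gcongr ?_ * _
    exact Real.exp_le_exp.2 (by linarith [mul_le_mul_of_nonneg_left hwy Real.two_pi_pos.le])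

lemma fourierPhi_eq {b : ℝ} (hb : 0 < b) (hb1 : b ≤ 1) {w : ℂ} {δ₁ δ₂ : ℝ}
    (hw : 0 < w.im) (h1 : w.im < δ₁) (h1' : 2 * δ₁ < b + b⁻¹) (h2 : w.im < δ₂)
    (h2' : 2 * δ₂ < b + b⁻¹) : fourierPhi b δ₁ w = fourierPhi b δ₂ w := by
  rcases le_total δ₁ δ₂ with h | h
  · exact fourierPhi_eq_of_le hb hb1 hw h1 h h2'
  · exact (fourierPhi_eq_of_le hb hb1 hw h2 h h1').symm

lemma fourierPhi_eq_laplace (b δ : ℝ) (w : ℂ) :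
    fourierPhi b δ w = Complex.exp (-(2 * π * δ * w)) *
      ∫ t : ℝ, Complex.exp (-logPhi b (t + (-δ : ℝ) * Complex.I)) *
        Complex.exp (-2 * π * Complex.I * w * t) := by
  rw [fourierPhi, ← integral_const_mul]
  congr 1 with t
  rw [fourierKer, mul_left_comm, ← Complex.exp_add (-(2 * π * δ * w))]
  congr 2
  push_cast
  linear_combination (2 * π * δ * w) * Complex.I_sq

lemma differentiableAt_fourierPhi {b : ℝ} (hb : 0 < b) (hb1 : b ≤ 1) {w : ℂ} {δ : ℝ}
    (hw : 0 < w.im) (hwδ : w.im < δ) (hδ : 2 * δ < b + b⁻¹) :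
    DifferentiableAt ℂ (fourierPhi b δ) w := by
  have hre : ∀ w : ℂ, (-2 * π * Complex.I * w).re = 2 * π * w.im := fun w => by
    rw [show -2 * π * Complex.I * w = ((-2 * π : ℝ) : ℂ) * (Complex.I * w) by
      push_cast; ring, Complex.re_ofReal_mul, Complex.I_mul_re]
    ring
  have hm : Continuous fun t : ℝ => Complex.exp (-logPhi b (t + (-δ : ℝ) * Complex.I)) := by
    have := continuous_logPhi_line hb hb1 (y := -δ)
      (by rwa [abs_neg, abs_of_pos (hw.trans hwδ)])
    fun_prop
  have h := (hasDerivAt_laplace hm (α := 0) (β := 2 * π * δ) (ζ := -2 * π * Complex.I * w)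
    (fun ξ hξ => ?_) ?_).2.2.differentiableAt
  · have h2 : DifferentiableAt ℂ (fun w : ℂ => -2 * π * Complex.I * w) w := by fun_prop
    have h3 := DifferentiableAt.comp w h h2
    rw [show fourierPhi b δ = _ from funext (fourierPhi_eq_laplace b δ)]
    exact DifferentiableAt.mul (by fun_prop) h3
  · have him : (((ξ / (2 * π) : ℝ) : ℂ) * Complex.I).im = ξ / (2 * π) := by
      rw [Complex.im_ofReal_mul, Complex.I_im, mul_one]
    have h1 := integrable_fourierKer hb hb1 (w := (ξ / (2 * π) : ℝ) * Complex.I) (δ := δ)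
      (by rw [him]; exact div_pos hξ.1 Real.two_pi_pos)
      (by rw [him]; exact (div_lt_iff₀' Real.two_pi_pos).2 hξ.2) hδ
    refine (h1.const_mul (Complex.exp (2 * π * δ * ((ξ / (2 * π) : ℝ) * Complex.I)))).congr
      (Eventually.of_forall fun t => ?_)
    simp only [fourierKer]
    rw [mul_left_comm, ← Complex.exp_add]
    congr 2
    have : (π : ℂ) ≠ 0 := by exact_mod_cast Real.pi_ne_zero
    push_cast
    field_simp
    linear_combination (ξ * (δ * Complex.I - t)) * Complex.I_sq
  · rw [hre]
    have := Real.two_pi_pos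
    exact ⟨by positivity, by gcongr⟩

end Growth

section FourierTransform
open Filter Topology

lemma cB_eq (b : ℝ) : cB b = ((b + b⁻¹) / 2 : ℝ) * Complex.I := by
  rw [cB]; push_cast; ring

lemma sub_cB_im (b : ℝ) (w : ℂ) : (w - cB b).im = w.im - (b + b⁻¹) / 2 := by
  rw [cB_eq, Complex.sub_im, Complex.im_ofReal_mul, Complex.I_im, mul_one]

lemma sub_cB_re (b : ℝ) (w : ℂ) : (w - cB b).re = w.re := by
  rw [cB_eq, Complex.sub_re, Complex.re_ofReal_mul, Complex.I_re, mul_zero, sub_zero]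

lemma exp_neg_logPhi_add {b : ℝ} (hb : 0 < b) (hb1 : b ≤ 1) {z : ℂ}
    (hz : 2 * |z.im + b / 2| < b⁻¹) :
    Complex.exp (-logPhi b (z + b * Complex.I)) =
      Complex.exp (-logPhi b z) * (1 + Complex.exp (2 * π * b * (z + b / 2 * Complex.I))) := by
  have him : (z + b / 2 * Complex.I).im = z.im + b / 2 := by
    rw [show (b : ℂ) / 2 * Complex.I = ((b / 2 : ℝ) : ℂ) * Complex.I by push_cast; ring]
    simp only [Complex.add_im, Complex.im_ofReal_mul, Complex.I_im, mul_one]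
  have h := exp_logPhi_sub hb hb1 (z := z + b / 2 * Complex.I) (by rwa [him])
  rw [show z + b / 2 * Complex.I - b / 2 * Complex.I = z by ring,
    show z + b / 2 * Complex.I + b / 2 * Complex.I = z + b * Complex.I by ring] at h
  rw [Complex.exp_neg, Complex.exp_neg, h]
  have h1 : 1 + Complex.exp (2 * π * b * (z + b / 2 * Complex.I)) ≠ 0 := fun h0 =>
    Complex.exp_ne_zero (logPhi b z) (by rw [h, h0, zero_mul])
  rw [mul_inv, mul_comm _⁻¹, mul_assoc, inv_mul_cancel₀ h1, mul_one]

lemma exp_logPhi_sub_cB {b : ℝ} (hb : 0 < b) (hb1 : b ≤ 1) {w : ℂ}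
    (hw : 0 < w.im) (hwb : w.im < b⁻¹) :
    Complex.exp (logPhi b (w - cB b)) = (1 - Complex.exp (2 * π * b * w)) *
      Complex.exp (logPhi b (w + b * Complex.I - cB b)) := by
  have hbc : (b : ℂ) ≠ 0 := by exact_mod_cast hb.ne'
  have hbR : ((b⁻¹ / 2 : ℝ) : ℂ) = (b : ℂ)⁻¹ / 2 := by push_cast; ring
  have him : (w - (b⁻¹ / 2 : ℝ) * Complex.I).im = w.im - b⁻¹ / 2 := by
    rw [Complex.sub_im, Complex.im_ofReal_mul, Complex.I_im, mul_one]
  have h := exp_logPhi_sub hb hb1 (z := w - (b⁻¹ / 2 : ℝ) * Complex.I) (by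
    rw [him]
    have : |w.im - b⁻¹ / 2| < b⁻¹ / 2 := abs_lt.2 ⟨by linarith, by linarith⟩
    linarith)
  rw [show w - (b⁻¹ / 2 : ℝ) * Complex.I - b / 2 * Complex.I = w - cB b by
      rw [cB, hbR]; push_cast; ring,
    show w - (b⁻¹ / 2 : ℝ) * Complex.I + b / 2 * Complex.I = w + b * Complex.I - cB b by
      rw [cB, hbR]; push_cast; ring,
    show 2 * π * b * (w - (b⁻¹ / 2 : ℝ) * Complex.I) = 2 * π * b * w - π * Complex.I by
      rw [hbR]; field_simp, Complex.exp_sub, Complex.exp_pi_mul_I] at h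
  rw [h]; ring

/-- The difference equation of the Fourier transform. -/
lemma fourierPhi_add {b : ℝ} (hb : 0 < b) (hb1 : b ≤ 1) {w : ℂ} {δ : ℝ}
    (hw : 0 < w.im) (hwδ : w.im + b < δ) (hδ : 2 * δ < b + b⁻¹) :
    fourierPhi b δ (w + b * Complex.I) = Complex.exp (-(π * Complex.I * b ^ 2)) *
      (Complex.exp (-(2 * π * b * w)) - 1) * fourierPhi b δ w := by
  have himb : (w + b * Complex.I).im = w.im + b := by simp
  have h1 := fourierPhi_eq hb hb1 hw (δ₁ := δ) (δ₂ := δ - b) (by linarith) hδ (by linarith)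
    (by linarith)
  have h2 : fourierPhi b (δ - b) w = Complex.exp (2 * π * b * w) * (fourierPhi b δ w +
      Complex.exp (π * Complex.I * b ^ 2) * fourierPhi b δ (w + b * Complex.I)) := by
    rw [fourierPhi, fourierPhi, fourierPhi, ← integral_const_mul, ← integral_add,
      ← integral_const_mul]
    rotate_left
    · exact integrable_fourierKer hb hb1 hw (by linarith) hδ
    · exact (integrable_fourierKer hb hb1 (by rw [himb]; linarith) (by rw [himb]; linarith)
        hδ).const_mul _
    congr 1 with t
    set z : ℂ := t + (-δ : ℝ) * Complex.I with hz
    have hzim : z.im = -δ := by simp [hz]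
    have e := exp_neg_logPhi_add hb hb1 (z := z) (by
      rw [hzim]
      have hbi : b ≤ b⁻¹ := hb1.trans ((one_le_inv₀ hb).2 hb1)
      have : |-δ + b / 2| < b⁻¹ / 2 := abs_lt.2 ⟨by linarith, by linarith⟩
      linarith)
    rw [show (t : ℂ) + (-(δ - b) : ℝ) * Complex.I = z + b * Complex.I by
      rw [hz]; push_cast; ring]
    simp only [fourierKer]
    rw [e]
    have e1 : Complex.exp (-2 * π * Complex.I * w * (z + b * Complex.I)) =
        Complex.exp (2 * π * b * w) * Complex.exp (-2 * π * Complex.I * w * z) := by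
      rw [← Complex.exp_add]; congr 1
      linear_combination (-2 * π * w * b) * Complex.I_sq
    have e2 : Complex.exp (2 * π * b * (z + b / 2 * Complex.I)) *
        Complex.exp (-2 * π * Complex.I * w * z) = Complex.exp (π * Complex.I * b ^ 2) *
        Complex.exp (-2 * π * Complex.I * (w + b * Complex.I) * z) := by
      rw [← Complex.exp_add, ← Complex.exp_add]; congr 1
      linear_combination (2 * π * b * z) * Complex.I_sq
    rw [e1]
    linear_combination (Complex.exp (2 * π * b * w) * Complex.exp (-logPhi b z)) * e2
  rw [← h1] at h2
  rw [Complex.exp_neg, Complex.exp_neg]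
  have n1 := Complex.exp_ne_zero (π * Complex.I * b ^ 2)
  have n2 := Complex.exp_ne_zero (2 * π * b * w)
  generalize Complex.exp (π * Complex.I * b ^ 2) = E₁ at *
  generalize Complex.exp (2 * π * b * w) = E₂ at *
  field_simp
  linear_combination -h2

/-- The Fourier transform of the inverse quantum dilogarithm divided by its expected value. -/
def fourierRatio (b δ : ℝ) (w : ℂ) : ℂ :=
  fourierPhi b δ w * Complex.exp (-(π * Complex.I * w ^ 2)) * Complex.exp (logPhi b (w - cB b))

lemma fourierRatio_add {b : ℝ} (hb : 0 < b) (hb1 : b ≤ 1) {w : ℂ} {δ : ℝ}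
    (hw : 0 < w.im) (hwδ : w.im + b < δ) (hδ : 2 * δ < b + b⁻¹) :
    fourierRatio b δ (w + b * Complex.I) = fourierRatio b δ w := by
  rw [fourierRatio, fourierRatio, fourierPhi_add hb hb1 hw hwδ hδ,
    exp_logPhi_sub_cB hb hb1 hw (by linarith)]
  have e : Complex.exp (-(π * Complex.I * (w + b * Complex.I) ^ 2)) =
      Complex.exp (-(π * Complex.I * w ^ 2)) * Complex.exp (2 * π * b * w) *
        Complex.exp (π * Complex.I * b ^ 2) := by
    rw [← Complex.exp_add, ← Complex.exp_add]; congr 1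
    linear_combination (-(2 * π * b * w) - π * b ^ 2 * Complex.I) * Complex.I_sq
  rw [e, Complex.exp_neg, Complex.exp_neg (2 * π * b * w)]
  have n1 := Complex.exp_ne_zero (π * Complex.I * b ^ 2)
  have n2 := Complex.exp_ne_zero (2 * π * b * w)
  generalize Complex.exp (π * Complex.I * b ^ 2) = E₁ at *
  generalize Complex.exp (2 * π * b * w) = E₂ at *
  field_simp

lemma two_mul_abs_sub_cB_im_lt {b σ : ℝ} (hσ : 0 < σ) (hσ' : 2 * σ < b + b⁻¹) :
    2 * |σ - (b + b⁻¹) / 2| < b + b⁻¹ := by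
  rw [abs_of_neg (by linarith)]; linarith

lemma differentiableAt_fourierRatio {b : ℝ} (hb : 0 < b) (hb1 : b ≤ 1) {w : ℂ} {δ : ℝ}
    (hw : 0 < w.im) (hwδ : w.im < δ) (hδ : 2 * δ < b + b⁻¹) :
    DifferentiableAt ℂ (fourierRatio b δ) w := by
  have h1 := differentiableAt_fourierPhi hb hb1 hw hwδ hδ
  have h2 : DifferentiableAt ℂ (logPhi b) (w - cB b) := differentiableAt_logPhi hb hb1 (by
    rw [sub_cB_im]; exact two_mul_abs_sub_cB_im_lt hw (by linarith))
  have h3 : DifferentiableAt ℂ (fun w => logPhi b (w - cB b)) w :=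
    DifferentiableAt.comp (g := logPhi b) w h2 (by fun_prop)
  unfold fourierRatio
  fun_prop

lemma exists_norm_fourierRatio_le {b : ℝ} (hb : 0 < b) (hb1 : b ≤ 1) {δ σ₀ σ₁ : ℝ}
    (hσ : 0 < σ₀) (hσδ : σ₁ < δ) (hδ : 2 * δ < b + b⁻¹) :
    ∃ C, ∀ w : ℂ, w.im ∈ Set.Icc σ₀ σ₁ → ‖fourierRatio b δ w‖ ≤
      C * Real.exp (2 * π * max ((b + b⁻¹) / 2 - δ) (δ - σ₀) * |w.re|) := by
  set ε := min σ₀ (δ - σ₁) with hε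
  have hε0 : 0 < ε := lt_min hσ (by linarith)
  set Y := (b + b⁻¹) / 2 - σ₀ with hY
  refine ⟨Real.exp (logPhiBound b δ) * (2 / (2 * π * ε)) * Real.exp (logPhiBound b Y),
    fun w hw => ?_⟩
  have h1 := norm_fourierPhi_le hb hb1 (w := w) (δ := δ) hε0 ((min_le_left _ _).trans hw.1)
    ((min_le_right _ _).trans (by linarith [hw.2])) hδ
  have h2 : ‖Complex.exp (-(π * Complex.I * w ^ 2))‖ = Real.exp (2 * π * w.re * w.im) := by
    rw [Complex.norm_exp]; congr 1
    rw [Complex.neg_re, mul_assoc, Complex.re_ofReal_mul, Complex.I_mul_re, pow_two,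
      Complex.mul_im]
    ring
  have h3 : ‖Complex.exp (logPhi b (w - cB b))‖ ≤ Real.exp (logPhiBound b Y) *
      Real.exp (2 * π * max w.re 0 * ((b + b⁻¹) / 2 - w.im)) := by
    rw [Complex.norm_exp, ← Real.exp_add]
    refine Real.exp_le_exp.2 ?_
    have := (abs_le.1 (abs_re_logPhi_add_le hb hb1 (z := w - cB b) (Y := Y) (by
      rw [sub_cB_im, abs_of_neg (by linarith [hw.2]), hY]; linarith [hw.1]) (by
      rw [hY]; linarith))).2
    rw [sub_cB_im, sub_cB_re] at this
    linarith
  rw [fourierRatio, norm_mul, norm_mul, h2]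
  calc _ ≤ Real.exp (logPhiBound b δ) * (2 / (2 * π * ε)) * Real.exp (-(2 * π * δ * w.re)) *
        Real.exp (2 * π * w.re * w.im) * (Real.exp (logPhiBound b Y) *
        Real.exp (2 * π * max w.re 0 * ((b + b⁻¹) / 2 - w.im))) := by gcongr
    _ = Real.exp (logPhiBound b δ) * (2 / (2 * π * ε)) * Real.exp (logPhiBound b Y) *
        Real.exp (2 * π * (-(δ * w.re) + w.re * w.im + max w.re 0 * ((b + b⁻¹) / 2 - w.im))) := by
      rw [show 2 * π * (-(δ * w.re) + w.re * w.im + max w.re 0 * ((b + b⁻¹) / 2 - w.im)) =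
        -(2 * π * δ * w.re) + 2 * π * w.re * w.im +
          2 * π * max w.re 0 * ((b + b⁻¹) / 2 - w.im) by ring, Real.exp_add, Real.exp_add]
      ring
    _ ≤ _ := by
      gcongr ?_ * ?_
      refine Real.exp_le_exp.2 ?_
      rw [mul_assoc _ (max _ _)]
      refine mul_le_mul_of_nonneg_left ?_ Real.two_pi_pos.le
      rcases le_total w.re 0 with h | h
      · rw [max_eq_right h, abs_of_nonpos h]
        have := le_max_right ((b + b⁻¹) / 2 - δ) (δ - σ₀)
        nlinarith [hw.1]
      · rw [max_eq_left h, abs_of_nonneg h]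
        have := le_max_left ((b + b⁻¹) / 2 - δ) (δ - σ₀)
        nlinarith

lemma exists_fourierRatio_eq_of_lt {b δ : ℝ} (hb : 0 < b) (hb1 : b ≤ 1) (hδb : b < δ)
    (hδ : 2 * δ < b + b⁻¹) :
    ∃ C : ℂ, ∀ w : ℂ, 0 < w.im → w.im < δ → fourierRatio b δ w = C := by
  have hbi : 1 ≤ b⁻¹ := (one_le_inv₀ hb).2 hb1
  obtain ⟨G, hG, hGp, hGe⟩ := exists_entire_periodic_extension (g := fourierRatio b δ)
    (α := 0) (β := δ) hb (by linarith)
    (fun z hz => differentiableAt_fourierRatio hb hb1 hz.1 hz.2 hδ)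
    (fun z h1 h2 => fourierRatio_add hb hb1 h1 h2 hδ)
  obtain ⟨σ₀, hσ0, hσ⟩ : ∃ σ, 0 < σ ∧ σ < δ - b := exists_between (by linarith)
  obtain ⟨C, hC⟩ := exists_norm_fourierRatio_le hb hb1 (σ₁ := σ₀ + b) hσ0 (by linarith) hδ
  have hκ : 2 * π * max ((b + b⁻¹) / 2 - δ) (δ - σ₀) < 2 * π / b := by
    rw [div_eq_mul_inv]
    refine mul_lt_mul_of_pos_left (max_lt ?_ ?_) Real.two_pi_pos <;> linarith
  have hconst := eq_const_of_periodic_of_growth hG hb hGp hκ (σ := σ₀) (C := C) fun z hz => by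
    rw [hGe z ⟨by linarith [hz.1], by linarith [hz.2]⟩]
    exact hC z hz
  exact ⟨G 0, fun w h1 h2 => by rw [← hGe w ⟨h1, h2⟩]; exact hconst _ _⟩

/-- For `b < 1` the Fourier transform is proportional to its expected value. -/
lemma exists_fourierRatio_eq {b : ℝ} (hb : 0 < b) (hb1 : b < 1) :
    ∃ C : ℂ, ∀ (δ : ℝ) (w : ℂ), 0 < w.im → w.im < δ → 2 * δ < b + b⁻¹ →
      fourierRatio b δ w = C := by
  have hbi : 1 < b⁻¹ := (one_lt_inv₀ hb).2 hb1
  obtain ⟨δ, hδb, hδ⟩ : ∃ δ, b < δ ∧ δ < (b + b⁻¹) / 2 := exists_between (by linarith)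
  have hδ' : 2 * δ < b + b⁻¹ := by linarith
  have hshift : ∀ (δ₁ δ₂ : ℝ) (w : ℂ), 0 < w.im → w.im < δ₁ → 2 * δ₁ < b + b⁻¹ → w.im < δ₂ →
      2 * δ₂ < b + b⁻¹ → fourierRatio b δ₁ w = fourierRatio b δ₂ w := fun δ₁ δ₂ w h h1 h1' h2 h2' => by
    rw [fourierRatio, fourierRatio, fourierPhi_eq hb hb1.le h h1 h1' h2 h2']
  obtain ⟨C, hC⟩ := exists_fourierRatio_eq_of_lt hb hb1.le hδb hδ'
  refine ⟨C, fun δ₁ w h1 h2 h3 => ?_⟩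
  have hmax : 2 * max δ δ₁ < b + b⁻¹ := by rcases max_cases δ δ₁ with h | h <;> linarith [h.1]
  obtain ⟨C', hC'⟩ := exists_fourierRatio_eq_of_lt hb hb1.le (hδb.trans_le (le_max_left δ δ₁)) hmax
  have him : (((b : ℝ) : ℂ) * Complex.I).im = b := by simp
  rw [hshift δ₁ (max δ δ₁) w h1 h2 h3 (lt_max_of_lt_right h2) hmax,
    hC' w h1 (lt_max_of_lt_right h2), ← hC (b * Complex.I) (by rwa [him]) (by rwa [him]),
    ← hC' (b * Complex.I) (by rwa [him]) (by rw [him]; exact lt_max_of_lt_left hδb)]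
  exact hshift _ _ _ (by rwa [him]) (by rw [him]; exact lt_max_of_lt_left hδb) hmax
    (by rwa [him]) hδ'

end FourierTransform

section FourierConstant
open Filter Topology

lemma norm_exp_sub_one_le_mul_exp (x : ℂ) : ‖Complex.exp x - 1‖ ≤ ‖x‖ * Real.exp ‖x‖ := by
  simpa using Complex.norm_exp_sub_sum_le_norm_mul_exp x 1

lemma norm_exp_neg_logPhi_sub_indicator_le {b : ℝ} (hb : 0 < b) (hb1 : b ≤ 1) {δ η : ℝ}
    (hη : 0 < η) (hηδ : 2 * η ≤ δ) (hδ : 2 * δ < b + b⁻¹) (t : ℝ) :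
    ‖Complex.exp (-logPhi b (t + (-δ : ℝ) * Complex.I)) * Complex.exp ((2 * π * η : ℝ) * t) -
      (Set.Iic (0 : ℝ)).indicator (fun t : ℝ => Complex.exp ((2 * π * η : ℝ) * t)) t‖ ≤
    Real.exp (logPhiBound b δ) * (logPhiBound b δ + 1) * Real.exp (-(π * min δ b) * |t|) := by
  have hδ0 : 0 < δ := by linarith
  have hM := logPhiBound_nonneg hb hδ
  set M := logPhiBound b δ
  set z : ℂ := t + (-δ : ℝ) * Complex.I with hz
  have hzim : |z.im| ≤ δ := by simp [hz, abs_of_pos hδ0]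
  have hzre : z.re = t := by simp [hz]
  have hE : ‖Complex.exp ((2 * π * η : ℝ) * t)‖ = Real.exp (2 * π * η * t) := by
    rw [norm_cexp_mul_ofReal, Complex.ofReal_re]
  have hπ := Real.pi_pos
  rcases le_or_gt t 0 with ht | ht
  · rw [Set.indicator_of_mem (Set.mem_Iic.2 ht), ← sub_one_mul, norm_mul, hE, abs_of_nonpos ht]
    have h1 := norm_logPhi_le_bound hb hb1 hzim hδ
    rw [hzre] at h1
    have h2 : Real.exp (π * b * t) ≤ 1 := Real.exp_le_one_iff.2
      (mul_nonpos_of_nonneg_of_nonpos (by positivity) ht)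
    have h3 : ‖logPhi b z‖ ≤ M := h1.trans (mul_le_of_le_one_right hM h2)
    have h4 : Real.exp (π * b * t) ≤ Real.exp (-(π * min δ b) * -t) := by
      refine Real.exp_le_exp.2 ?_
      have : min δ b * -t ≤ b * -t := mul_le_mul_of_nonneg_right (min_le_right _ _) (by linarith)
      nlinarith
    have h5 : Real.exp (2 * π * η * t) ≤ 1 := Real.exp_le_one_iff.2
      (mul_nonpos_of_nonneg_of_nonpos (by positivity) ht)
    have h6 := norm_exp_sub_one_le_mul_exp (-logPhi b z)
    rw [norm_neg] at h6
    calc _ ≤ ‖logPhi b z‖ * Real.exp ‖logPhi b z‖ * 1 := by gcongr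
      _ ≤ (M * Real.exp (π * b * t)) * Real.exp M * 1 := by gcongr
      _ = Real.exp M * M * Real.exp (π * b * t) := by ring
      _ ≤ _ := by gcongr; linarith
  · rw [Set.indicator_of_notMem (by simpa using ht), sub_zero, norm_mul, hE, Complex.norm_exp,
      abs_of_pos ht]
    have h1 := (abs_le.1 (abs_re_logPhi_add_le hb hb1 hzim hδ)).1
    rw [hzre, max_eq_left ht.le, show z.im = -δ by simp [hz]] at h1
    have h2 : min δ b * t ≤ δ * t := mul_le_mul_of_nonneg_right (min_le_left _ _) ht.le
    have h3 : 2 * η * t ≤ δ * t := mul_le_mul_of_nonneg_right hηδ ht.le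
    calc _ = Real.exp (-(logPhi b z).re + 2 * π * η * t) := by
          rw [Complex.neg_re, Real.exp_add]
      _ ≤ Real.exp (M + -(π * min δ b) * t) := by
          refine Real.exp_le_exp.2 ?_
          nlinarith
      _ = Real.exp M * 1 * Real.exp (-(π * min δ b) * t) := by rw [Real.exp_add, mul_one]
      _ ≤ _ := by gcongr; linarith

lemma tendsto_mul_fourierPhi {b : ℝ} (hb : 0 < b) (hb1 : b ≤ 1) {δ : ℝ} (hδ0 : 0 < δ)
    (hδ : 2 * δ < b + b⁻¹) :
    Tendsto (fun η : ℝ => (η : ℂ) * fourierPhi b δ (η * Complex.I)) (𝓝[>] 0)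
      (𝓝 (2 * π : ℂ)⁻¹) := by
  have hM := logPhiBound_nonneg hb hδ
  have hπ := Real.pi_pos
  have hκ : 0 < π * min δ b := by have := lt_min hδ0 hb; positivity
  set D := Real.exp (logPhiBound b δ) * (logPhiBound b δ + 1) * (2 / (π * min δ b)) with hD
  have hev : ∀ᶠ η : ℝ in 𝓝[>] 0, 0 < η ∧ 2 * η ≤ δ := by
    filter_upwards [Ioo_mem_nhdsGT (show (0 : ℝ) < δ / 2 by linarith)] with η hη
    exact ⟨hη.1, by linarith [hη.2]⟩
  have hint : ∀ η : ℝ, 0 < η ∧ 2 * η ≤ δ →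
      ‖(∫ t : ℝ, Complex.exp (-logPhi b (t + (-δ : ℝ) * Complex.I)) *
        Complex.exp ((2 * π * η : ℝ) * t)) - ((2 * π * η : ℝ) : ℂ)⁻¹‖ ≤ D := by
    rintro η ⟨hη, hηδ⟩
    have h2 : 0 < 2 * π * η := by positivity
    have him : ((η : ℂ) * Complex.I).im = η := by simp
    have i1 : Integrable fun t : ℝ => Complex.exp (-logPhi b (t + (-δ : ℝ) * Complex.I)) *
        Complex.exp ((2 * π * η : ℝ) * t) := by
      refine ((integrable_fourierKer hb hb1 (w := η * Complex.I) (δ := δ) (by rwa [him])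
        (by rw [him]; linarith) hδ).const_mul (Complex.exp (2 * π * η * δ * Complex.I))).congr
        (Eventually.of_forall fun t => ?_)
      simp only [fourierKer]
      rw [mul_left_comm, ← Complex.exp_add (2 * π * η * δ * Complex.I)]
      congr 2
      push_cast
      linear_combination (-2 * π * η * t + 2 * π * η * δ * Complex.I) * Complex.I_sq
    have i2 : IntegrableOn (fun t : ℝ => Complex.exp ((2 * π * η : ℝ) * t)) (Set.Iic 0) :=
      integrableOn_exp_mul_complex_Iic (by simpa using h2) 0
    have e2 : ∫ t in Set.Iic (0 : ℝ), Complex.exp ((2 * π * η : ℝ) * t) =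
        ((2 * π * η : ℝ) : ℂ)⁻¹ := by
      rw [integral_exp_mul_complex_Iic (by simpa using h2) 0]; simp
    rw [← e2, ← integral_indicator measurableSet_Iic,
      ← integral_sub i1 (i2.integrable_indicator measurableSet_Iic)]
    refine (norm_integral_le_of_norm_le ((integrable_exp_neg_mul_abs hκ).const_mul _)
      (Eventually.of_forall (norm_exp_neg_logPhi_sub_indicator_le hb hb1 hη hηδ hδ))).trans ?_
    rw [integral_const_mul, integral_exp_neg_mul_abs hκ]
  have hlim : Tendsto (fun η : ℝ => (η : ℂ) *
      ∫ t : ℝ, Complex.exp (-logPhi b (t + (-δ : ℝ) * Complex.I)) *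
        Complex.exp ((2 * π * η : ℝ) * t)) (𝓝[>] 0) (𝓝 (2 * π : ℂ)⁻¹) := by
    rw [tendsto_iff_norm_sub_tendsto_zero]
    have hz : Tendsto (fun η : ℝ => η * D) (𝓝[>] 0) (𝓝 0) := by
      have : Continuous fun η : ℝ => η * D := by fun_prop
      simpa using (this.tendsto 0).mono_left nhdsWithin_le_nhds
    refine squeeze_zero' (Eventually.of_forall fun _ => norm_nonneg _) ?_ hz
    filter_upwards [hev] with η hη
    have hη0 : (η : ℂ) ≠ 0 := by exact_mod_cast hη.1.ne'
    have hpi : (π : ℂ) ≠ 0 := by exact_mod_cast hπ.ne'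
    have e : (2 * π : ℂ)⁻¹ = η * ((2 * π * η : ℝ) : ℂ)⁻¹ := by push_cast; field_simp
    rw [e, ← mul_sub, norm_mul, Complex.norm_real, Real.norm_of_nonneg hη.1.le]
    exact mul_le_mul_of_nonneg_left (hint η hη) hη.1.le
  have hph : Tendsto (fun η : ℝ => Complex.exp (-(2 * π * δ * (η * Complex.I)))) (𝓝[>] 0) (𝓝 1) := by
    have : Continuous fun η : ℝ => Complex.exp (-(2 * π * δ * (η * Complex.I))) := by fun_prop
    simpa using (this.tendsto 0).mono_left nhdsWithin_le_nhds
  have := hph.mul hlim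
  rw [one_mul] at this
  refine this.congr fun η => ?_
  rw [fourierPhi_eq_laplace, mul_left_comm]
  congr 3 with t
  congr 2
  push_cast
  linear_combination (2 * π * η * t) * Complex.I_sq

lemma tendsto_div_one_sub_exp {k : ℂ} (hk : k ≠ 0) :
    Tendsto (fun η : ℝ => (η : ℂ) / (1 - Complex.exp (k * η))) (𝓝[>] 0) (𝓝 (-k)⁻¹) := by
  have h : HasDerivAt (fun η : ℂ => 1 - Complex.exp (k * η)) (-k) ((0 : ℝ) : ℂ) := by
    have := ((hasDerivAt_id ((0 : ℝ) : ℂ)).const_mul k).cexp.const_sub 1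
    simpa using this
  have h2 := h.comp_ofReal.tendsto_slope
  have h3 := (h2.mono_left (nhdsWithin_mono _ (fun x (hx : 0 < x) => hx.ne'))).inv₀ (neg_ne_zero.2 hk)
  refine h3.congr fun η => ?_
  rw [slope_def_module]
  simp [div_eq_mul_inv, mul_comm]

/-- The value of the proportionality constant in terms of a special value of the quantum
dilogarithm. -/
lemma fourier_const_eq {b : ℝ} (hb : 0 < b) (hb1 : b ≤ 1) {C : ℂ}
    (hC : ∀ (δ : ℝ) (w : ℂ), 0 < w.im → w.im < δ → 2 * δ < b + b⁻¹ → fourierRatio b δ w = C) :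
    C = -(Complex.I * b) * Complex.exp (logPhi b (b * Complex.I - cB b)) := by
  have hbi : 0 < b⁻¹ := inv_pos.2 hb
  have hbc : (b : ℂ) ≠ 0 := by exact_mod_cast hb.ne'
  have hpi : (π : ℂ) ≠ 0 := by exact_mod_cast Real.pi_ne_zero
  obtain ⟨δ, hδ0, hδ⟩ : ∃ δ, 0 < δ ∧ δ < (b + b⁻¹) / 2 := exists_between (by positivity)
  have hδ' : 2 * δ < b + b⁻¹ := by linarith
  have h1 := tendsto_mul_fourierPhi hb hb1 hδ0 hδ'
  have h2 : Tendsto (fun η : ℝ => C * Complex.exp (π * Complex.I * (η * Complex.I) ^ 2) *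
      (η / (1 - Complex.exp (2 * π * b * Complex.I * η))) *
      Complex.exp (-logPhi b (η * Complex.I + b * Complex.I - cB b))) (𝓝[>] 0)
      (𝓝 (C * 1 * (-(2 * π * b * Complex.I))⁻¹ *
        Complex.exp (-logPhi b (b * Complex.I - cB b)))) := by
    refine Tendsto.mul (Tendsto.mul (Tendsto.const_mul C ?_)
      (tendsto_div_one_sub_exp (by simp [hbc, hpi]))) ?_
    · have : Continuous fun η : ℝ => Complex.exp (π * Complex.I * (η * Complex.I) ^ 2) := by
        fun_prop
      simpa using (this.tendsto 0).mono_left nhdsWithin_le_nhds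
    · have hd : ContinuousAt (logPhi b) (b * Complex.I - cB b) :=
        (differentiableAt_logPhi hb hb1 (by
          rw [sub_cB_im, show ((b : ℂ) * Complex.I).im = b by simp]
          have : |b - (b + b⁻¹) / 2| < (b + b⁻¹) / 2 := abs_lt.2 ⟨by linarith, by
            have : b ≤ b⁻¹ := hb1.trans ((one_le_inv₀ hb).2 hb1)
            linarith⟩
          linarith)).continuousAt
      have hc : Tendsto (fun η : ℝ => (η : ℂ) * Complex.I + b * Complex.I - cB b) (𝓝[>] 0)
          (𝓝 (b * Complex.I - cB b)) := by
        have : Continuous fun η : ℝ => (η : ℂ) * Complex.I + b * Complex.I - cB b := by fun_prop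
        simpa using (this.tendsto 0).mono_left nhdsWithin_le_nhds
      exact (Complex.continuous_exp.tendsto _).comp (hd.tendsto.comp hc).neg
  have h3 := tendsto_nhds_unique h1 (h2.congr' ?_)
  · have n1 := Complex.exp_ne_zero (logPhi b (b * Complex.I - cB b))
    rw [Complex.exp_neg] at h3
    generalize Complex.exp (logPhi b (b * Complex.I - cB b)) = E at *
    have hI := Complex.I_ne_zero
    field_simp at h3
    linear_combination h3
  · filter_upwards [Ioo_mem_nhdsGT (lt_min hδ0 hbi)] with η hη
    have him : ((η : ℂ) * Complex.I).im = η := by simp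
    have e1 := hC δ (η * Complex.I) (by rw [him]; exact hη.1)
      (by rw [him]; exact hη.2.trans_le (min_le_left _ _)) hδ'
    have e2 := exp_logPhi_sub_cB hb hb1 (w := η * Complex.I) (by rw [him]; exact hη.1)
      (by rw [him]; exact hη.2.trans_le (min_le_right _ _))
    rw [fourierRatio, e2, Complex.exp_neg] at e1
    rw [← e1, Complex.exp_neg,
      show 2 * π * b * Complex.I * η = 2 * π * b * (η * Complex.I) by ring]
    have n0 : 1 - Complex.exp (2 * π * b * (η * Complex.I)) ≠ 0 := fun h0 =>
      Complex.exp_ne_zero (logPhi b (η * Complex.I - cB b)) (by rw [e2, h0, zero_mul])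
    have n1 := Complex.exp_ne_zero (logPhi b (η * Complex.I + b * Complex.I - cB b))
    have n2 := Complex.exp_ne_zero (π * Complex.I * (η * Complex.I) ^ 2)
    generalize Complex.exp (logPhi b (η * Complex.I + b * Complex.I - cB b)) = E₁ at *
    generalize Complex.exp (π * Complex.I * (η * Complex.I) ^ 2) = E₂ at *
    generalize Complex.exp (2 * π * b * (η * Complex.I)) = E₃ at *
    field_simp

lemma logPhi_special_im {b : ℝ} (hb : 0 < b) (hb1 : b ≤ 1) :
    (logPhi b (b * Complex.I - cB b)).im = π * (1 / 4 - (b ^ 2 + b⁻¹ ^ 2) / 12) := by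
  have hbi : 0 < b⁻¹ := inv_pos.2 hb
  have hbb : b ≤ b⁻¹ := hb1.trans ((one_le_inv₀ hb).2 hb1)
  set z := (b : ℂ) * Complex.I - cB b with hz
  have hz' : z = ((b - b⁻¹) / 2 : ℝ) * Complex.I := by rw [hz, cB]; push_cast; ring
  have hzim : z.im = (b - b⁻¹) / 2 := by rw [hz', Complex.im_ofReal_mul, Complex.I_im, mul_one]
  have hconj : (starRingEnd ℂ) z = -z := by
    rw [hz', map_mul, Complex.conj_ofReal, Complex.conj_I]; ring
  have h1 := conj_logPhi hb hb1 z
  have h2 := logPhi_add_logPhi_neg hb hb1 (z := z) (by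
    rw [hzim, abs_of_nonpos (by linarith)]; linarith)
  rw [hconj] at h1
  have hcc : (logPhi b z) - (starRingEnd ℂ) (logPhi b z) =
      π * Complex.I * (z ^ 2 + ((b : ℂ) ^ 2 + (b : ℂ)⁻¹ ^ 2) / 12) := by
    rw [h1, sub_neg_eq_add, h2]
  rw [Complex.sub_conj] at hcc
  have hbc : (b : ℂ) ≠ 0 := by exact_mod_cast hb.ne'
  have e : ((2 * (logPhi b z).im : ℝ) : ℂ) * Complex.I =
      ((2 * (π * (1 / 4 - (b ^ 2 + b⁻¹ ^ 2) / 12)) : ℝ) : ℂ) * Complex.I := by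
    rw [hcc, hz', mul_pow, Complex.I_sq]
    push_cast
    field_simp
    ring
  have := Complex.ofReal_injective (mul_right_cancel₀ Complex.I_ne_zero e)
  linarith

lemma fourier_const_polar {b : ℝ} (hb : 0 < b) (hb1 : b ≤ 1) {C : ℂ}
    (hC : ∀ (δ : ℝ) (w : ℂ), 0 < w.im → w.im < δ → 2 * δ < b + b⁻¹ → fourierRatio b δ w = C) :
    0 < ‖C‖ ∧ C = ‖C‖ * Complex.exp (-(π * Complex.I / 12) * (1 + ((b : ℂ) + (b : ℂ)⁻¹) ^ 2)) := by
  have h := fourier_const_eq hb hb1 hC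
  have hbc : (b : ℂ) ≠ 0 := by exact_mod_cast hb.ne'
  have hn : ‖C‖ = b * Real.exp (logPhi b (b * Complex.I - cB b)).re := by
    rw [h, norm_mul, norm_neg, norm_mul, Complex.norm_I, one_mul, Complex.norm_real,
      Real.norm_of_nonneg hb.le, Complex.norm_exp]
  refine ⟨by rw [hn]; positivity, ?_⟩
  rw [hn, h]
  conv_lhs => rw [← Complex.re_add_im (logPhi b (b * Complex.I - cB b)), logPhi_special_im hb hb1]
  rw [Complex.exp_add]
  have hI : -Complex.I = Complex.exp (-(π / 2 * Complex.I)) := by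
    rw [Complex.exp_neg, Complex.exp_pi_div_two_mul_I, Complex.inv_I]
  have e : -Complex.I * Complex.exp ((π * (1 / 4 - (b ^ 2 + b⁻¹ ^ 2) / 12) : ℝ) * Complex.I) =
      Complex.exp (-(π * Complex.I / 12) * (1 + ((b : ℂ) + (b : ℂ)⁻¹) ^ 2)) := by
    rw [hI, ← Complex.exp_add]; congr 1
    push_cast
    field_simp
    ring
  rw [← e]; push_cast; ring

end FourierConstant

section Plancherel
open FourierTransform

/-- Plancherel's identity for a continuous function that is integrable together with its Fourier
transform. -/
lemma integral_norm_sq_fourier_of_integrable {f : ℝ → ℂ} (hc : Continuous f) (hf : Integrable f)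
    (hF : Integrable (𝓕 f)) : ∫ ξ, ‖𝓕 f ξ‖ ^ 2 = ∫ x, ‖f x‖ ^ 2 := by
  have hinv := hc.fourierInv_fourier_eq hf hF
  have h := VectorFourier.integral_sesq_fourierIntegral_eq_neg_flip (innerSL ℂ)
    Real.continuous_fourierChar (L := innerₗ ℝ) (μ := volume) (ν := volume) continuous_inner hf hF
  have h2 : ∫ ξ, inner ℂ (𝓕 f ξ) (𝓕 f ξ) = ∫ x, inner ℂ (f x) (f x) := by
    refine h.trans ?_
    have e : VectorFourier.fourierIntegral Real.fourierChar volume (-(innerₗ ℝ).flip) (𝓕 f) =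
        𝓕⁻ (𝓕 f) := by
      rw [flip_innerₗ]; rfl
    simp only [e, hinv]
    rfl
  apply Complex.ofRealLI.injective
  simpa [← LinearIsometry.integral_comp_comm, inner_self_eq_norm_sq_to_K] using h2

end Plancherel

section PsiFunction
open Filter Topology FourierTransform

/-- The phase relating `psiF` to `fourierKer`, in terms of `q = b + b⁻¹`. -/
def psiPhase (q a c : ℝ) : ℝ := π * q ^ 2 * (a * (a + c) + (4 * (a - c) + 1) / 24)

lemma psiF_eq {b a c : ℝ} (hb : 0 < b) (ha : 0 < a) (hc : 0 < c)
    (hac : a + c < 1 / 2) (t : ℝ) :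
    psiF b a c t = Complex.exp (psiPhase (b + b⁻¹) a c * Complex.I) *
      fourierKer b (((b + b⁻¹) * a : ℝ) * Complex.I)
        (t + (-((b + b⁻¹) * (a + c)) : ℝ) * Complex.I) := by
  have hq : 0 < b + b⁻¹ := by positivity
  have hz : (t : ℂ) - 2 * cB b * (a + c) = t + (-((b + b⁻¹) * (a + c)) : ℝ) * Complex.I := by
    rw [cB]; push_cast; ring
  have him : ((t : ℂ) + (-((b + b⁻¹) * (a + c)) : ℝ) * Complex.I).im
      = -((b + b⁻¹) * (a + c)) := by
    rw [Complex.add_im, Complex.im_ofReal_mul, Complex.I_im, Complex.ofReal_im]; ring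
  have hPhi : Phi b (t + (-((b + b⁻¹) * (a + c)) : ℝ) * Complex.I) =
      Complex.exp (logPhi b (t + (-((b + b⁻¹) * (a + c)) : ℝ) * Complex.I)) := by
    rw [Phi, if_neg, if_neg, PhiS_eq_exp_logPhi]
    · rw [him]; nlinarith
    · rw [him]; nlinarith
  rw [psiF, hz, hPhi, fourierKer, ← Complex.exp_neg, ← Complex.exp_add, ← Complex.exp_add,
    ← Complex.exp_add, ← Complex.exp_add, psiPhase, cB]
  congr 1
  push_cast
  linear_combination (-(π * ((b : ℂ) + (b : ℂ)⁻¹) ^ 2 * Complex.I *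
    (a * (a + c) + (4 * (a - c) + 1) / 24))) * Complex.I_sq

lemma continuous_psiF {b a c : ℝ} (hb : 0 < b) (hb1 : b ≤ 1) (ha : 0 < a) (hc : 0 < c)
    (hac : a + c < 1 / 2) : Continuous fun t : ℝ => psiF b a c t := by
  have hq : 0 < b + b⁻¹ := by positivity
  simp_rw [psiF_eq hb ha hc hac]
  refine continuous_const.mul (continuous_fourierKer_line hb hb1 _ ?_)
  rw [abs_neg, abs_of_pos (by positivity)]
  nlinarith

lemma exists_norm_psiF_le {b a c : ℝ} (hb : 0 < b) (hb1 : b ≤ 1) (ha : 0 < a) (hc : 0 < c)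
    (hac : a + c < 1 / 2) :
    ∃ K κ : ℝ, 0 < κ ∧ ∀ t : ℝ, ‖psiF b a c t‖ ≤ K * Real.exp (-κ * |t|) := by
  have hq : 0 < b + b⁻¹ := by positivity
  refine ⟨Real.exp (logPhiBound b ((b + b⁻¹) * (a + c))), 2 * π * min ((b + b⁻¹) * a)
    ((b + b⁻¹) * c), by positivity, fun t => ?_⟩
  rw [psiF_eq hb ha hc hac, norm_mul, Complex.norm_exp_ofReal_mul_I, one_mul]
  refine (norm_fourierKer_le hb hb1 (Y := (b + b⁻¹) * (a + c)) (δ := (b + b⁻¹) * (a + c))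
    (ε := min ((b + b⁻¹) * a) ((b + b⁻¹) * c)) ?_ (by nlinarith) ?_ ?_ ?_).trans (le_of_eq ?_)
  · rw [Complex.add_im, Complex.im_ofReal_mul, Complex.I_im, Complex.ofReal_im, zero_add, mul_one,
      abs_neg, abs_of_pos (by positivity)]
  · rw [Complex.add_im, Complex.im_ofReal_mul, Complex.I_im, Complex.ofReal_im, zero_add, mul_one]
  · rw [Complex.im_ofReal_mul, Complex.I_im, mul_one]
    exact min_le_left _ _
  · rw [Complex.im_ofReal_mul, Complex.I_im, mul_one]
    exact (min_le_right _ _).trans (by linarith)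
  · rw [Complex.re_ofReal_mul, Complex.I_re, Complex.add_re, Complex.re_ofReal_mul, Complex.I_re,
      Complex.ofReal_re]
    simp

lemma integrable_psiF {b a c : ℝ} (hb : 0 < b) (hb1 : b ≤ 1) (ha : 0 < a) (hc : 0 < c)
    (hac : a + c < 1 / 2) : Integrable fun t : ℝ => psiF b a c t := by
  obtain ⟨K, κ, hκ, h⟩ := exists_norm_psiF_le hb hb1 ha hc hac
  exact ((integrable_exp_neg_mul_abs hκ).const_mul K).mono'
    (continuous_psiF hb hb1 ha hc hac).aestronglyMeasurable (Eventually.of_forall h)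

lemma fourier_psiF (b a c : ℝ) : 𝓕 (fun t : ℝ => psiF b a c t) = psiT b a c := by
  ext s
  rw [Real.fourier_real_eq_integral_exp_smul, psiT]
  congr 1 with t
  rw [smul_eq_mul, mul_comm]
  congr 2
  push_cast
  ring

lemma psiT_eq_fourierPhi {b a c : ℝ} (hb : 0 < b) (ha : 0 < a) (hc : 0 < c)
    (hac : a + c < 1 / 2) (s : ℝ) :
    psiT b a c s = Complex.exp (psiPhase (b + b⁻¹) a c * Complex.I +
      2 * π * s * ((b + b⁻¹) * (a + c) : ℝ)) *
      fourierPhi b ((b + b⁻¹) * (a + c)) (s + ((b + b⁻¹) * a : ℝ) * Complex.I) := by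
  rw [psiT, fourierPhi, ← integral_const_mul]
  congr 1 with t
  rw [psiF_eq hb ha hc hac, fourierKer, fourierKer]
  simp only [← Complex.exp_add]
  congr 1
  push_cast
  linear_combination (-2 * π * s * ((b : ℂ) + (b : ℂ)⁻¹) * (a + c)) * Complex.I_sq

lemma psiT_eq_of_fourierRatio_eq {b a c : ℝ} (hb : 0 < b) (ha : 0 < a) (hc : 0 < c)
    (hac : a + c < 1 / 2) {C : ℂ}
    (hC : ∀ (δ : ℝ) (w : ℂ), 0 < w.im → w.im < δ → 2 * δ < b + b⁻¹ → fourierRatio b δ w = C)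
    (s : ℝ) :
    psiT b a c s = C * Complex.exp (π * Complex.I * ((b : ℂ) + (b : ℂ)⁻¹) ^ 2 / 12) *
      Complex.exp (π * Complex.I * s ^ 2) * psiF b c (1 / 2 - a - c) s := by
  have hq : 0 < b + b⁻¹ := by positivity
  have him : ((s : ℂ) + ((b + b⁻¹) * a : ℝ) * Complex.I).im = (b + b⁻¹) * a := by
    rw [Complex.add_im, Complex.im_ofReal_mul, Complex.I_im, Complex.ofReal_im]; ring
  have h := hC ((b + b⁻¹) * (a + c)) (s + ((b + b⁻¹) * a : ℝ) * Complex.I)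
    (by rw [him]; positivity) (by rw [him]; nlinarith) (by nlinarith)
  have hw : (s : ℂ) + ((b + b⁻¹) * a : ℝ) * Complex.I - cB b =
      s + (-((b + b⁻¹) * (c + (1 / 2 - a - c))) : ℝ) * Complex.I := by
    rw [cB]; push_cast; ring
  rw [fourierRatio, hw] at h
  rw [psiT_eq_fourierPhi hb ha hc hac, psiF_eq hb hc (by linarith) (by linarith), ← h,
    fourierKer]
  set L := logPhi b (s + (-((b + b⁻¹) * (c + (1 / 2 - a - c))) : ℝ) * Complex.I)
  set F := fourierPhi b ((b + b⁻¹) * (a + c)) (s + ((b + b⁻¹) * a : ℝ) * Complex.I)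
  suffices hE : ∀ u1 u2 u3 u4 u5 u6 u7 u8 : ℂ, u1 = u2 + u3 + u4 + u5 + u6 + u7 + u8 →
      Complex.exp u1 * F = F * Complex.exp u2 * Complex.exp u3 * Complex.exp u4 * Complex.exp u5 *
        (Complex.exp u6 * (Complex.exp u7 * Complex.exp u8)) by
    refine hE _ _ _ _ _ _ _ _ ?_
    rw [psiPhase, psiPhase]
    push_cast
    linear_combination (π * ((b : ℂ) + (b : ℂ)⁻¹) * (((b : ℂ) + (b : ℂ)⁻¹) * Complex.I *
      (2 * a * c + a ^ 2 - c) + 2 * s * (a + c))) * Complex.I_sq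
  intro u1 u2 u3 u4 u5 u6 u7 u8 h
  rw [h]
  simp only [Complex.exp_add]
  ring
end PsiFunction

section FourierConstant
open Filter Topology FourierTransform

lemma psiF_ne_zero {b a c : ℝ} (hb : 0 < b) (ha : 0 < a) (hc : 0 < c)
    (hac : a + c < 1 / 2) (t : ℝ) : psiF b a c t ≠ 0 := by
  rw [psiF_eq hb ha hc hac, fourierKer]
  exact mul_ne_zero (Complex.exp_ne_zero _)
    (mul_ne_zero (Complex.exp_ne_zero _) (Complex.exp_ne_zero _))

lemma integrable_norm_sq_psiF {b a c : ℝ} (hb : 0 < b) (hb1 : b ≤ 1) (ha : 0 < a) (hc : 0 < c)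
    (hac : a + c < 1 / 2) : Integrable fun t : ℝ => ‖psiF b a c t‖ ^ 2 := by
  obtain ⟨K, κ, hκ, h⟩ := exists_norm_psiF_le hb hb1 ha hc hac
  have hb : ∀ t : ℝ, ‖‖psiF b a c t‖‖ ≤ |K| := fun t => by
    rw [norm_norm]
    refine (h t).trans ((mul_le_mul_of_nonneg_right (le_abs_self K) (Real.exp_pos _).le).trans
      (mul_le_of_le_one_right (abs_nonneg K) (Real.exp_le_one_iff.2 ?_)))
    rw [neg_mul, neg_nonpos]; positivity
  have hi := integrable_psiF ‹0 < b› hb1 ha hc hac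
  simp_rw [pow_two]
  exact hi.norm.bdd_mul (f := fun t : ℝ => ‖psiF b a c t‖) hi.norm.aestronglyMeasurable
    (Eventually.of_forall hb)

lemma fourierRatio_eq_of_lt_one {b : ℝ} (hb : 0 < b) (hb1 : b < 1) {δ : ℝ} {w : ℂ}
    (hw : 0 < w.im) (hwδ : w.im < δ) (hδ : 2 * δ < b + b⁻¹) :
    fourierRatio b δ w =
      Complex.exp (-(π * Complex.I / 12) * (1 + ((b : ℂ) + (b : ℂ)⁻¹) ^ 2)) := by
  obtain ⟨C, hC⟩ := exists_fourierRatio_eq hb hb1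
  obtain ⟨hpos, hpol⟩ := fourier_const_polar hb hb1.le hC
  have h6 : (0 : ℝ) < 1 / 6 := by norm_num
  have h66 : (1 / 6 : ℝ) + 1 / 6 < 1 / 2 := by norm_num
  have hi := integrable_psiF hb hb1.le h6 h6 h66
  have hcont := continuous_psiF hb hb1.le h6 h6 h66
  have hT : ∀ s : ℝ, psiT b (1 / 6) (1 / 6) s =
      C * Complex.exp (π * Complex.I * ((b : ℂ) + (b : ℂ)⁻¹) ^ 2 / 12) *
      Complex.exp (π * Complex.I * s ^ 2) * psiF b (1 / 6) (1 / 6) s := fun s => by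
    have := psiT_eq_of_fourierRatio_eq hb h6 h6 h66 hC s
    rwa [show (1 / 2 - 1 / 6 - 1 / 6 : ℝ) = 1 / 6 by norm_num] at this
  have hn : ∀ s : ℝ, ‖psiT b (1 / 6) (1 / 6) s‖ = ‖C‖ * ‖psiF b (1 / 6) (1 / 6) s‖ := fun s => by
    rw [hT, norm_mul, norm_mul, norm_mul,
      show π * Complex.I * ((b : ℂ) + (b : ℂ)⁻¹) ^ 2 / 12 =
        (π * (b + b⁻¹) ^ 2 / 12 : ℝ) * Complex.I by push_cast; ring,
      show π * Complex.I * (s : ℂ) ^ 2 = (π * s ^ 2 : ℝ) * Complex.I by push_cast; ring,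
      Complex.norm_exp_ofReal_mul_I, Complex.norm_exp_ofReal_mul_I, mul_one, mul_one]
  have hTi : Integrable (psiT b (1 / 6) (1 / 6)) := by
    refine (hi.norm.const_mul ‖C‖).mono' ?_ (Eventually.of_forall fun s => (hn s).le)
    rw [funext hT]
    exact Continuous.aestronglyMeasurable (by fun_prop)
  have hP := integral_norm_sq_fourier_of_integrable hcont hi (by rwa [fourier_psiF])
  have hpos2 : 0 < ∫ t : ℝ, ‖psiF b (1 / 6) (1 / 6) t‖ ^ 2 := by
    rw [integral_pos_iff_support_of_nonneg (fun t => by positivity)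
      (integrable_norm_sq_psiF hb hb1.le h6 h6 h66)]
    rw [show Function.support (fun t : ℝ => ‖psiF b (1 / 6) (1 / 6) t‖ ^ 2) = Set.univ by
      ext t; simpa using psiF_ne_zero hb h6 h6 h66 t]
    simp
  simp_rw [fourier_psiF, hn, mul_pow] at hP
  rw [integral_const_mul] at hP
  have h1 : ‖C‖ ^ 2 = 1 := mul_right_cancel₀ hpos2.ne' (by rw [hP, one_mul])
  have h2 : ‖C‖ = 1 := by nlinarith
  rw [hC δ w hw hwδ hδ, hpol, h2, Complex.ofReal_one, one_mul]

end FourierConstant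

section LimitAtOne
open Filter Topology

lemma two_le_add_inv_self {b : ℝ} (hb : 0 < b) : 2 ≤ b + b⁻¹ := by
  have h : b * b⁻¹ = 1 := mul_inv_cancel₀ hb.ne'
  nlinarith [sq_nonneg (b - b⁻¹), inv_pos.2 hb]

lemma eventually_half_lt_and_lt_one : ∀ᶠ b : ℝ in 𝓝[<] 1, 1 / 2 < b ∧ b < 1 :=
  Ioo_mem_nhdsLT (by norm_num)

lemma inv_pow_three_le {b : ℝ} (hb : 1 / 2 < b) : (b ^ 3)⁻¹ ≤ 8 := by
  have h : (1 / 2 : ℝ) ^ 3 ≤ b ^ 3 := by gcongr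
  calc (b ^ 3)⁻¹ ≤ ((1 / 2 : ℝ) ^ 3)⁻¹ := inv_anti₀ (by positivity) h
    _ = 8 := by norm_num

lemma tendsto_lineKer (t : ℝ) : Tendsto (fun b => lineKer b t) (𝓝[<] 1) (𝓝 (lineKer 1 t)) := by
  refine (ContinuousAt.tendsto ?_).mono_left nhdsWithin_le_nhds
  have h := lineKer_den_ne_zero one_pos le_rfl t
  unfold lineKer
  refine ContinuousAt.inv₀ ?_ h
  have h1 : ((1 : ℝ) : ℂ) ≠ 0 := by norm_num
  fun_prop (disch := assumption)

lemma tendsto_logPhi {z : ℝ → ℂ} {z₀ : ℂ} (hz : Tendsto z (𝓝[<] 1) (𝓝 z₀)) (hz₀ : |z₀.im| < 1) :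
    Tendsto (fun b => logPhi b (z b)) (𝓝[<] 1) (𝓝 (logPhi 1 z₀)) := by
  obtain ⟨Y, hY0, hY1⟩ := exists_between hz₀
  have hev : ∀ᶠ b in 𝓝[<] (1 : ℝ), |(z b).im| < Y :=
    ((Complex.continuous_im.tendsto z₀).comp hz).abs.eventually_lt_const hY0
  have hid : Tendsto (fun b : ℝ => (b : ℂ)) (𝓝[<] 1) (𝓝 ((1 : ℝ) : ℂ)) :=
    (Complex.continuous_ofReal.tendsto 1).mono_left nhdsWithin_le_nhds
  rw [logPhi_eq one_pos le_rfl]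
  have key : Tendsto (fun b : ℝ => Complex.exp (π * b * z b) *
      ∫ t : ℝ, lineKer b t * Complex.exp (-2 * Complex.I * z b * t)) (𝓝[<] 1)
      (𝓝 (Complex.exp (π * (1 : ℝ) * z₀) *
        ∫ t : ℝ, lineKer 1 t * Complex.exp (-2 * Complex.I * z₀ * t))) := by
    refine Tendsto.mul ((Complex.continuous_exp.tendsto _).comp
      ((hid.const_mul _).mul hz)) ?_
    refine tendsto_integral_filter_of_dominated_convergence
      (fun t : ℝ => 8 * Real.exp (-(2 - 2 * Y) * |t|)) ?_ ?_
      ((integrable_exp_neg_mul_abs (by linarith)).const_mul 8) ?_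
    · filter_upwards [eventually_half_lt_and_lt_one] with b hb
      have := continuous_lineKer (b := b) (by linarith) hb.2.le
      exact Continuous.aestronglyMeasurable (by fun_prop)
    · filter_upwards [eventually_half_lt_and_lt_one, hev] with b hb hbY
      refine Eventually.of_forall fun t => ?_
      have hb0 : 0 < b := by linarith
      refine (norm_lineKer_mul_exp_le hb0 hb.2.le _ t).trans ?_
      rw [re_neg_two_I_mul, abs_mul, abs_two]
      have := two_le_add_inv_self hb0
      gcongr
      exact inv_pow_three_le hb.1
    · refine Eventually.of_forall fun t => (tendsto_lineKer t).mul ?_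
      exact (Complex.continuous_exp.tendsto _).comp ((hz.const_mul _).mul_const _)
  refine key.congr' ?_
  filter_upwards [eventually_half_lt_and_lt_one] with b hb
  rw [logPhi_eq (by linarith) hb.2.le]

lemma tendsto_fourierPhi {w : ℂ} {δ : ℝ} (hw : 0 < w.im) (hwδ : w.im < δ) (hδ : δ < 1) :
    Tendsto (fun b => fourierPhi b δ w) (𝓝[<] 1) (𝓝 (fourierPhi 1 δ w)) := by
  have hδ0 : 0 < δ := hw.trans hwδ
  have hε : 0 < min w.im (δ - w.im) := lt_min hw (by linarith)
  have him : ∀ t : ℝ, ((t : ℂ) + (-δ : ℝ) * Complex.I).im = -δ := fun t => by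
    rw [Complex.add_im, Complex.im_ofReal_mul, Complex.I_im, Complex.ofReal_im, zero_add, mul_one]
  have hre : ∀ t : ℝ, ((t : ℂ) + (-δ : ℝ) * Complex.I).re = t := fun t => by
    rw [Complex.add_re, Complex.re_ofReal_mul, Complex.I_re, Complex.ofReal_re, mul_zero, add_zero]
  have hab : |-δ| = δ := by rw [abs_neg, abs_of_pos hδ0]
  refine tendsto_integral_filter_of_dominated_convergence
    (fun t : ℝ => Real.exp (8 * (2 / (2 - 2 * δ)) + 2 * π * (w.re * -δ)) *
      Real.exp (-(2 * π * min w.im (δ - w.im)) * |t|)) ?_ ?_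
      ((integrable_exp_neg_mul_abs (by positivity)).const_mul _) ?_
  · filter_upwards [eventually_half_lt_and_lt_one] with b hb
    have hb0 : 0 < b := by linarith
    have := two_le_add_inv_self hb0
    exact (continuous_fourierKer_line hb0 hb.2.le w
      (by rw [hab]; linarith)).aestronglyMeasurable
  · filter_upwards [eventually_half_lt_and_lt_one] with b hb
    refine Eventually.of_forall fun t => ?_
    have hb0 : 0 < b := by linarith
    have hq := two_le_add_inv_self hb0
    refine (norm_fourierKer_le hb0 hb.2.le (Y := δ) (δ := δ) (ε := min w.im (δ - w.im))
      (by rw [him, hab]) (by linarith) (him t).le (min_le_left _ _) (min_le_right _ _)).trans ?_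
    rw [him, hre, logPhiBound]
    have h2 : 0 < 2 - 2 * δ := by linarith
    gcongr
    · exact div_nonneg zero_le_two (by linarith)
    · exact inv_pow_three_le hb.1
  · refine Eventually.of_forall fun t => ?_
    refine Tendsto.mul_const _ ((Complex.continuous_exp.tendsto _).comp (Tendsto.neg ?_))
    exact tendsto_logPhi tendsto_const_nhds (by rw [him, hab]; exact hδ)

lemma fourierRatio_eq {b : ℝ} (hb : 0 < b) (hb1 : b ≤ 1) {δ : ℝ} {w : ℂ}
    (hw : 0 < w.im) (hwδ : w.im < δ) (hδ : 2 * δ < b + b⁻¹) :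
    fourierRatio b δ w =
      Complex.exp (-(π * Complex.I / 12) * (1 + ((b : ℂ) + (b : ℂ)⁻¹) ^ 2)) := by
  rcases hb1.lt_or_eq with hlt | rfl
  · exact fourierRatio_eq_of_lt_one hb hlt hw hwδ hδ
  have hδ1 : δ < 1 := by norm_num at hδ; linarith
  have h1 : ((1 : ℝ) : ℂ) ≠ 0 := by norm_num
  have hid : ContinuousAt (fun b : ℝ => (b : ℂ) + (b : ℂ)⁻¹) 1 := by
    fun_prop (disch := assumption)
  have hid' := hid.tendsto.mono_left (nhdsWithin_le_nhds (s := Set.Iio 1))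
  have hcB : Tendsto (fun b => w - cB b) (𝓝[<] 1) (𝓝 (w - cB 1)) := by
    have h1 : (1 : ℝ) ≠ 0 := one_ne_zero
    have hc : ContinuousAt (fun b : ℝ => w - ((b + b⁻¹) / 2 : ℝ) * Complex.I) 1 := by
      fun_prop (disch := assumption)
    simp_rw [cB_eq]
    exact hc.tendsto.mono_left nhdsWithin_le_nhds
  have hL : Tendsto (fun b => fourierRatio b δ w) (𝓝[<] 1) (𝓝 (fourierRatio 1 δ w)) := by
    refine ((tendsto_fourierPhi hw hwδ hδ1).mul_const _).mul
      ((Complex.continuous_exp.tendsto _).comp (tendsto_logPhi hcB ?_))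
    rw [sub_cB_im, abs_lt]
    constructor <;> norm_num <;> linarith
  have hR : Tendsto (fun b : ℝ => Complex.exp (-(π * Complex.I / 12) *
      (1 + ((b : ℂ) + (b : ℂ)⁻¹) ^ 2))) (𝓝[<] 1) (𝓝 (Complex.exp (-(π * Complex.I / 12) *
      (1 + (((1 : ℝ) : ℂ) + ((1 : ℝ) : ℂ)⁻¹) ^ 2)))) :=
    (Complex.continuous_exp.tendsto _).comp (((hid'.pow 2).const_add 1).const_mul _)
  refine tendsto_nhds_unique hL (hR.congr' ?_)
  filter_upwards [eventually_half_lt_and_lt_one] with b hb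
  have hb0 : 0 < b := by linarith
  have hq := two_le_add_inv_self hb0
  rw [fourierRatio_eq_of_lt_one hb0 hb.2 hw hwδ (by linarith)]

end LimitAtOne

section Rotation
open Filter Topology FourierTransform Asymptotics

lemma psiT_eq {b a c : ℝ} (hb : 0 < b) (hb1 : b ≤ 1) (ha : 0 < a) (hc : 0 < c)
    (hac : a + c < 1 / 2) (s : ℝ) :
    psiT b a c s = Complex.exp (-π * Complex.I / 12) * Complex.exp (π * Complex.I * s ^ 2) *
      psiF b c (1 / 2 - a - c) s := by
  rw [psiT_eq_of_fourierRatio_eq hb ha hc hac fun δ w => fourierRatio_eq hb hb1 (δ := δ) (w := w),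
    ← Complex.exp_add]
  congr 3
  ring

lemma psiT'_eq {b a c : ℝ} (hb : 0 < b) (hb1 : b ≤ 1) (ha : 0 < a) (hc : 0 < c)
    (hac : a + c < 1 / 2) (s : ℝ) :
    psiT' b a c s = Complex.exp (-π * Complex.I / 12) * psiF b c (1 / 2 - a - c) s := by
  rw [psiT', psiT_eq hb hb1 ha hc hac, ← mul_assoc, mul_left_comm, ← Complex.exp_add,
    show -π * Complex.I * (s : ℂ) ^ 2 + π * Complex.I * s ^ 2 = 0 by ring, Complex.exp_zero,
    mul_one]

lemma isBigO_rpow_of_exp_decay {f : ℝ → ℂ} {K κ x : ℝ} (hκ : 0 < κ)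
    (hf : ∀ t : ℝ, ‖f t‖ ≤ K * Real.exp (-κ * |t + x|)) :
    f =O[cocompact ℝ] fun t => |t| ^ (-2 : ℝ) := by
  have hK : 0 ≤ K := nonneg_of_mul_nonneg_left ((norm_nonneg _).trans (hf 0)) (Real.exp_pos _)
  have hev : ∀ᶠ t : ℝ in cocompact ℝ, t ≠ 0 := by
    have := (isCompact_singleton (x := (0 : ℝ))).compl_mem_cocompact
    filter_upwards [this] with t ht using ht
  refine IsBigO.of_bound (K * Real.exp (κ * |x|) * (2 / κ ^ 2)) ?_
  filter_upwards [hev] with t ht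
  have ht0 : 0 < |t| := abs_pos.2 ht
  rw [Real.rpow_neg (abs_nonneg t), Real.rpow_two, Real.norm_of_nonneg (by positivity)]
  have h1 : (κ * |t|) ^ 2 / 2 ≤ Real.exp (κ * |t|) := by
    have := Real.quadratic_le_exp_of_nonneg (x := κ * |t|) (by positivity)
    have : 0 < κ * |t| := by positivity
    linarith
  have h2 : |t| - |x| ≤ |t + x| := by
    have := abs_sub_abs_le_abs_sub t (-x)
    rwa [abs_neg, sub_neg_eq_add] at this
  calc ‖f t‖ ≤ K * Real.exp (-κ * |t + x|) := hf t
    _ ≤ K * Real.exp (κ * |x| + -(κ * |t|)) := by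
      gcongr
      nlinarith
    _ = K * Real.exp (κ * |x|) * (Real.exp (κ * |t|))⁻¹ := by
      rw [Real.exp_add, Real.exp_neg]; ring
    _ ≤ K * Real.exp (κ * |x|) * ((κ * |t|) ^ 2 / 2)⁻¹ := by
      gcongr
    _ = _ := by field_simp

/-- Translation and modulation under the Fourier transform of `psiF`. -/
lemma fourier_psiF_translate_modulate (b a c x y ξ : ℝ) :
    𝓕 (fun t : ℝ => psiF b a c (t + x : ℝ) * Complex.exp (2 * π * Complex.I * y * t)) ξ =
      Complex.exp ((2 * π * (ξ - y) * x : ℝ) * Complex.I) * psiT b a c (ξ - y) := by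
  rw [Real.fourier_real_eq_integral_exp_smul, psiT, ← integral_const_mul]
  refine Eq.trans ?_ (integral_add_right_eq_self _ x)
  congr 1 with t
  rw [smul_eq_mul, mul_left_comm, mul_left_comm (Complex.exp _) (psiF b a c _), ← Complex.exp_add,
    ← Complex.exp_add]
  congr 2
  push_cast
  ring

lemma tsum_psiF_eq {b a c : ℝ} (hb : 0 < b) (hb1 : b ≤ 1) (ha : 0 < a) (hc : 0 < c)
    (hac : a + c < 1 / 2) (x y : ℝ) :
    ∑' m : ℤ, psiF b a c (m + x : ℝ) * Complex.exp (2 * π * Complex.I * y * m) =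
      ∑' m : ℤ, Complex.exp ((2 * π * (m - y) * x : ℝ) * Complex.I) * psiT b a c (m - y) := by
  have hcont := continuous_psiF hb hb1 ha hc hac
  obtain ⟨K, κ, hκ, hK⟩ := exists_norm_psiF_le hb hb1 ha hc hac
  obtain ⟨K', κ', hκ', hK'⟩ := exists_norm_psiF_le hb hb1 hc (c := 1 / 2 - a - c) (by linarith)
    (by linarith)
  set F : ℝ → ℂ := fun t => psiF b a c (t + x : ℝ) * Complex.exp (2 * π * Complex.I * y * t) with hF
  have hFc : Continuous F := (hcont.comp (continuous_id.add continuous_const)).mul (by fun_prop)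
  have hFt : 𝓕 F = fun ξ => Complex.exp ((2 * π * (ξ - y) * x : ℝ) * Complex.I) *
      psiT b a c (ξ - y) := funext (fourier_psiF_translate_modulate b a c x y)
  have h1 : F =O[cocompact ℝ] fun t => |t| ^ (-2 : ℝ) := by
    refine isBigO_rpow_of_exp_decay hκ (K := K) (x := x) fun t => ?_
    rw [hF, norm_mul, show 2 * π * Complex.I * y * t = (2 * π * y * t : ℝ) * Complex.I by
      push_cast; ring, Complex.norm_exp_ofReal_mul_I, mul_one]
    exact hK _
  have h2 : 𝓕 F =O[cocompact ℝ] fun t => |t| ^ (-2 : ℝ) := by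
    refine isBigO_rpow_of_exp_decay hκ' (K := K') (x := -y) fun t => ?_
    rw [hFt, norm_mul, Complex.norm_exp_ofReal_mul_I, one_mul, psiT_eq hb hb1 ha hc hac, norm_mul,
      norm_mul, show -π * Complex.I / 12 = (-π / 12 : ℝ) * Complex.I by push_cast; ring,
      show π * Complex.I * ((t - y : ℝ) : ℂ) ^ 2 = (π * (t - y) ^ 2 : ℝ) * Complex.I by
        push_cast; ring, Complex.norm_exp_ofReal_mul_I, Complex.norm_exp_ofReal_mul_I, one_mul,
      one_mul, ← sub_eq_add_neg]
    exact hK' _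
  have h := Real.tsum_eq_tsum_fourier_of_rpow_decay hFc one_lt_two h1 h2 0
  rw [hFt] at h
  simpa [hF] using h

lemma exp_pi_mul_I_int_parity (k : ℤ) :
    Complex.exp (π * Complex.I * (k - k ^ 2)) = 1 := by
  obtain ⟨n, hn⟩ : Even (k - k ^ 2) := by
    rw [Int.even_sub]; simp [Int.even_pow]
  rw [show (π * Complex.I * (k - k ^ 2) : ℂ) = n * (2 * π * Complex.I) by
    have : ((k - k ^ 2 : ℤ) : ℂ) = ((n + n : ℤ) : ℂ) := by rw [hn]
    push_cast at this
    rw [this]; ring]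
  exact Complex.exp_int_mul_two_pi_mul_I n

lemma gW_eq_of_le_one {b a c : ℝ} (hb : 0 < b) (hb1 : b ≤ 1) (ha : 0 < a) (hc : 0 < c)
    (hac : a + c < 1 / 2) (x y : ℝ) :
    gW b a c x y = Complex.exp (-π * Complex.I / 12) *
      gW b c (1 / 2 - a - c) (-y) (x - y + 1 / 2) * Complex.exp (π * Complex.I * y / 2) := by
  have h := tsum_psiF_eq hb hb1 hc (c := 1 / 2 - a - c) (by linarith) (by linarith) x y
  have h1 : gW b a c x y = Complex.exp (-π * Complex.I / 12) * (Complex.exp (Complex.I * π * y * x) *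
      ∑' m : ℤ, psiF b c (1 / 2 - a - c) (m + x : ℝ) * Complex.exp (2 * π * Complex.I * y * m)) := by
    rw [gW, ← tsum_mul_left, ← tsum_mul_left]
    congr 1 with m
    rw [psiT'_eq hb hb1 ha hc hac, mul_assoc, mul_left_comm (Complex.exp (Complex.I * π * y * x)),
      ← Complex.exp_add, add_comm x]
    congr 3
    ring
  rw [h1, h, gW, mul_assoc (Complex.exp (-π * Complex.I / 12)), ← tsum_mul_left, ← tsum_mul_right]
  congr 2 with m
  rw [psiT', show (-y + m : ℝ) = m - y by ring]
  set T := psiT b c (1 / 2 - a - c) (m - y)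
  rw [← mul_assoc, ← Complex.exp_add, mul_right_comm _ T, mul_right_comm _ T, ← Complex.exp_add,
    ← Complex.exp_add]
  congr 1
  rw [← mul_one (Complex.exp _), ← exp_pi_mul_I_int_parity m, ← Complex.exp_add]
  congr 1
  push_cast
  ring

end Rotation

section Inversion

lemma cB_inv (b : ℝ) : cB b⁻¹ = cB b := by
  rw [cB, cB, inv_inv, add_comm]

lemma PhiS_inv (b : ℝ) (z : ℂ) : PhiS b⁻¹ z = PhiS b z := by
  have h : phiKer b⁻¹ z = phiKer b z := by
    ext w
    rw [phiKer, phiKer, Complex.ofReal_inv, div_inv_eq_mul, ← div_eq_mul_inv]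
    congr 1
    ring
  rw [PhiS, PhiS, h, inv_inv, min_comm]

lemma Phi_of_mem_strip {b : ℝ} {z : ℂ} (hz : |z.im| < (b + b⁻¹) / 2) : Phi b z = PhiS b z := by
  obtain ⟨h1, h2⟩ := abs_lt.1 hz
  rw [Phi, if_neg h1.not_ge, if_neg h2.not_ge]

lemma psiF_inv {b a c : ℝ} (hb : 0 < b) (ha : 0 < a) (hc : 0 < c) (hac : a + c < 1 / 2) (t : ℝ) :
    psiF b⁻¹ a c t = psiF b a c t := by
  have hq : 0 < b + b⁻¹ := by positivity
  have him : ((t : ℂ) - 2 * cB b * (a + c)).im = -((b + b⁻¹) * (a + c)) := by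
    rw [cB_eq, show (t : ℂ) - 2 * (((b + b⁻¹) / 2 : ℝ) * Complex.I) * (a + c) =
      t + (-((b + b⁻¹) * (a + c)) : ℝ) * Complex.I by push_cast; ring, Complex.add_im,
      Complex.im_ofReal_mul, Complex.I_im, Complex.ofReal_im]
    ring
  have hz : |((t : ℂ) - 2 * cB b * (a + c)).im| < (b + b⁻¹) / 2 := by
    rw [him, abs_neg, abs_of_pos (by positivity)]
    nlinarith
  rw [psiF, psiF, cB_inv, Phi_of_mem_strip hz, Phi_of_mem_strip (by rwa [inv_inv, add_comm b⁻¹]),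
    PhiS_inv]

lemma gW_inv {b a c : ℝ} (hb : 0 < b) (ha : 0 < a) (hc : 0 < c) (hac : a + c < 1 / 2) (x y : ℝ) :
    gW b⁻¹ a c x y = gW b a c x y := by
  simp only [gW, psiT', psiT, psiF_inv hb ha hc hac]

lemma gW_eq {b a c : ℝ} (hb : 0 < b) (ha : 0 < a) (hc : 0 < c)
    (hac : a + c < 1 / 2) (x y : ℝ) :
    gW b a c x y = Complex.exp (-π * Complex.I / 12) *
      gW b c (1 / 2 - a - c) (-y) (x - y + 1 / 2) * Complex.exp (π * Complex.I * y / 2) := by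
  rcases le_total b 1 with h | h
  · exact gW_eq_of_le_one hb h ha hc hac x y
  · have := gW_eq_of_le_one (inv_pos.2 hb) (inv_le_one_of_one_le₀ h) ha hc hac x y
    rwa [gW_inv hb ha hc hac, gW_inv hb hc (by linarith) (by linarith)] at this

end Inversion

/-- Eq. (27) of the paper (rotation symmetry of the tetrahedral weight):
`g_{a,c}(x,y) = e^{iπ/12} g_{b,a}(y-x-1/2, -x) e^{πix/2}`, equivalently
`g_{a,c}(x,y) = e^{-iπ/12} g_{c,b}(-y, x-y+1/2) e^{πiy/2}`, with `b = 1/2 - a - c`. -/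
theorem gW_rotation_symmetry (bb : ℝ) (hbb : 0 < bb) (a c : ℝ)
    (ha : 0 < a) (hc : 0 < c) (hb : 0 < 1 / 2 - a - c) (x y : ℝ) :
    gW bb a c x y =
      Complex.exp (π * Complex.I / 12) * gW bb (1 / 2 - a - c) a (y - x - 1 / 2) (-x) *
        Complex.exp (π * Complex.I * x / 2) ∧
    gW bb a c x y =
      Complex.exp (-π * Complex.I / 12) * gW bb c (1 / 2 - a - c) (-y) (x - y + 1 / 2) *
        Complex.exp (π * Complex.I * y / 2) := by
  refine ⟨?_, gW_eq hbb ha hc (by linarith) x y⟩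
  have h := gW_eq hbb hb ha (by linarith) (y - x - 1 / 2) (-x)
  rw [show (1 / 2 - (1 / 2 - a - c) - a : ℝ) = c by ring, neg_neg,
    show (y - x - 1 / 2 - -x + 1 / 2 : ℝ) = y by ring] at h
  have e : Complex.exp (π * Complex.I / 12) * Complex.exp (-π * Complex.I / 12) *
      (Complex.exp (π * Complex.I * (-x : ℝ) / 2) * Complex.exp (π * Complex.I * x / 2)) = 1 := by
    simp only [← Complex.exp_add]
    rw [← Complex.exp_zero]
    congr 1
    push_cast
    ring
  rw [h]
  linear_combination -(gW bb a c x y) * e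
end
end

section
/- The Weil–Gel'fand–Zak transform is an isometry: for any Schwartz function f on ℝ, one has ∫_0^1 ∫_0^1 |(Wf)(x, y)|² dx dy = ∫_ℝ |f(x)|² dx. -/
open Real MeasureTheory

noncomputable section

/-- The Weil–Gel'fand–Zak transform: `(Wf)(x,y) = e^{πixy} Σ_{m∈ℤ} f(x+m) e^{2πimy}`. -/
def WGZ (f : ℝ → ℂ) (x y : ℝ) : ℂ :=
  Complex.exp (π * Complex.I * x * y) *
    ∑' m : ℤ, f (x + m) * Complex.exp (2 * π * Complex.I * m * y)

/-- The translates of a Schwartz function by integers are summable, uniformly on `[0, 1]`. -/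
lemma SchwartzMap.exists_summable_bound_comp_add_int (f : SchwartzMap ℝ ℂ) :
    ∃ u : ℤ → ℝ, Summable u ∧ ∀ m : ℤ, ∀ x ∈ Set.Icc (0 : ℝ) 1, ‖f (x + m)‖ ≤ u m := by
  let K : TopologicalSpace.Compacts ℝ := ⟨Set.Icc 0 1, isCompact_Icc⟩
  let F : C(ℝ, ℂ) := ⟨f, f.continuous⟩
  refine ⟨fun m => ‖(F.comp (ContinuousMap.addRight (m : ℝ))).restrict K‖,
    summable_of_isBigO (Real.summable_abs_int_rpow one_lt_two)
      ((isBigO_norm_restrict_cocompact F two_pos (f.isBigO_cocompact_rpow (-2)) K).comp_tendsto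
        Int.tendsto_coe_cofinite), fun m x hx => ?_⟩
  exact ContinuousMap.norm_coe_le_norm
    ((F.comp (ContinuousMap.addRight (m : ℝ))).restrict K) ⟨x, hx⟩

/-- **Parseval's identity** for an absolutely convergent Fourier series. -/
lemma integral_norm_sq_tsum_fourier {a : ℤ → ℂ} (ha : Summable fun m => ‖a m‖) :
    ∫ y in (0 : ℝ)..1, ‖∑' m : ℤ, a m * fourier m (y : UnitAddCircle)‖ ^ 2 =
      ∑' m : ℤ, ‖a m‖ ^ 2 := by
  have hs : Summable fun m : ℤ => a m • (fourier m : C(UnitAddCircle, ℂ)) :=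
    .of_norm (by simpa only [norm_smul, fourier_norm, mul_one] using ha)
  set F : C(UnitAddCircle, ℂ) := ∑' m : ℤ, a m • (fourier m : C(UnitAddCircle, ℂ))
  set G := ContinuousMap.toLp (E := ℂ) 2 (AddCircle.haarAddCircle (T := 1)) ℂ F
  have hFG : (G : UnitAddCircle → ℂ) =ᵐ[AddCircle.haarAddCircle] F :=
    ContinuousMap.coeFn_toLp _ F
  have hsum : HasSum (fun m : ℤ => a m • (fourierLp 2 m : Lp ℂ 2 AddCircle.haarAddCircle)) G := by
    simpa [Function.comp_def, fourierLp] using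
      (ContinuousMap.toLp (E := ℂ) 2 (AddCircle.haarAddCircle (T := 1)) ℂ).hasSum hs.hasSum
  have hcoeff (n : ℤ) : fourierCoeff G n = a n := by
    rw [← fourierBasis_repr, HilbertBasis.repr_apply_apply, coe_fourierBasis]
    have h := (innerSL ℂ (fourierLp 2 n : Lp ℂ 2 (AddCircle.haarAddCircle (T := 1)))).hasSum hsum
    have hterm : (fun m : ℤ => innerSL ℂ (fourierLp 2 n : Lp ℂ 2 (AddCircle.haarAddCircle (T := 1)))
        (a m • fourierLp 2 m)) = fun m => if m = n then a n else 0 := by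
      funext m
      rw [innerSL_apply_apply, inner_smul_right,
        orthonormal_iff_ite.mp (orthonormal_fourier (T := 1)) n m]
      rcases eq_or_ne m n with rfl | hmn
      · rw [if_pos rfl, if_pos rfl, mul_one]
      · rw [if_neg hmn.symm, if_neg hmn, mul_zero]
    rw [hterm] at h
    exact h.unique (hasSum_ite_eq n (a n))
  have hpt (t : UnitAddCircle) : F t = ∑' m : ℤ, a m * fourier m t := by
    simpa using ((ContinuousMap.evalCLM ℂ t).hasSum hs.hasSum).tsum_eq.symm
  calc
    _ = ∫ y in (0 : ℝ)..0 + 1, ‖F (y : UnitAddCircle)‖ ^ 2 := by simp [hpt]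
    _ = ∫ t : UnitAddCircle, ‖F t‖ ^ 2 :=
      UnitAddCircle.intervalIntegral_preimage 0 fun t => ‖F t‖ ^ 2
    _ = ∫ t : UnitAddCircle, ‖G t‖ ^ 2 ∂AddCircle.haarAddCircle := by
      rw [integral_congr_ae (g := fun t => ‖F t‖ ^ 2) (hFG.mono fun t ht => by simp only [ht]),
        AddCircle.integral_haarAddCircle, inv_one, one_smul]
    _ = ∑' m : ℤ, ‖a m‖ ^ 2 := by rw [← tsum_sq_fourierCoeff]; simp_rw [hcoeff]

lemma norm_WGZ (f : ℝ → ℂ) (x y : ℝ) :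
    ‖WGZ f x y‖ = ‖∑' m : ℤ, f (x + m) * fourier m (y : UnitAddCircle)‖ := by
  have h : (π * Complex.I * x * y : ℂ) = (π * x * y : ℝ) * Complex.I := by push_cast; ring
  rw [WGZ, norm_mul, h, Complex.norm_exp_ofReal_mul_I, one_mul]
  simp

lemma SchwartzMap.continuousOn_norm_WGZ (f : SchwartzMap ℝ ℂ) :
    ContinuousOn (fun p : ℝ × ℝ => ‖WGZ f p.2 p.1‖ ^ 2)
      (Set.Icc (0 : ℝ) 1 ×ˢ Set.Icc (0 : ℝ) 1) := by
  obtain ⟨u, hu, hfu⟩ := f.exists_summable_bound_comp_add_int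
  simp_rw [norm_WGZ]
  refine (ContinuousOn.norm (continuousOn_tsum (fun m => ?_) hu fun m p hp => ?_)).pow 2
  · have := f.continuous
    have h : Continuous fun p : ℝ × ℝ => fourier m (p.1 : UnitAddCircle) :=
      (fourier m).continuous.comp ((AddCircle.continuous_mk' 1).comp continuous_fst)
    exact ((this.comp (by fun_prop)).mul h).continuousOn
  · rw [norm_mul, fourier_apply, Circle.norm_coe, mul_one]
    exact hfu m _ hp.2

/-- The Weil–Gel'fand–Zak transform is an isometry:
`∫_0^1∫_0^1 |(Wf)(x,y)|² dx dy = ∫_ℝ |f(x)|² dx`. -/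
theorem WGZ_isometry (f : SchwartzMap ℝ ℂ) :
    (∫ y in (0:ℝ)..1, ∫ x in (0:ℝ)..1, ‖WGZ ⇑f x y‖ ^ 2) = ∫ x : ℝ, ‖f x‖ ^ 2 := by
  obtain ⟨u, hu, hfu⟩ := f.exists_summable_bound_comp_add_int
  have hu2 : Summable fun m => u m ^ 2 := by
    have hu0 (m : ℤ) : 0 ≤ u m := (norm_nonneg _).trans (hfu m 0 (by simp))
    simpa only [sq, Function.comp_def] using (hu.mul_of_nonneg hu hu0 hu0).comp_injective
      (i := fun m => (m, m)) fun _ _ h => congrArg Prod.fst h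
  have hle (m : ℤ) (x : ℝ) (hx : x ∈ Set.Icc (0 : ℝ) 1) : ‖f (x + m)‖ ^ 2 ≤ u m ^ 2 := by
    gcongr
    exact hfu m x hx
  have hIcc {x : ℝ} (hx : x ∈ Set.uIoc (0 : ℝ) 1) : x ∈ Set.Icc (0 : ℝ) 1 := by
    rw [Set.uIoc_of_le zero_le_one] at hx
    exact Set.Ioc_subset_Icc_self hx
  rw [intervalIntegral_intervalIntegral_swap]
  swap
  · exact (f.continuousOn_norm_WGZ.integrableOn_compact
      (isCompact_Icc.prod isCompact_Icc)).mono_set fun p hp => ⟨hIcc hp.1, hIcc hp.2⟩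
  have hinner : ∫ x in (0 : ℝ)..1, ∫ y in (0 : ℝ)..1, ‖WGZ f x y‖ ^ 2 =
      ∫ x in (0 : ℝ)..1, ∑' m : ℤ, ‖f (x + m)‖ ^ 2 := by
    refine intervalIntegral.integral_congr fun x hx => ?_
    rw [Set.uIcc_of_le zero_le_one] at hx
    simp only [norm_WGZ]
    exact integral_norm_sq_tsum_fourier
      (hu.of_nonneg_of_le (fun _ => norm_nonneg _) fun m => hfu m x hx)
  rw [hinner]
  have hsum : HasSum (fun m : ℤ => ∫ x in (0 : ℝ)..1, ‖f (x + m)‖ ^ 2)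
      (∫ x in (0 : ℝ)..1, ∑' m : ℤ, ‖f (x + m)‖ ^ 2) := by
    refine intervalIntegral.hasSum_integral_of_dominated_convergence (fun m _ => u m ^ 2)
      (fun m => ?_) (fun m => ae_of_all _ fun x hx => ?_) (ae_of_all _ fun _ _ => hu2)
      intervalIntegrable_const (ae_of_all _ fun x hx => ?_)
    · have := f.continuous
      exact (by fun_prop : Continuous fun x : ℝ => ‖f (x + m)‖ ^ 2).aestronglyMeasurable
    · rw [Real.norm_of_nonneg (by positivity)]
      exact hle m x (hIcc hx)
    · exact (hu2.of_nonneg_of_le (fun _ => by positivity) fun m => hle m x (hIcc hx)).hasSum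
  have hint : Integrable fun x : ℝ => ‖f x‖ ^ 2 :=
    (f.memLp 2 volume).integrable_norm_pow two_ne_zero
  exact hsum.unique hint.hasSum_intervalIntegral_comp_add_int
end
end
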